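/- For every constant C₀ < 1/2 there exists δ > 0 such that for every quasisymmetric homeomorphism φ of ℝP¹ with cross-ratio norm ‖φ‖_cr < δ, the minimal Lagrangian extension Φ_ML: ℍ² → ℍ² of φ has maximal dilatation K(Φ_ML) satisfying C₀ · ‖φ‖_cr ≤ ln K(Φ_ML). -/

import Mathlib

/-!
Common framework for formalizing "Maximal surfaces in Anti-de Sitter space, width of
convex hulls and quasiconformal extensions of quasisymmetric homeomorphisms" (A. Seppi).

Anti-de Sitter space is modeled projectively: `qform` is the bilinear form of
signature (2,2) on ℝ⁴, `AdS3` is the projectivization of its negative cone,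
and spacelike surfaces are recorded through (lifts of) smooth spacelike embeddings
of ℝ² into the quadric {⟨x,x⟩ = -1} (the double cover of AdS³), together with a
future-directed unit normal field and the associated shape operator.
-/

noncomputable section

open Real Set Filter Topology

namespace AdSPaper

/-- The bilinear form of signature `(2,2)` on `ℝ⁴`. -/
def qform (x y : Fin 4 → ℝ) : ℝ :=
  x 0 * y 0 + x 1 * y 1 - x 2 * y 2 - x 3 * y 3

/-- Quotient topology on a projectivization. -/
instance (K V : Type*) [DivisionRing K] [AddCommGroup V] [Module K V] [TopologicalSpace V] :
    TopologicalSpace (Projectivization K V) := by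
  unfold Projectivization
  infer_instance

/-- Real projective 3-space. -/
abbrev RP3 := Projectivization ℝ (Fin 4 → ℝ)

/-- The real projective line. -/
abbrev RP1 := Projectivization ℝ (Fin 2 → ℝ)

/-- The point of `ℝP³` determined by a nonzero vector of `ℝ⁴`. -/
def projPt (x : Fin 4 → ℝ) (hx : x ≠ 0) : RP3 := Projectivization.mk ℝ x hx

/-- Anti-de Sitter space: the projectivization of the negative cone of `qform`.
(The sign of `qform x x` does not depend on the chosen representative.) -/
def AdS3 : Set RP3 := {P | qform P.rep P.rep < 0}

/-- The boundary at infinity of Anti-de Sitter space: the projectivization of the null cone. -/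
def bdryAdS3 : Set RP3 := {P | qform P.rep P.rep = 0}

/-- The nonzero lifts of a subset of `ℝP³`. -/
def lifts (Γ : Set RP3) : Set (Fin 4 → ℝ) :=
  {x | ∃ hx : x ≠ 0, projPt x hx ∈ Γ}

/-- The (projective) convex hull of a set `Γ ⊆ ℝP³` contained in an affine chart:
the image of the convex hull of a coherent family of lifts of `Γ`, chosen on the positive
side of a linear hyperplane avoiding all lifts of `Γ` (i.e. an affine chart containing `Γ`). -/
def projConvexHull (Γ : Set RP3) : Set RP3 :=
  {P | ∃ L : (Fin 4 → ℝ) →ₗ[ℝ] ℝ, (∀ x ∈ lifts Γ, L x ≠ 0) ∧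
      ∃ (y : Fin 4 → ℝ) (hy : y ≠ 0), projPt y hy = P ∧
        y ∈ convexHull ℝ {x | x ∈ lifts Γ ∧ 0 < L x}}

/-- The width of (the convex hull of) a set `Γ ⊆ ℝP³`: the supremum of the lengths of
timelike geodesic segments `t ↦ [cos t • a + sin t • b]` contained in the convex hull of `Γ`. -/
def width (Γ : Set RP3) : ℝ :=
  sSup {T : ℝ | 0 ≤ T ∧ T < π ∧ ∃ a b : Fin 4 → ℝ,
      qform a a = -1 ∧ qform b b = -1 ∧ qform a b = 0 ∧
      ∀ t ∈ Icc (0 : ℝ) T, ∃ h : (Real.cos t • a + Real.sin t • b) ≠ 0,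
        projPt (Real.cos t • a + Real.sin t • b) h ∈ projConvexHull Γ}

/-- Inverse hyperbolic cosine. -/
def arcosh (x : ℝ) : ℝ := Real.log (x + Real.sqrt (x ^ 2 - 1))

/-! ### The projective line, cross-ratios and quasisymmetric homeomorphisms -/

/-- Determinant of a pair of vectors of ℝ². -/
def det2 (v w : Fin 2 → ℝ) : ℝ := v 0 * w 1 - v 1 * w 0

/-- The cross-ratio of a quadruple of points of `ℝP¹`, with the convention
`cr(z₁,z₂,z₃,z₄) = (z₄−z₁)(z₃−z₂)/((z₂−z₁)(z₃−z₄))`.  (The expression below is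
invariant under rescaling of each of the four representatives.) -/
def crossRatio (z₁ z₂ z₃ z₄ : RP1) : ℝ :=
  (det2 z₄.rep z₁.rep * det2 z₃.rep z₂.rep) / (det2 z₂.rep z₁.rep * det2 z₃.rep z₄.rep)

/-- The cyclic orientation invariant of a triple of points of `ℝP¹`
(for finite points `a,b,c` it equals `(a−b)(b−c)(c−a)` and its sign is scale invariant). -/
def tripleOrient (a b c : RP1) : ℝ :=
  det2 a.rep b.rep * det2 b.rep c.rep * det2 c.rep a.rep

/-- A map of `ℝP¹` is orientation-preserving if it preserves the cyclic orientation
of triples of points. -/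
def OrientationPreserving (φ : RP1 → RP1) : Prop :=
  ∀ a b c : RP1, 0 < tripleOrient a b c → 0 < tripleOrient (φ a) (φ b) (φ c)

/-- The set of cross-ratio distortions `|ln |cr(φ(Q))||` of symmetric quadruples
(`cr(Q) = -1`) under the map `φ`. -/
def crSet (φ : RP1 → RP1) : Set ℝ :=
  {r | ∃ z₁ z₂ z₃ z₄ : RP1, crossRatio z₁ z₂ z₃ z₄ = -1 ∧
      r = |Real.log (abs (crossRatio (φ z₁) (φ z₂) (φ z₃) (φ z₄)))|}

/-- The cross-ratio norm `‖φ‖_cr` of a circle map `φ`. -/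
def crNorm (φ : RP1 → RP1) : ℝ := sSup (crSet φ)

/-- A quasisymmetric homeomorphism of `ℝP¹`: an orientation-preserving homeomorphism
with finite cross-ratio norm. -/
def Quasisymmetric (φ : RP1 ≃ₜ RP1) : Prop :=
  OrientationPreserving ⇑φ ∧ BddAbove (crSet ⇑φ)

/-- The null vector of ℝ^{2,2} corresponding to the pair of lines `([v],[w]) ∈ ℝP¹ × ℝP¹`
under the standard identification of `∂∞AdS³` with `ℝP¹ × ℝP¹` (via the rank-one
2×2 matrix `v wᵀ`, identifying ℝ^{2,2} with 2×2 matrices with minus the determinant). -/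
def toBoundary (v w : Fin 2 → ℝ) : Fin 4 → ℝ :=
  ![(v 0 * w 0 - v 1 * w 1) / 2, (v 0 * w 1 + v 1 * w 0) / 2,
    (v 0 * w 0 + v 1 * w 1) / 2, (v 0 * w 1 - v 1 * w 0) / 2]

/-- The graph `gr(φ)` of a map `φ : ℝP¹ → ℝP¹`, as a curve in `∂∞AdS³ ⊆ ℝP³`. -/
def grGraph (φ : RP1 → RP1) : Set RP3 :=
  {P | ∃ (v w : Fin 2 → ℝ) (hv : v ≠ 0) (hw : w ≠ 0) (hx : toBoundary v w ≠ 0),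
      projPt (toBoundary v w) hx = P ∧
      φ (Projectivization.mk ℝ v hv) = Projectivization.mk ℝ w hw}

/-! ### Spacelike and maximal surfaces in AdS³ -/

/-- The global timelike vector field `x ↦ (0,0,−x₄,x₃)` on the quadric, fixing the
time orientation of AdS³. -/
def timeVec (x : Fin 4 → ℝ) : Fin 4 → ℝ := ![0, 0, -(x 3), x 2]

/-- A (lifted, parametrized) smooth spacelike embedded disc in AdS³: a smooth embedding
of ℝ² into the quadric `{⟨x,x⟩ = −1} ⊆ ℝ^{2,2}` (the double cover of AdS³), with spacelike
first fundamental form, together with its future-directed unit normal field and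
the associated shape operator `B = ∇N`. -/
structure SpacelikeSurface where
  /-- the embedding of ℝ² into the quadric -/
  emb : (Fin 2 → ℝ) → (Fin 4 → ℝ)
  /-- the future-directed unit normal vector field -/
  normal : (Fin 2 → ℝ) → (Fin 4 → ℝ)
  /-- the shape operator, in the coordinates of the parametrization -/
  shape : (Fin 2 → ℝ) → ((Fin 2 → ℝ) →ₗ[ℝ] (Fin 2 → ℝ))
  smooth_emb : ContDiff ℝ (⊤ : ℕ∞) emb
  smooth_normal : ContDiff ℝ (⊤ : ℕ∞) normal
  inj : Function.Injective emb
  on_quadric : ∀ y, qform (emb y) (emb y) = -1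
  spacelike : ∀ y v, v ≠ 0 → 0 < qform (fderiv ℝ emb y v) (fderiv ℝ emb y v)
  normal_unit : ∀ y, qform (normal y) (normal y) = -1
  normal_orth_base : ∀ y, qform (normal y) (emb y) = 0
  normal_orth : ∀ y v, qform (normal y) (fderiv ℝ emb y v) = 0
  normal_future : ∀ y, qform (normal y) (timeVec (emb y)) < 0
  shape_spec : ∀ y v, fderiv ℝ normal y v = fderiv ℝ emb y (shape y v)

namespace SpacelikeSurface

variable (S : SpacelikeSurface)

/-- A spacelike surface is maximal if its shape operator is traceless. -/
def IsMaximal : Prop := ∀ y, LinearMap.trace ℝ (Fin 2 → ℝ) (S.shape y) = 0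

/-- The surface as a subset of `ℝP³` (i.e. of AdS³). -/
def proj : Set RP3 :=
  {P | ∃ (y : Fin 2 → ℝ) (h : S.emb y ≠ 0), projPt (S.emb y) h = P}

/-- The asymptotic boundary `∂∞S` of the surface: the frontier `closure S \ S`. -/
def bdryAtInfinity : Set RP3 := closure S.proj \ S.proj

/-- The surface is entire if its frontier is contained in the boundary at
infinity of AdS³. -/
def IsEntire : Prop := S.bdryAtInfinity ⊆ bdryAdS3

/-- The nonnegative principal curvature `λ` at a point: for a maximal surface the
principal curvatures are `±λ` with `λ = √(−det B)`. -/
def lambdaAt (y : Fin 2 → ℝ) : ℝ := Real.sqrt (-(LinearMap.det (S.shape y)))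

/-- The supremum `‖λ‖∞` of the principal curvatures of the surface. -/
def lambdaSup : ℝ := ⨆ y, S.lambdaAt y

/-- Nonpositive curvature: by the Gauss equation `K = −1 + λ²`, this is `λ ≤ 1`. -/
def NonpositiveCurvature : Prop := ∀ y, S.lambdaAt y ≤ 1

/-- Uniformly negative curvature: `λ ≤ 1 − ε` for some `ε > 0`. -/
def UniformlyNegativeCurvature : Prop := ∃ ε > 0, ∀ y, S.lambdaAt y ≤ 1 - ε

/-- The set of non-umbilical points of a maximal surface (where `λ ≠ 0`). -/
def nonUmbilic : Set (Fin 2 → ℝ) := {y | LinearMap.det (S.shape y) ≠ 0}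

/-- The intrinsic distance of the induced Riemannian metric on the surface. -/
def idist (y₁ y₂ : Fin 2 → ℝ) : ℝ :=
  sInf {L | ∃ c : ℝ → (Fin 2 → ℝ), ContDiff ℝ (⊤ : ℕ∞) c ∧ c 0 = y₁ ∧ c 1 = y₂ ∧
      L = ∫ t in (0:ℝ)..(1:ℝ),
        Real.sqrt (qform (deriv (fun s => S.emb (c s)) t) (deriv (fun s => S.emb (c s)) t))}

/-- `F` is the intrinsic gradient field of the function `f` on `U ⊆ S`: the vector field
which is `I`-dual to the differential of `f`. -/
def IsGradientOn (U : Set (Fin 2 → ℝ)) (f : (Fin 2 → ℝ) → ℝ)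
    (F : (Fin 2 → ℝ) → (Fin 2 → ℝ)) : Prop :=
  ∀ y ∈ U, ∀ v, qform (fderiv ℝ S.emb y (F y)) (fderiv ℝ S.emb y v) = fderiv ℝ f y v

/-- `H` is the intrinsic Hessian (as a (1,1)-tensor) of a function with gradient field `F`
on `U ⊆ S`: the tangential part of the ambient flat derivative of the ambient gradient
field (the normal part, in the ambient coordinates, lies in `span{σ(y), N(y)}`). -/
def IsHessianOn (U : Set (Fin 2 → ℝ)) (F : (Fin 2 → ℝ) → (Fin 2 → ℝ))
    (H : (Fin 2 → ℝ) → ((Fin 2 → ℝ) →ₗ[ℝ] (Fin 2 → ℝ))) : Prop :=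
  ∀ y ∈ U, ∀ v, ∃ a b : ℝ,
    fderiv ℝ (fun y' => fderiv ℝ S.emb y' (F y')) y v
      = fderiv ℝ S.emb y (H y v) + a • S.emb y + b • S.normal y

/-- The squared norm `‖grad f‖²` of a gradient field `F`, for the induced metric. -/
def gradNormSq (F : (Fin 2 → ℝ) → (Fin 2 → ℝ)) (y : Fin 2 → ℝ) : ℝ :=
  qform (fderiv ℝ S.emb y (F y)) (fderiv ℝ S.emb y (F y))

/-- `Δf` is the Laplace–Beltrami operator of the induced metric applied to `f`, on `U`:
the trace of the intrinsic Hessian. -/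
def IsLaplacianOn (U : Set (Fin 2 → ℝ)) (f Δf : (Fin 2 → ℝ) → ℝ) : Prop :=
  ∃ F H, S.IsGradientOn U f F ∧ S.IsHessianOn U F H ∧
    ∀ y ∈ U, Δf y = LinearMap.trace ℝ (Fin 2 → ℝ) (H y)

/-- `c` parametrizes an intrinsic geodesic of the surface: the ambient acceleration
is orthogonal to the surface, i.e. lies in `span{σ(c t), N(c t)}`. -/
def IsIntrinsicGeodesic (c : ℝ → (Fin 2 → ℝ)) : Prop :=
  ∀ t, ∃ a b : ℝ,
    deriv (deriv (fun s => S.emb (c s))) t = a • S.emb (c t) + b • S.normal (c t)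

/-- `E` is a system of normal coordinates for the surface centered at `y₀` (i.e. the
exponential map of the induced metric at that point, read in an orthonormal frame). -/
def IsNormalCoordsAt (y₀ : Fin 2 → ℝ) (E : (Fin 2 → ℝ) → (Fin 2 → ℝ)) : Prop :=
  E 0 = y₀ ∧ (∀ v, S.IsIntrinsicGeodesic (fun t => E (t • v))) ∧
  ∀ v w : Fin 2 → ℝ,
    qform (deriv (fun t : ℝ => S.emb (E (t • v))) 0) (deriv (fun t : ℝ => S.emb (E (t • w))) 0)
      = v 0 * w 0 + v 1 * w 1

end SpacelikeSurface

/-- The normal flow at time `ρ`: the parametrization of the surface `S_ρ` at constant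
timelike distance `ρ` from `S`. -/
def parallelEmb (S : SpacelikeSurface) (ρ : ℝ) : (Fin 2 → ℝ) → (Fin 4 → ℝ) :=
  fun y => Real.cos ρ • S.emb y + Real.sin ρ • S.normal y

/-- The pull-back to `S` of the first fundamental form of the parallel surface `S_ρ`. -/
def Irho (S : SpacelikeSurface) (ρ : ℝ) (y : Fin 2 → ℝ) (v w : Fin 2 → ℝ) : ℝ :=
  qform (fderiv ℝ (parallelEmb S ρ) y v) (fderiv ℝ (parallelEmb S ρ) y w)

/-- The second fundamental form of the parallel surface `S_ρ`, via `II_ρ = ½ dI_ρ/dρ`. -/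
def IIrho (S : SpacelikeSurface) (ρ : ℝ) (y : Fin 2 → ℝ) (v w : Fin 2 → ℝ) : ℝ :=
  (1 / 2) * deriv (fun ρ' => Irho S ρ' y v w) ρ

/-! ### Euclidean balls and `C⁰`/`C²` norms on ℝ² -/

/-- The Euclidean ball of radius `r` centered at the origin of ℝ². -/
def eball (r : ℝ) : Set (Fin 2 → ℝ) := {z | Real.sqrt ((z 0) ^ 2 + (z 1) ^ 2) < r}

/-- The `C⁰` norm of a function on the Euclidean ball of radius `r`. -/
def C0norm (u : (Fin 2 → ℝ) → ℝ) (r : ℝ) : ℝ :=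
  sSup {a | ∃ z ∈ eball r, a = |u z|}

/-- The `C²` norm of a function on the Euclidean ball of radius `r`. -/
def C2norm (u : (Fin 2 → ℝ) → ℝ) (r : ℝ) : ℝ :=
  sSup {a | ∃ z ∈ eball r, a = |u z| + ‖fderiv ℝ u z‖ + ‖fderiv ℝ (fderiv ℝ u) z‖}

end AdSPaper
/-! ### The hyperbolic plane, quasiconformal dilatation and minimal Lagrangian maps -/

namespace AdSPaper

/-- The upper half-plane model of ℍ², as a subset of ℂ. -/
def Hset : Set ℂ := {z | 0 < z.im}

/-- The real inner product on ℂ ≅ ℝ². -/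
def rinner (v w : ℂ) : ℝ := v.re * w.re + v.im * w.im

/-- The Christoffel bilinear form of the hyperbolic metric `(dx² + dy²)/y²` on the
upper half-plane: `Γ_z(v,w) = (i / Im z) · (v·w)` (complex multiplication). -/
def Gamma (z v w : ℂ) : ℂ := (Complex.I / (z.im : ℂ)) * (v * w)

/-- The quasiconformal dilatation of a map `Φ` at the point `z`: the ratio between the
major and the minor axis of the image of a unit circle under the differential of `Φ`. -/
def dilatationAt (Φ : ℂ → ℂ) (z : ℂ) : ℝ :=
  (⨆ v : {v : ℂ // ‖v‖ = 1}, ‖fderiv ℝ Φ z (v : ℂ)‖) /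
    (⨅ v : {v : ℂ // ‖v‖ = 1}, ‖fderiv ℝ Φ z (v : ℂ)‖)

/-- The maximal dilatation `K(Φ)` of a map of the upper half-plane. -/
def maxDilatation (Φ : ℂ → ℂ) : ℝ := ⨆ z : Hset, dilatationAt Φ (z : ℂ)

/-- `Φ` is a minimal Lagrangian diffeomorphism of ℍ² (upper half-plane model): a smooth
diffeomorphism of ℍ² which is area-preserving and whose graph is minimal in ℍ² × ℍ²;
equivalently (Bonsante–Schlenker, Prop. 1.2.6 of Toulisse), `Φ*g = g(b·,b·)` for a
self-adjoint, `det = 1`, Codazzi bundle morphism `b`. -/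
def IsMinimalLagrangian (Φ : ℂ → ℂ) : Prop :=
  ContDiffOn ℝ (⊤ : ℕ∞) Φ Hset ∧ Set.BijOn Φ Hset Hset ∧
  (∃ Ψ : ℂ → ℂ, ContDiffOn ℝ (⊤ : ℕ∞) Ψ Hset ∧ Set.InvOn Ψ Φ Hset Hset) ∧
  ∃ b : ℂ → (ℂ →L[ℝ] ℂ),
    (∀ z ∈ Hset, ∀ v w : ℂ, rinner (b z v) w = rinner v (b z w)) ∧
    (∀ z ∈ Hset, LinearMap.det ((b z : ℂ →L[ℝ] ℂ) : ℂ →ₗ[ℝ] ℂ) = 1) ∧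
    (∀ z ∈ Hset, ∀ v w : ℂ,
      rinner (fderiv ℝ Φ z v) (fderiv ℝ Φ z w) / (Φ z).im ^ 2
        = rinner (b z v) (b z w) / z.im ^ 2) ∧
    (∀ z ∈ Hset, ∀ v w : ℂ,
      fderiv ℝ (fun u => b u w) z v + Gamma z v (b z w) - b z (Gamma z v w)
        = fderiv ℝ (fun u => b u v) z w + Gamma z w (b z v) - b z (Gamma z w v))

/-- The point of the boundary `∂ℍ² = ℝ ∪ {∞}` of the upper half-plane (inside the
Riemann sphere `ℂ ∪ {∞}`) corresponding to a point of `ℝP¹`. -/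
def rp1ToSphere (ξ : RP1) : OnePoint ℂ :=
  if ξ.rep 1 = 0 then OnePoint.infty
  else OnePoint.some ((ξ.rep 0 / ξ.rep 1 : ℝ) : ℂ)

/-- `Φ : ℍ² → ℍ²` extends the circle map `φ : ℝP¹ → ℝP¹`: at every boundary point `ξ`,
`Φ(z) → φ(ξ)` as `z → ξ` from inside the upper half-plane (in the Riemann sphere). -/
def ExtendsToBoundary (Φ : ℂ → ℂ) (φ : RP1 → RP1) : Prop :=
  ∀ ξ : RP1, Filter.Tendsto (fun z => OnePoint.some (Φ z))
      ((Filter.comap OnePoint.some (nhds (rp1ToSphere ξ))) ⊓ Filter.principal Hset)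
      (nhds (rp1ToSphere (φ ξ)))

/-- `Φ` is the (unique) minimal Lagrangian extension of the quasisymmetric
homeomorphism `φ` of `ℝP¹`. -/
def IsMinimalLagrangianExtension (Φ : ℂ → ℂ) (φ : RP1 → RP1) : Prop :=
  IsMinimalLagrangian Φ ∧ ExtendsToBoundary Φ φ

end AdSPaper

namespace AdSPaper

open ComplexConjugate

/-! ### Wirtinger derivatives -/

/-- The real-linear map `v ↦ A v + B v̄` of `ℂ`. -/
def wirtinger (A B : ℂ) : ℂ →L[ℝ] ℂ :=
  A • ContinuousLinearMap.id ℝ ℂ + B • (Complex.conjCLE : ℂ →L[ℝ] ℂ)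

@[simp]
lemma wirtinger_apply (A B v : ℂ) : wirtinger A B v = A * v + B * conj v := by
  simp [wirtinger]

/-- `u` is real differentiable at `q` with Wirtinger derivatives `∂u = A` and `∂̄u = B`. -/
def HasW (u : ℂ → ℂ) (A B q : ℂ) : Prop := HasFDerivAt u (wirtinger A B) q

lemma wirtinger_ext {L : ℂ →L[ℝ] ℂ} {A B : ℂ} (h : ∀ v, L v = A * v + B * conj v) :
    L = wirtinger A B := by
  ext v <;> simp [h]

lemma eq_wirtinger (L : ℂ →L[ℝ] ℂ) :
    L = wirtinger ((L 1 - Complex.I * L Complex.I) / 2) ((L 1 + Complex.I * L Complex.I) / 2) := by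
  apply wirtinger_ext
  intro v
  have hv : L v = v.re * L 1 + v.im * L Complex.I := by
    conv_lhs => rw [show v = v.re • (1 : ℂ) + v.im • Complex.I by
      apply Complex.ext <;> simp]
    rw [map_add, map_smul, map_smul]; simp
  rw [hv]
  apply Complex.ext <;> simp <;> ring

lemma wirtinger_injective {A B A' B' : ℂ} (h : wirtinger A B = wirtinger A' B') :
    A = A' ∧ B = B' := by
  have h1 := congrArg (fun L => L 1) h
  have h2 := congrArg (fun L => L Complex.I) h
  simp only [wirtinger_apply, map_one, Complex.conj_I] at h1 h2
  have hI := Complex.I_mul_I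
  constructor
  · linear_combination (1 / 2) * h1 - (Complex.I / 2) * h2 + (A - A' - B + B') / 2 * hI
  · linear_combination (1 / 2) * h1 + (Complex.I / 2) * h2 + (-A + A' + B - B') / 2 * hI

/-- The derivative `∂u/∂z`. -/
def dz (u : ℂ → ℂ) (q : ℂ) : ℂ := (fderiv ℝ u q 1 - Complex.I * fderiv ℝ u q Complex.I) / 2

/-- The derivative `∂u/∂z̄`. -/
def dzb (u : ℂ → ℂ) (q : ℂ) : ℂ := (fderiv ℝ u q 1 + Complex.I * fderiv ℝ u q Complex.I) / 2

lemma fderiv_eq_wirtinger (u : ℂ → ℂ) (q : ℂ) : fderiv ℝ u q = wirtinger (dz u q) (dzb u q) :=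
  eq_wirtinger _

lemma hasW_of_differentiableAt {u : ℂ → ℂ} {q : ℂ} (h : DifferentiableAt ℝ u q) :
    HasW u (dz u q) (dzb u q) q := by
  have := h.hasFDerivAt
  rwa [fderiv_eq_wirtinger] at this

namespace HasW

variable {u v : ℂ → ℂ} {A B A' B' q : ℂ}

lemma unique (h : HasW u A B q) (h' : HasW u A' B' q) : A = A' ∧ B = B' :=
  wirtinger_injective (HasFDerivAt.unique h h')

lemma dz_eq (h : HasW u A B q) : dz u q = A :=
  ((hasW_of_differentiableAt h.differentiableAt).unique h).1

lemma dzb_eq (h : HasW u A B q) : dzb u q = B :=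
  ((hasW_of_differentiableAt h.differentiableAt).unique h).2

lemma congr_of_eventuallyEq (h : HasW u A B q) (hv : v =ᶠ[𝓝 q] u) : HasW v A B q :=
  HasFDerivAt.congr_of_eventuallyEq h hv

lemma congr_coeff (h : HasW u A B q) (hA : A = A') (hB : B = B') : HasW u A' B' q := by
  rwa [← hA, ← hB]

lemma of_hasFDerivAt {L : ℂ →L[ℝ] ℂ} (h : HasFDerivAt u L q)
    (hL : ∀ v, L v = A * v + B * conj v) : HasW u A B q := by
  rw [wirtinger_ext hL] at h
  exact h

lemma const (c q : ℂ) : HasW (fun _ => c) 0 0 q :=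
  of_hasFDerivAt (hasFDerivAt_const (𝕜 := ℝ) c q) (by simp)

lemma id (q : ℂ) : HasW (fun z => z) 1 0 q :=
  of_hasFDerivAt (hasFDerivAt_id (𝕜 := ℝ) q) (by simp)

lemma add (h : HasW u A B q) (h' : HasW v A' B' q) :
    HasW (fun z => u z + v z) (A + A') (B + B') q :=
  of_hasFDerivAt (HasFDerivAt.add h h') (by intro v; simp; ring)

lemma neg (h : HasW u A B q) : HasW (fun z => -u z) (-A) (-B) q :=
  of_hasFDerivAt (HasFDerivAt.neg h) (by intro v; simp; ring)

lemma sub (h : HasW u A B q) (h' : HasW v A' B' q) :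
    HasW (fun z => u z - v z) (A - A') (B - B') q :=
  of_hasFDerivAt (HasFDerivAt.sub h h') (by intro v; simp; ring)

lemma mul (h : HasW u A B q) (h' : HasW v A' B' q) :
    HasW (fun z => u z * v z) (u q * A' + v q * A) (u q * B' + v q * B) q :=
  of_hasFDerivAt (HasFDerivAt.mul h h') (by intro v; simp; ring)

lemma const_mul (c : ℂ) (h : HasW u A B q) : HasW (fun z => c * u z) (c * A) (c * B) q := by
  simpa using (HasW.const c q).mul h

lemma star (h : HasW u A B q) : HasW (fun z => conj (u z)) (conj B) (conj A) q :=
  of_hasFDerivAt ((Complex.conjCLE : ℂ →L[ℝ] ℂ).hasFDerivAt.comp q h) (by intro v; simp; ring)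

/-- Composition with a holomorphic function on the left. -/
lemma comp_hasDerivAt {g : ℂ → ℂ} {g' : ℂ} (hg : HasDerivAt g g' (u q)) (h : HasW u A B q) :
    HasW (fun z => g (u z)) (g' * A) (g' * B) q :=
  of_hasFDerivAt ((hg.hasFDerivAt.restrictScalars ℝ).comp q h) (by intro v; simp; ring)

/-- Composition with a holomorphic function on the right. -/
lemma comp_right {g : ℂ → ℂ} {g' : ℂ} (h : HasW u A B (g q)) (hg : HasDerivAt g g' q) :
    HasW (fun z => u (g z)) (A * g') (B * conj g') q :=
  of_hasFDerivAt (HasFDerivAt.comp q h (hg.hasFDerivAt.restrictScalars ℝ))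
    (by intro v; simp; ring)

lemma inv (h : HasW u A B q) (h0 : u q ≠ 0) :
    HasW (fun z => (u z)⁻¹) (-(u q ^ 2)⁻¹ * A) (-(u q ^ 2)⁻¹ * B) q :=
  comp_hasDerivAt (hasDerivAt_inv h0) h

lemma im (q : ℂ) : HasW (fun z => ((z.im : ℝ) : ℂ)) (-Complex.I / 2) (Complex.I / 2) q := by
  have h := ((HasW.id q).sub (HasW.id q).star).const_mul (-Complex.I / 2)
  refine (h.congr_of_eventuallyEq (Eventually.of_forall fun z => ?_)).congr_coeff ?_ ?_
  · apply Complex.ext <;> simp <;> ring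
  · simp
  · simp [neg_div]

/-- The chain rule along a curve. -/
lemma comp_curve {c : ℝ → ℂ} {c' : ℂ} {t : ℝ} (h : HasW u A B (c t)) (hc : HasDerivAt c c' t) :
    HasDerivAt (fun s => u (c s)) (A * c' + B * conj c') t := by
  have := HasFDerivAt.comp_hasDerivAt t h hc
  rw [wirtinger_apply] at this
  exact this

lemma ofReal_re (h : HasW u A B q) :
    HasW (fun z => (((u z).re : ℝ) : ℂ)) ((A + conj B) / 2)
      ((B + conj A) / 2) q := by
  refine ((h.add h.star).const_mul (1 / 2)).congr_of_eventuallyEq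
    (Eventually.of_forall fun z => ?_) |>.congr_coeff ?_ ?_
  · apply Complex.ext <;> simp <;> ring
  · ring
  · ring

lemma ofReal_im (h : HasW u A B q) :
    HasW (fun z => (((u z).im : ℝ) : ℂ)) (-Complex.I * (A - conj B) / 2)
      (-Complex.I * (B - conj A) / 2) q := by
  refine ((h.sub h.star).const_mul (-Complex.I / 2)).congr_of_eventuallyEq
    (Eventually.of_forall fun z => ?_) |>.congr_coeff ?_ ?_
  · apply Complex.ext <;> simp <;> ring
  · ring
  · ring

end HasW

/-! ### A comparison lemma for curves moving in the direction of a parallel vector field -/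

/-- Let `(X, Y)` be a curve of the upper half-plane and `(e₁, e₂)` a parallel vector field along
it, making an acute angle with the velocity. A function `(α |c|² + β X + γ) / Y` which vanishes
initially with gradient a positive multiple of `(e₁, e₂)` remains nonnegative. -/
lemma quadratic_nonneg_along_curve {X Y e₁ e₂ X' Y' : ℝ → ℝ} {t₀ K α β γ : ℝ}
    (hX : ∀ t, t₀ ≤ t → HasDerivAt X (X' t) t) (hY : ∀ t, t₀ ≤ t → HasDerivAt Y (Y' t) t)
    (he₁ : ∀ t, t₀ ≤ t → HasDerivAt e₁ ((X' t * e₂ t + Y' t * e₁ t) / Y t) t)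
    (he₂ : ∀ t, t₀ ≤ t → HasDerivAt e₂ ((Y' t * e₂ t - X' t * e₁ t) / Y t) t)
    (hY0 : ∀ t, t₀ ≤ t → 0 < Y t) (hK : ∀ t, t₀ ≤ t → e₁ t ^ 2 + e₂ t ^ 2 = K * Y t ^ 2)
    (hK0 : 0 < K) (hpos : ∀ t, t₀ ≤ t → 0 < X' t * e₁ t + Y' t * e₂ t)
    (h0 : α * (X t₀ ^ 2 + Y t₀ ^ 2) + β * X t₀ + γ = 0)
    (hm0 : 0 < 2 * α * (X t₀ * e₁ t₀ + Y t₀ * e₂ t₀) + β * e₁ t₀)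
    (hn0 : 2 * α * (-X t₀ * e₂ t₀ + Y t₀ * e₁ t₀) - β * e₂ t₀ = 0) {t₁ : ℝ} (ht₁ : t₀ ≤ t₁) :
    0 ≤ α * (X t₁ ^ 2 + Y t₁ ^ 2) + β * X t₁ + γ := by
  set N : ℝ → ℝ := fun t => α * (X t ^ 2 + Y t ^ 2) + β * X t + γ with hN
  set p : ℝ → ℝ := fun t => N t / Y t with hp
  set m : ℝ → ℝ := fun t =>
    (2 * α * (X t * e₁ t + Y t * e₂ t) + β * e₁ t) / Y t - N t * e₂ t / Y t ^ 2 with hm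
  set n : ℝ → ℝ := fun t =>
    (2 * α * (-X t * e₂ t + Y t * e₁ t) - β * e₂ t) / Y t - N t * e₁ t / Y t ^ 2 with hn
  have hN' : ∀ t, t₀ ≤ t → HasDerivAt N (2 * α * (X t * X' t + Y t * Y' t) + β * X' t) t := by
    intro t ht
    have := ((((hX t ht).pow 2).add ((hY t ht).pow 2)).const_mul α).add
      ((hX t ht).const_mul β) |>.add_const γ
    refine HasDerivAt.congr_deriv this ?_
    norm_num; ring
  have hp' : ∀ t, t₀ ≤ t → HasDerivAt p
      ((2 * α * (X t * X' t + Y t * Y' t) + β * X' t) / Y t - N t * Y' t / Y t ^ 2) t := by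
    intro t ht
    have hy := (hY0 t ht).ne'
    refine ((hN' t ht).div (hY t ht) hy).congr_deriv ?_
    field_simp
  have hm' : ∀ t, t₀ ≤ t → HasDerivAt m (p t * (X' t * e₁ t + Y' t * e₂ t) / Y t ^ 2) t := by
    intro t ht
    have hy := (hY0 t ht).ne'
    have h1 := ((((hX t ht).mul (he₁ t ht)).add ((hY t ht).mul (he₂ t ht))).const_mul (2 * α)).add
      ((he₁ t ht).const_mul β)
    have h2 := (h1.div (hY t ht) hy).sub (((hN' t ht).mul (he₂ t ht)).div ((hY t ht).pow 2)
      (pow_ne_zero 2 hy))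
    refine HasDerivAt.congr_deriv h2 ?_
    simp only [hp, hN, Pi.add_apply, Pi.mul_apply, Pi.pow_apply]
    norm_num
    field_simp
    ring
  have hcons : ∀ t, t₀ ≤ t → m t ^ 2 + n t ^ 2 = K * (p t ^ 2 + β ^ 2 - 4 * α * γ) := by
    intro t ht
    have hy := (hY0 t ht).ne'
    have hk := hK t ht
    have : m t ^ 2 + n t ^ 2 = (e₁ t ^ 2 + e₂ t ^ 2) / Y t ^ 2 * (p t ^ 2 + β ^ 2 - 4 * α * γ) := by
      simp only [hp, hN, hm, hn]
      field_simp
      ring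
    rw [this, hk]
    field_simp
  have hpK : ∀ t, t₀ ≤ t →
      (2 * α * (X t * X' t + Y t * Y' t) + β * X' t) / Y t - N t * Y' t / Y t ^ 2
        = (m t * (X' t * e₁ t + Y' t * e₂ t) + n t * (Y' t * e₁ t - X' t * e₂ t))
          / (K * Y t ^ 2) := by
    intro t ht
    have hy := (hY0 t ht).ne'
    rw [← hK t ht]
    have : e₁ t ^ 2 + e₂ t ^ 2 ≠ 0 := by
      rw [hK t ht]; positivity
    simp only [hm, hn]
    field_simp
    ring
  have hp0 : p t₀ = 0 := by simp only [hp, hN, h0, zero_div]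
  have hm00 : 0 < m t₀ := by
    have hN0 : N t₀ = 0 := h0
    have := hY0 t₀ le_rfl
    simp only [hm, hN0, zero_mul, zero_div, sub_zero]
    positivity
  have hn00 : n t₀ = 0 := by
    have hN0 : N t₀ = 0 := h0
    simp only [hn, hN0, zero_mul, zero_div, sub_zero, hn0]
  have key : Icc t₀ t₁ ⊆ {t | 0 ≤ p t ∧ m t₀ ≤ m t} := by
    have hcp : ContinuousOn p (Icc t₀ t₁) := fun t ht =>
      (hp' t ht.1).continuousAt.continuousWithinAt
    have hcm : ContinuousOn m (Icc t₀ t₁) := fun t ht =>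
      (hm' t ht.1).continuousAt.continuousWithinAt
    apply IsClosed.Icc_subset_of_forall_mem_nhdsWithin
    · have h1 := hcp.preimage_isClosed_of_isClosed isClosed_Icc (isClosed_Ici (a := (0 : ℝ)))
      have h2 := hcm.preimage_isClosed_of_isClosed isClosed_Icc (isClosed_Ici (a := m t₀))
      convert h1.inter h2 using 1
      ext t
      simp only [mem_inter_iff, mem_ofPred_eq, mem_preimage, mem_Ici]
      tauto
    · exact ⟨hp0.ge, le_rfl⟩
    · rintro t ⟨⟨h1, h2⟩, ht0, -⟩
      have hev : ∀ᶠ s in 𝓝[>] t, 0 ≤ p s := by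
        rcases h1.lt_or_eq with h | h
        · have hpos := (hp' t ht0).continuousAt.eventually (eventually_gt_nhds h)
          exact nhdsWithin_le_nhds (hpos.mono
            fun s hs => hs.le)
        · have hc := hcons t ht0
          have hc0 := hcons t₀ le_rfl
          rw [hp0, hn00] at hc0
          rw [← h] at hc
          have hn2 : n t = 0 := by nlinarith
          have hd := hp' t ht0
          rw [hpK t ht0, hn2] at hd
          have hy := hY0 t ht0
          have hd0 : 0 < (m t * (X' t * e₁ t + Y' t * e₂ t)
              + 0 * (Y' t * e₁ t - X' t * e₂ t)) / (K * Y t ^ 2) := by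
            have := hpos t ht0
            have : 0 < m t := hm00.trans_le h2
            rw [zero_mul, add_zero]
            positivity
          have := (hasDerivAt_iff_tendsto_slope.1 hd).eventually (eventually_gt_nhds hd0)
          have h3 := this.filter_mono (nhdsWithin_mono t (fun s (hs : t < s) => ne_of_gt hs))
          filter_upwards [h3, self_mem_nhdsWithin] with s hs (hts : t < s)
          rw [slope_def_field, ← h, sub_zero] at hs
          have := (div_pos_iff_of_pos_right (sub_pos.2 hts)).1 hs
          exact this.le
      obtain ⟨s, hs, hsub⟩ := mem_nhdsGT_iff_exists_Ioo_subset.1 hev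
      have hmono : MonotoneOn m (Ico t s) := by
        apply monotoneOn_of_hasDerivWithinAt_nonneg (convex_Ico t s)
          (f' := fun r => p r * (X' r * e₁ r + Y' r * e₂ r) / Y r ^ 2)
        · exact fun r hr => (hm' r (ht0.trans hr.1)).continuousAt.continuousWithinAt
        · intro r hr
          rw [interior_Ico] at hr
          exact (hm' r (ht0.trans hr.1.le)).hasDerivWithinAt
        · intro r hr
          rw [interior_Ico] at hr
          have h1 := hpos r (ht0.trans hr.1.le)
          have h2 : 0 ≤ p r := hsub hr
          positivity
      refine mem_nhdsGT_iff_exists_Ioo_subset.2 ⟨s, hs, fun r hr => ⟨hsub hr, h2.trans ?_⟩⟩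
      exact hmono ⟨le_rfl, hs⟩ ⟨hr.1.le, hr.2⟩ hr.1.le
  have h1 := (key ⟨ht₁, le_rfl⟩).1
  have hy := hY0 t₁ ht₁
  have : N t₁ = p t₁ * Y t₁ := by simp only [hp]; field_simp
  change 0 ≤ N t₁
  rw [this]
  positivity

/-! ### Minimal Lagrangian maps in Wirtinger form -/

/-- An orientation preserving minimal Lagrangian map of the upper half-plane, in Wirtinger form:
`∂Φ = a μ` and `∂̄Φ = a ν`, where `a` is a parallel isometry of tangent spaces and
`v ↦ μ v + ν v̄` is a self-adjoint Codazzi field of determinant one. -/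
structure MLData (Φ a ν : ℂ → ℂ) (μ : ℂ → ℝ) : Prop where
  im_pos : ∀ q ∈ Hset, 0 < (Φ q).im
  mu_pos : ∀ q ∈ Hset, 0 < μ q
  mu_sq : ∀ q ∈ Hset, μ q ^ 2 = 1 + ‖ν q‖ ^ 2
  norm_a : ∀ q ∈ Hset, ‖a q‖ * q.im = (Φ q).im
  hasW_map : ∀ q ∈ Hset, HasW Φ (a q * μ q) (a q * ν q) q
  hasW_a : ∀ q ∈ Hset, HasW a
    (a q * (Complex.I / (q.im : ℂ)) - Complex.I / ((Φ q).im : ℂ) * a q ^ 2 * μ q)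
    (-(Complex.I / ((Φ q).im : ℂ) * a q ^ 2 * ν q)) q
  contDiff_mu : ContDiffOn ℝ 2 μ Hset
  contDiff_nu : ContDiffOn ℝ 2 ν Hset
  codazzi : ∀ q ∈ Hset,
    dzb (fun z => (μ z : ℂ)) q = dz ν q + Complex.I / (q.im : ℂ) * ν q

/-- `Φ` extends continuously to the boundary of the upper half-plane, by `φ` on the real line and
fixing the point at infinity. -/
structure BoundaryMap (Φ : ℂ → ℂ) (φ : ℝ → ℝ) : Prop where
  tendsto_real : ∀ x : ℝ, Tendsto Φ (𝓝[Hset] (x : ℂ)) (𝓝 (φ x : ℂ))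
  tendsto_infty : Tendsto Φ (Bornology.cobounded ℂ ⊓ 𝓟 Hset) (Bornology.cobounded ℂ)

lemma isOpen_Hset : IsOpen Hset := isOpen_lt continuous_const Complex.continuous_im

lemma convex_Hset : Convex ℝ Hset := convex_halfSpace_im_gt 0

namespace MLData

variable {Φ a ν : ℂ → ℂ} {μ : ℂ → ℝ}

lemma a_ne_zero (D : MLData Φ a ν μ) {q : ℂ} (hq : q ∈ Hset) : a q ≠ 0 := by
  intro h
  have h1 := D.norm_a q hq
  have h2 := D.im_pos q hq
  rw [h] at h1
  simp at h1
  linarith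

/-- The condition on `κ` under which the cones of aperture `κ` are preserved. -/
def ConeAdmissible (ν : ℂ → ℂ) (μ : ℂ → ℝ) (κ : ℂ) : Prop :=
  ∀ q ∈ Hset, ∀ v : ℂ, v ≠ 0 → 0 < (κ * conj (μ q * v + ν q * conj v) * v).re

lemma nonneg_along_curve (D : MLData Φ a ν μ) {κ : ℂ} (hκ : ConeAdmissible ν μ κ)
    {q q' T : ℝ → ℂ} {t₀ : ℝ} (h0 : 0 < t₀) (hq : ∀ t, t₀ ≤ t → q t ∈ Hset)
    (hq' : ∀ t, t₀ ≤ t → HasDerivAt q (q' t) t) (hq0 : ∀ t, t₀ ≤ t → q' t ≠ 0)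
    (hT : ∀ t, t₀ ≤ t → T t = t * q' t)
    (hT' : ∀ t, t₀ ≤ t → HasDerivAt T (-(Complex.I / ((q t).im : ℂ)) * q' t * T t) t)
    (hTn : ∀ t, t₀ ≤ t → ‖T t‖ = (q t).im) {t : ℝ} (ht : t₀ ≤ t) :
    0 ≤ -(conj (κ * a (q t₀) * T t₀) * ((‖Φ (q t)‖ ^ 2 : ℝ)
      - 2 * (Φ (q t)).re * Φ (q t₀) + Φ (q t₀) ^ 2)).im := by
  have hκ0 : κ ≠ 0 := by
    rintro rfl
    have := hκ _ (hq t₀ le_rfl) 1 one_ne_zero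
    simp at this
  set c : ℝ → ℂ := fun t => Φ (q t) with hc
  set e : ℝ → ℂ := fun t => κ * a (q t) * T t with he
  set c' : ℝ → ℂ := fun t => a (q t) * μ (q t) * q' t + a (q t) * ν (q t) * conj (q' t) with hc'
  have hcd : ∀ t, t₀ ≤ t → HasDerivAt c (c' t) t := fun t ht =>
    (D.hasW_map _ (hq t ht)).comp_curve (hq' t ht)
  have hed : ∀ t, t₀ ≤ t → HasDerivAt e (-(Complex.I / ((c t).im : ℂ)) * c' t * e t) t := by
    intro t ht
    have h1 := (((D.hasW_a _ (hq t ht)).comp_curve (hq' t ht)).const_mul κ).mul (hT' t ht)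
    refine HasDerivAt.congr_deriv h1 ?_
    simp only [hc, he, hc']
    ring
  have hre : ∀ {u : ℝ → ℂ} {u' : ℂ} {s : ℝ}, HasDerivAt u u' s →
      HasDerivAt (fun r => (u r).re) u'.re s := fun h =>
    Complex.reCLM.hasFDerivAt.comp_hasDerivAt _ h
  have him : ∀ {u : ℝ → ℂ} {u' : ℂ} {s : ℝ}, HasDerivAt u u' s →
      HasDerivAt (fun r => (u r).im) u'.im s := fun h =>
    Complex.imCLM.hasFDerivAt.comp_hasDerivAt _ h
  have hcim : ∀ t, t₀ ≤ t → 0 < (c t).im := fun t ht => D.im_pos _ (hq t ht)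
  have hen : ∀ t, t₀ ≤ t → ‖e t‖ = ‖κ‖ * (c t).im := by
    intro t ht
    simp only [he, hc, norm_mul, hTn t ht, ← D.norm_a _ (hq t ht)]
    ring
  have main := quadratic_nonneg_along_curve (X := fun t => (c t).re) (Y := fun t => (c t).im)
    (e₁ := fun t => (e t).re) (e₂ := fun t => (e t).im) (X' := fun t => (c' t).re)
    (Y' := fun t => (c' t).im) (t₀ := t₀) (K := ‖κ‖ ^ 2) (α := (e t₀).im)
    (β := 2 * ((e t₀).re * (c t₀).im - (e t₀).im * (c t₀).re))
    (γ := -(conj (e t₀) * c t₀ ^ 2).im)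
    (fun t ht => hre (hcd t ht)) (fun t ht => him (hcd t ht))
    (fun t ht => (hre (hed t ht)).congr_deriv ?_)
    (fun t ht => (him (hed t ht)).congr_deriv ?_) hcim ?_ (by positivity) ?_ ?_ ?_ ?_ ht
  · convert main using 1
    change -(conj (e t₀) * ((‖c t‖ ^ 2 : ℝ) - 2 * (c t).re * c t₀ + c t₀ ^ 2)).im = _
    rw [← Complex.normSq_eq_norm_sq, Complex.normSq_apply]
    simp [pow_two]
    ring
  · have := (hcim t ht).ne'
    rw [← mul_div_cancel_left₀ ((c' t).re * (e t).im + (c' t).im * (e t).re) this]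
    simp [Complex.div_re, Complex.div_im, Complex.normSq_apply]
    field_simp
  · have := (hcim t ht).ne'
    simp [Complex.div_re, Complex.div_im, Complex.normSq_apply]
    field_simp
    ring
  · intro t ht
    have h1 := hen t ht
    have h2 : ‖e t‖ ^ 2 = (e t).re ^ 2 + (e t).im ^ 2 := by
      rw [← Complex.normSq_eq_norm_sq, Complex.normSq_apply]; ring
    rw [← h2, h1]; ring
  · intro t ht
    have h1 := hκ _ (hq t ht) _ (hq0 t ht)
    have h2 : (c' t).re * (e t).re + (c' t).im * (e t).im
        = ‖a (q t)‖ ^ 2 * t * (κ * conj (μ (q t) * q' t + ν (q t) * conj (q' t)) * q' t).re := by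
      have h3 : (c' t).re * (e t).re + (c' t).im * (e t).im = (conj (c' t) * e t).re := by simp
      have h4 : conj (c' t) * e t = ((‖a (q t)‖ ^ 2 * t : ℝ) : ℂ)
          * (κ * conj (μ (q t) * q' t + ν (q t) * conj (q' t)) * q' t) := by
        push_cast
        rw [← Complex.conj_mul']
        simp only [hc', he, hT t ht, map_add, map_mul, Complex.conj_conj, Complex.conj_ofReal]
        ring
      rw [h3, h4, Complex.re_ofReal_mul]
    rw [h2]
    have := D.a_ne_zero (hq t ht)
    have : 0 < t := h0.trans_le ht
    positivity
  · simp [pow_two]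
    ring
  · have h1 : 0 < ‖e t₀‖ := by
      rw [hen t₀ le_rfl]
      have := hcim t₀ le_rfl
      positivity
    have h2 : ‖e t₀‖ ^ 2 = (e t₀).re ^ 2 + (e t₀).im ^ 2 := by
      rw [← Complex.normSq_eq_norm_sq, Complex.normSq_apply]; ring
    have := hcim t₀ le_rfl
    have h3 : 0 < 2 * (c t₀).im * ((e t₀).re ^ 2 + (e t₀).im ^ 2) := by
      rw [← h2]; positivity
    linarith
  · ring

lemma cone_infty (D : MLData Φ a ν μ) {φ : ℝ → ℝ} (hB : BoundaryMap Φ φ) {κ : ℂ}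
    (hκ : ConeAdmissible ν μ κ) {q : ℂ} (hq : q ∈ Hset) : 0 ≤ (conj κ * conj (a q)).re := by
  have hy : 0 < q.im := hq
  set γ : ℝ → ℂ := fun t => (q.re : ℂ) + Complex.I * t with hγ
  have hγ0 : γ q.im = q := by
    apply Complex.ext <;> simp [hγ]
  have hγim : ∀ t, (γ t).im = t := by intro t; simp [hγ]
  have hγH : ∀ t, q.im ≤ t → γ t ∈ Hset := fun t ht => by
    change 0 < (γ t).im
    rw [hγim]; exact hy.trans_le ht
  have hd : ∀ t : ℝ, HasDerivAt (fun s : ℝ => (s : ℂ)) 1 t := fun t => Complex.ofRealCLM.hasDerivAt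
  have hc0 : ∀ t : ℝ, q.im ≤ t → (t : ℂ) ≠ 0 := fun t ht => by
    exact_mod_cast (hy.trans_le ht).ne'
  have hmain := fun t (ht : q.im ≤ t) => D.nonneg_along_curve hκ (q := γ) (q' := fun _ => Complex.I)
    (T := fun t => t * Complex.I) hy hγH
    (fun t _ => (((hd t).const_mul Complex.I).const_add _).congr_deriv (by ring))
    (fun _ _ => Complex.I_ne_zero) (fun _ _ => rfl)
    (fun t ht => ((hd t).mul_const Complex.I).congr_deriv (by
      rw [hγim]
      have := hc0 t ht
      field_simp
      linear_combination Complex.I_sq))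
    (fun t ht => by
      rw [hγim]
      simpa using hy.le.trans ht) ht
  simp only [hγ0] at hmain
  have hlim : Tendsto γ atTop (Bornology.cobounded ℂ ⊓ 𝓟 Hset) := by
    refine tendsto_inf.2 ⟨?_, tendsto_principal.2 ?_⟩
    · rw [← tendsto_norm_atTop_iff_cobounded]
      refine tendsto_atTop_mono (fun t => ?_) tendsto_id
      have := Complex.abs_im_le_norm (γ t)
      rw [hγim] at this
      exact (le_abs_self t).trans this
    · filter_upwards [eventually_ge_atTop q.im] with t ht using hγH t ht
  have hΦ : Tendsto (fun t => ‖Φ (γ t)‖) atTop atTop :=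
    tendsto_norm_cobounded_atTop.comp (hB.tendsto_infty.comp hlim)
  set E : ℂ := conj (κ * a q * (q.im * Complex.I)) with hE
  have hEim : -E.im = q.im * (conj κ * conj (a q)).re := by
    simp [hE]; ring
  by_contra! hneg
  have h1 : 0 < E.im := by nlinarith
  have h2 := hΦ.eventually (eventually_gt_atTop
    ((2 * ‖E‖ * ‖Φ q‖ + ‖E‖ * ‖Φ q‖ ^ 2) / E.im + 1))
  obtain ⟨t, ht, htq⟩ := (h2.and (eventually_ge_atTop q.im)).exists
  have h3 := hmain t htq
  set r := ‖Φ (γ t)‖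
  have hb : 0 ≤ (2 * ‖E‖ * ‖Φ q‖ + ‖E‖ * ‖Φ q‖ ^ 2) / E.im := by positivity
  have hr1 : 1 < r := by linarith
  have h4 : (E * ((r ^ 2 : ℝ) - 2 * (Φ (γ t)).re * Φ q + Φ q ^ 2)).im
      = E.im * r ^ 2 - (E * (2 * (Φ (γ t)).re * Φ q - Φ q ^ 2)).im := by
    rw [show E * (((r ^ 2 : ℝ) : ℂ) - 2 * (Φ (γ t)).re * Φ q + Φ q ^ 2)
      = E * ((r ^ 2 : ℝ) : ℂ) - E * (2 * (Φ (γ t)).re * Φ q - Φ q ^ 2) by ring, Complex.sub_im,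
      Complex.im_mul_ofReal]
  rw [h4] at h3
  have h5 : (E * (2 * (Φ (γ t)).re * Φ q - Φ q ^ 2)).im
      ≤ ‖E‖ * (2 * r * ‖Φ q‖ + ‖Φ q‖ ^ 2) := by
    refine (le_abs_self _).trans ((Complex.abs_im_le_norm _).trans ?_)
    rw [norm_mul]
    gcongr
    refine (norm_sub_le _ _).trans ?_
    rw [norm_mul, norm_mul, norm_pow]
    have := Complex.abs_re_le_norm (Φ (γ t))
    simp only [Complex.norm_ofNat, Complex.norm_real, Real.norm_eq_abs]
    gcongr
  have h6 : (2 * ‖E‖ * ‖Φ q‖ + ‖E‖ * ‖Φ q‖ ^ 2) < r * E.im := by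
    rw [← div_lt_iff₀ h1]; linarith
  have h7 : 0 ≤ ‖E‖ * ‖Φ q‖ ^ 2 := by positivity
  nlinarith

lemma cone_real (D : MLData Φ a ν μ) {φ : ℝ → ℝ} (hB : BoundaryMap Φ φ) {κ : ℂ}
    (hκ : ConeAdmissible ν μ κ) {q : ℂ} (hq : q ∈ Hset) (z : ℝ) :
    0 ≤ (conj κ * conj (a q) * (z - conj q) ^ 2 * (φ z - Φ q) ^ 2).re := by
  have hy : 0 < q.im := hq
  have hzq : ∀ p ∈ Hset, (z : ℂ) - p ≠ 0 := by
    intro p hp h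
    have := congrArg Complex.im h
    simp at this
    exact (ne_of_gt hp) this
  set w₀ : ℂ := (z - q)⁻¹ with hw₀
  have hw₀ne : (z : ℂ) - q ≠ 0 := hzq q hq
  set t₀ : ℝ := w₀.im with ht₀
  have ht₀pos : 0 < t₀ := by
    have : 0 < Complex.normSq (z - q) := Complex.normSq_pos.2 hw₀ne
    rw [ht₀, hw₀, Complex.inv_im]
    simp
    positivity
  set w : ℝ → ℂ := fun t => (w₀.re : ℂ) + Complex.I * t with hw
  have hwim : ∀ t, (w t).im = t := by intro t; simp [hw]
  have hw0 : w t₀ = w₀ := by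
    apply Complex.ext <;> simp [hw, ht₀]
  have hwne : ∀ t, t₀ ≤ t → w t ≠ 0 := by
    intro t ht h
    have := hwim t
    rw [h] at this
    simp at this
    linarith
  set γ : ℝ → ℂ := fun t => z - (w t)⁻¹ with hγ
  have hγ0 : γ t₀ = q := by
    simp only [hγ, hw0, hw₀, inv_inv]
    ring
  have hγim : ∀ t, (γ t).im = t / Complex.normSq (w t) := by
    intro t; simp only [hγ, Complex.sub_im, Complex.inv_im, hwim, Complex.ofReal_im]; ring
  have hγH : ∀ t, t₀ ≤ t → γ t ∈ Hset := fun t ht => by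
    change 0 < (γ t).im
    rw [hγim]
    have := Complex.normSq_pos.2 (hwne t ht)
    have := ht₀pos.trans_le ht
    positivity
  have hd : ∀ t : ℝ, HasDerivAt (fun s : ℝ => (s : ℂ)) 1 t := fun t => Complex.ofRealCLM.hasDerivAt
  have hwd : ∀ t : ℝ, HasDerivAt w Complex.I t := fun t =>
    (((hd t).const_mul Complex.I).const_add _).congr_deriv (by ring)
  have hmain := fun t (ht : t₀ ≤ t) => D.nonneg_along_curve hκ (q := γ)
    (q' := fun t => Complex.I / w t ^ 2)
    (T := fun t => t * (Complex.I / w t ^ 2)) ht₀pos hγH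
    (fun t ht => (((hwd t).inv (hwne t ht)).const_sub (z : ℂ)).congr_deriv (by
      ring))
    (fun t ht => div_ne_zero Complex.I_ne_zero (pow_ne_zero 2 (hwne t ht))) (fun _ _ => rfl)
    (fun t ht => ((hd t).mul ((((hwd t).pow 2).fun_div (hasDerivAt_const t (1 : ℂ)) one_ne_zero
      |>.inv (by simpa using hwne t ht)).const_mul Complex.I)).congr_deriv ?_
      |>.congr_of_eventuallyEq ?_)
    (fun t ht => ?_) ht
  · simp only [hγ0] at hmain
    have hlimw : Tendsto w atTop (Bornology.cobounded ℂ) := by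
      rw [← tendsto_norm_atTop_iff_cobounded]
      refine tendsto_atTop_mono (fun t => ?_) tendsto_id
      have := Complex.abs_im_le_norm (w t)
      rw [hwim] at this
      exact (le_abs_self t).trans this
    have hlim : Tendsto γ atTop (𝓝[Hset] (z : ℂ)) := by
      refine tendsto_nhdsWithin_iff.2 ⟨?_, ?_⟩
      · have := (tendsto_inv₀_cobounded.comp hlimw).const_sub (z : ℂ)
        simpa using this
      · filter_upwards [eventually_ge_atTop t₀] with t ht using hγH t ht
    have hΦ : Tendsto (fun t => Φ (γ t)) atTop (𝓝 (φ z : ℂ)) := (hB.tendsto_real z).comp hlim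
    set E : ℂ := conj (κ * a q * (t₀ * (Complex.I / w t₀ ^ 2))) with hE
    have hcont : Continuous fun c : ℂ =>
        -(E * ((‖c‖ ^ 2 : ℝ) - 2 * c.re * Φ q + Φ q ^ 2)).im := by
      fun_prop
    have h1 := ge_of_tendsto ((hcont.tendsto _).comp hΦ)
      ((eventually_ge_atTop t₀).mono fun t ht => hmain t ht)
    have h2 : E = -Complex.I * t₀ * (conj κ * conj (a q) * (z - conj q) ^ 2) := by
      rw [hE, hw0, hw₀]
      simp only [map_mul, map_div₀, map_pow, map_inv₀, map_sub, Complex.conj_I,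
        Complex.conj_ofReal]
      simp
      ring
    have h3 : -(E * ((‖(φ z : ℂ)‖ ^ 2 : ℝ) - 2 * (φ z : ℂ).re * Φ q + Φ q ^ 2)).im
        = t₀ * (conj κ * conj (a q) * (z - conj q) ^ 2 * (φ z - Φ q) ^ 2).re := by
      have : ((‖(φ z : ℂ)‖ ^ 2 : ℝ) : ℂ) = (φ z : ℂ) ^ 2 := by
        simp [← Complex.ofReal_pow]
      rw [this, h2, Complex.ofReal_re]
      generalize conj κ * conj (a q) * (z - conj q) ^ 2 = G
      rw [show -Complex.I * t₀ * G * ((φ z : ℂ) ^ 2 - 2 * (φ z) * Φ q + Φ q ^ 2)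
        = (t₀ : ℂ) * (-Complex.I * (G * (φ z - Φ q) ^ 2)) by ring, Complex.im_ofReal_mul]
      simp
      ring
    rw [h3] at h1
    exact nonneg_of_mul_nonneg_right h1 ht₀pos
  · rw [hγim]
    have h1 := hwne t ht
    have h2 : (t : ℂ) ≠ 0 := by exact_mod_cast (ht₀pos.trans_le ht).ne'
    have h3 : ((Complex.normSq (w t) : ℝ) : ℂ) = w t * conj (w t) := (Complex.mul_conj _).symm
    have h4 : conj (w t) = w t - 2 * Complex.I * t := by
      apply Complex.ext <;> simp [hw]
      ring
    push_cast
    rw [h3, h4]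
    simp
    field_simp
    ring_nf
    simp only [Complex.I_sq, Complex.I_pow_three]
    ring
  · filter_upwards with s
    simp [div_eq_mul_inv]
  · have := (ht₀pos.trans_le ht)
    rw [hγim, Complex.normSq_eq_norm_sq]
    simp [abs_of_pos this, div_eq_mul_inv]

end MLData

/-! ### The second order operator attached to a minimal Lagrangian map -/

/-- The bilinear form `Γ(U, V)` of the operator, on the `∂`-derivatives of two functions. -/
def carre (ν : ℂ → ℂ) (μ : ℂ → ℝ) (q U V : ℂ) : ℝ :=
  q.im ^ 2 * (μ q * (U * conj V).re - (ν q * U * V).re)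

/-- `u` is twice differentiable at `q` with `∂u = U`, and the value at `q` of the operator
`y² (μ ∂∂̄u - Re (ν ∂∂u)) + y Re (i ν ∂u)` is `ℓ`. -/
def HasL (ν : ℂ → ℂ) (μ : ℂ → ℝ) (u : ℂ → ℝ) (U : ℂ) (ℓ : ℝ) (q : ℂ) : Prop :=
  ∃ (U' : ℂ → ℂ) (A : ℂ) (B : ℝ),
    (∀ᶠ z in 𝓝 q, HasW (fun z => (u z : ℂ)) (U' z) (conj (U' z)) z) ∧ HasW U' A B q ∧ U' q = U ∧
    ℓ = q.im ^ 2 * (μ q * B - (ν q * A).re) + q.im * (Complex.I * ν q * U).re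

namespace HasL

variable {ν : ℂ → ℂ} {μ u v : ℂ → ℝ} {U V q : ℂ} {ℓ k : ℝ}

lemma const (c : ℝ) (q : ℂ) : HasL ν μ (fun _ => c) 0 0 q :=
  ⟨fun _ => 0, 0, 0, Eventually.of_forall fun z => by simpa using HasW.const (c : ℂ) z,
    by simpa using HasW.const 0 q, rfl, by simp⟩

lemma add (h : HasL ν μ u U ℓ q) (h' : HasL ν μ v V k q) :
    HasL ν μ (fun z => u z + v z) (U + V) (ℓ + k) q := by
  obtain ⟨U', A, B, h1, h2, h3, h4⟩ := h
  obtain ⟨V', A', B', h1', h2', h3', h4'⟩ := h'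
  refine ⟨fun z => U' z + V' z, A + A', B + B', ?_, ?_, by simp only [h3, h3'], ?_⟩
  · filter_upwards [h1, h1'] with z hz hz'
    simpa using hz.add hz'
  · simpa using h2.add h2'
  · rw [h4, h4']
    simp only [mul_add, Complex.add_re]
    ring

lemma mul (h : HasL ν μ u U ℓ q) (h' : HasL ν μ v V k q) :
    HasL ν μ (fun z => u z * v z) (u q * V + v q * U)
      (u q * k + v q * ℓ + 2 * carre ν μ q U V) q := by
  obtain ⟨U', A, B, h1, h2, h3, h4⟩ := h
  obtain ⟨V', A', B', h1', h2', h3', h4'⟩ := h'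
  refine ⟨fun z => u z * V' z + v z * U' z, u q * A' + 2 * U * V + v q * A,
    u q * B' + 2 * (U * conj V).re + v q * B, ?_, ?_, by simp only [h3, h3'], ?_⟩
  · filter_upwards [h1, h1'] with z hz hz'
    simpa using hz.mul hz'
  · refine ((h1.self_of_nhds.mul h2').add (h1'.self_of_nhds.mul h2)).congr_coeff ?_ ?_
    · rw [h3, h3']; ring
    · rw [h3, h3']
      have : (2 * (U * conj V).re : ℂ) = U * conj V + V * conj U := by
        apply Complex.ext <;> simp <;> ring
      push_cast
      rw [this]; ring
  · rw [h4, h4', carre]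
    have e1 : (ν q * (u q * A' + 2 * U * V + v q * A)).re
        = u q * (ν q * A').re + 2 * (ν q * U * V).re + v q * (ν q * A).re := by
      rw [show ν q * (u q * A' + 2 * U * V + v q * A) = ((u q : ℝ) : ℂ) * (ν q * A')
        + ((2 : ℝ) : ℂ) * (ν q * U * V) + ((v q : ℝ) : ℂ) * (ν q * A) by push_cast; ring]
      simp only [Complex.add_re, Complex.re_ofReal_mul]
    have e2 : (Complex.I * ν q * (u q * V + v q * U)).re
        = u q * (Complex.I * ν q * V).re + v q * (Complex.I * ν q * U).re := by
      rw [show Complex.I * ν q * (u q * V + v q * U) = ((u q : ℝ) : ℂ) * (Complex.I * ν q * V)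
        + ((v q : ℝ) : ℂ) * (Complex.I * ν q * U) by ring]
      simp only [Complex.add_re, Complex.re_ofReal_mul]
    rw [e1, e2]
    ring

lemma const_mul (c : ℝ) (h : HasL ν μ u U ℓ q) : HasL ν μ (fun z => c * u z) (c * U) (c * ℓ) q := by
  simpa [carre] using (HasL.const c q).mul h

lemma inv (h : HasL ν μ u U ℓ q) (h0 : u q ≠ 0) :
    HasL ν μ (fun z => (u z)⁻¹) (-((u q ^ 2)⁻¹ : ℝ) * U)
      (-(u q ^ 2)⁻¹ * ℓ + 2 * (u q ^ 3)⁻¹ * carre ν μ q U U) q := by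
  obtain ⟨U', A, B, h1, h2, h3, h4⟩ := h
  have hne : ∀ᶠ z in 𝓝 q, u z ≠ 0 := by
    have hc : ContinuousAt (fun z => (u z : ℂ)) q := HasFDerivAt.continuousAt h1.self_of_nhds
    filter_upwards [hc.eventually_ne (Complex.ofReal_ne_zero.2 h0)] with z hz
    exact_mod_cast hz
  have h0' : (u q : ℂ) ≠ 0 := by exact_mod_cast h0
  refine ⟨fun z => -((u z : ℂ) ^ 2)⁻¹ * U' z,
    -((u q : ℂ) ^ 2)⁻¹ * A + 2 * ((u q : ℂ) ^ 3)⁻¹ * U ^ 2,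
    -(u q ^ 2)⁻¹ * B + 2 * (u q ^ 3)⁻¹ * (U * conj U).re, ?_, ?_, by simp [h3], ?_⟩
  · filter_upwards [h1, hne] with z hz hz0
    refine ((hz.inv (by exact_mod_cast hz0)).congr_of_eventuallyEq ?_).congr_coeff rfl (by simp)
    exact Eventually.of_forall fun w => by push_cast; rfl
  · have hu := h1.self_of_nhds
    have hs := hu.mul hu
    have hi := (hs.inv (mul_ne_zero h0' h0')).neg.mul h2
    refine (hi.congr_of_eventuallyEq (Eventually.of_forall fun z => ?_)).congr_coeff ?_ ?_
    · simp only [pow_two]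
    · rw [h3]
      field_simp
      ring
    · rw [h3]
      have : ((U * conj U).re : ℂ) = U * conj U := by
        apply Complex.ext <;> simp
        ring
      push_cast
      rw [this]
      field_simp
      ring
  · rw [h4, carre]
    have e1 : (ν q * (-((u q : ℂ) ^ 2)⁻¹ * A + 2 * ((u q : ℂ) ^ 3)⁻¹ * U ^ 2)).re
        = -(u q ^ 2)⁻¹ * (ν q * A).re + 2 * (u q ^ 3)⁻¹ * (ν q * U * U).re := by
      rw [show ν q * (-((u q : ℂ) ^ 2)⁻¹ * A + 2 * ((u q : ℂ) ^ 3)⁻¹ * U ^ 2)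
        = ((-(u q ^ 2)⁻¹ : ℝ) : ℂ) * (ν q * A) + ((2 * (u q ^ 3)⁻¹ : ℝ) : ℂ) * (ν q * U * U) by
          push_cast; ring]
      simp only [Complex.add_re, Complex.re_ofReal_mul]
    have e2 : (Complex.I * ν q * (-((u q ^ 2)⁻¹ : ℝ) * U)).re
        = -(u q ^ 2)⁻¹ * (Complex.I * ν q * U).re := by
      rw [show Complex.I * ν q * (-((u q ^ 2)⁻¹ : ℝ) * U)
        = ((-(u q ^ 2)⁻¹ : ℝ) : ℂ) * (Complex.I * ν q * U) by push_cast; ring]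
      simp only [Complex.re_ofReal_mul]
    rw [e1, e2]
    ring

end HasL

/-- A function of a real variable with a local maximum has nonpositive second derivative. -/
lemma second_deriv_nonpos_of_isLocalMax {g g' : ℝ → ℝ} {x g'' : ℝ} (hmax : IsLocalMax g x)
    (hg : ∀ᶠ t in 𝓝 x, HasDerivAt g (g' t) t) (hg' : HasDerivAt g' g'' x) : g'' ≤ 0 := by
  by_contra! hpos
  have hd : deriv g =ᶠ[𝓝 x] g' := hg.mono fun t ht => ht.deriv
  have h2 : deriv (deriv g) x = g'' := by
    rw [hd.deriv_eq]; exact hg'.deriv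
  have hmin : IsLocalMin g x := isLocalMin_of_deriv_deriv_pos (by rw [h2]; exact hpos)
    hmax.deriv_eq_zero hg.self_of_nhds.continuousAt
  have hconst : ∀ᶠ t in 𝓝 x, g t = g x := by
    filter_upwards [hmax, hmin] with t h1 h2 using le_antisymm h1 h2
  have hd0 : deriv g =ᶠ[𝓝 x] fun _ => 0 := by
    filter_upwards [hconst.eventually_nhds] with t ht
    rw [EventuallyEq.deriv_eq (f := fun _ => g x) ht, deriv_const]
  have : deriv (deriv g) x = 0 := by rw [hd0.deriv_eq, deriv_const]
  linarith

/-- The maximum principle. -/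
lemma HasL.nonpos_of_isLocalMax {ν : ℂ → ℂ} {μ u : ℂ → ℝ} {U q : ℂ} {ℓ : ℝ}
    (h : HasL ν μ u U ℓ q) (hmax : IsLocalMax u q) (hν : ‖ν q‖ ≤ μ q) : ℓ ≤ 0 := by
  obtain ⟨U', A, B, h1, h2, h3, h4⟩ := h
  have hU : U = 0 := by
    have hf : HasFDerivAt u (Complex.reCLM.comp (wirtinger (U' q) (conj (U' q)))) q := by
      have := Complex.reCLM.hasFDerivAt.comp q h1.self_of_nhds
      exact this
    have h0 := hmax.hasFDerivAt_eq_zero hf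
    have e1 := congrArg (fun L => L 1) h0
    have e2 := congrArg (fun L => L Complex.I) h0
    simp at e1 e2
    rw [← h3]
    apply Complex.ext
    · simpa using e1
    · rw [Complex.zero_im]
      linarith
  have hsec : ∀ v : ℂ, (A * v ^ 2).re + B * ‖v‖ ^ 2 ≤ 0 := by
    intro v
    set c : ℝ → ℂ := fun t => q + t * v with hc
    have hcd : ∀ t, HasDerivAt c v t := fun t =>
      ((Complex.ofRealCLM.hasDerivAt (x := t)).mul_const v |>.const_add q).congr_deriv (by simp)
    have hc0 : c 0 = q := by simp [hc]
    have hct : Tendsto c (𝓝 0) (𝓝 q) := by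
      have := (hcd 0).continuousAt.tendsto
      rwa [hc0] at this
    have hm : IsLocalMax (fun t => u (c t)) 0 := by
      have := hct.eventually hmax
      filter_upwards [this] with t ht
      rwa [hc0]
    have hg : ∀ᶠ t in 𝓝 (0 : ℝ), HasDerivAt (fun t => u (c t)) ((2 * (U' (c t) * v)).re) t := by
      filter_upwards [hct.eventually h1] with t ht
      have := Complex.reCLM.hasFDerivAt.comp_hasDerivAt t (ht.comp_curve (hcd t))
      refine (HasDerivAt.congr_deriv this ?_)
      simp
      ring
    have hg' : HasDerivAt (fun t => (2 * (U' (c t) * v)).re)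
        (2 * ((A * v + B * conj v) * v)).re 0 := by
      rw [← hc0] at h2
      have := ((h2.comp_curve (hcd 0)).mul_const v).const_mul 2
      exact Complex.reCLM.hasFDerivAt.comp_hasDerivAt 0 this
    have h5 := second_deriv_nonpos_of_isLocalMax hm hg hg'
    have h6 : (2 * ((A * v + B * conj v) * v)).re = 2 * ((A * v ^ 2).re + B * ‖v‖ ^ 2) := by
      rw [← Complex.normSq_eq_norm_sq, Complex.normSq_apply]
      simp [pow_two]
      ring
    linarith
  have hB : B ≤ 0 := by
    have e1 := hsec 1
    have e2 := hsec Complex.I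
    simp at e1 e2
    linarith
  obtain ⟨w, hw⟩ := IsAlgClosed.exists_pow_nat_eq (-(ν q)) (n := 2) two_pos
  have h5 := hsec w
  have h6 : ‖w‖ ^ 2 = ‖ν q‖ := by rw [← norm_pow, hw, norm_neg]
  rw [hw, h6] at h5
  have h7 : (A * -(ν q)).re = -(ν q * A).re := by rw [← Complex.neg_re]; ring_nf
  rw [h7] at h5
  have h8 : μ q * B - (ν q * A).re ≤ 0 := by nlinarith
  rw [h4, hU, mul_zero, Complex.zero_re, mul_zero, add_zero]
  exact mul_nonpos_of_nonneg_of_nonpos (sq_nonneg _) h8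

lemma HasW.eq_conj_of_real {u : ℂ → ℝ} {A B q : ℂ} (h : HasW (fun z => (u z : ℂ)) A B q) :
    A = conj B := by
  have h2 := h.star
  simp only [Complex.conj_ofReal] at h2
  exact (h.unique h2).1

lemma ofReal_re_eq (z : ℂ) : ((z.re : ℝ) : ℂ) = (z + conj z) / 2 := by
  apply Complex.ext <;> simp

lemma ofReal_im_eq (z : ℂ) : ((z.im : ℝ) : ℂ) = -Complex.I * (z - conj z) / 2 := by
  apply Complex.ext <;> simp

namespace MLData

variable {Φ a ν : ℂ → ℂ} {μ : ℂ → ℝ}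

lemma hasW_nu (D : MLData Φ a ν μ) {q : ℂ} (hq : q ∈ Hset) : HasW ν (dz ν q) (dzb ν q) q :=
  hasW_of_differentiableAt
    (((D.contDiff_nu.contDiffAt (isOpen_Hset.mem_nhds hq))).differentiableAt (by norm_num))

/-- The derivative `∂̄μ`, as given by the Codazzi equation. -/
def dbarMu (ν : ℂ → ℂ) (q : ℂ) : ℂ := dz ν q + Complex.I / (q.im : ℂ) * ν q

lemma hasW_mu (D : MLData Φ a ν μ) {q : ℂ} (hq : q ∈ Hset) :
    HasW (fun z => (μ z : ℂ)) (conj (dbarMu ν q)) (dbarMu ν q) q := by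
  have h : DifferentiableAt ℝ (fun z => (μ z : ℂ)) q :=
    Complex.ofRealCLM.differentiableAt.comp q
      (((D.contDiff_mu.contDiffAt (isOpen_Hset.mem_nhds hq))).differentiableAt (by norm_num))
  have h2 := hasW_of_differentiableAt h
  have h3 := D.codazzi q hq
  have h4 := h2.eq_conj_of_real
  exact h2.congr_coeff (by rw [h4, h3, dbarMu]) h3

lemma mu_sq_complex (D : MLData Φ a ν μ) {q : ℂ} (hq : q ∈ Hset) :
    (μ q : ℂ) ^ 2 = 1 + ν q * conj (ν q) := by
  rw [Complex.mul_conj']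
  exact_mod_cast D.mu_sq q hq

lemma one_le_mu (D : MLData Φ a ν μ) {q : ℂ} (hq : q ∈ Hset) : 1 ≤ μ q := by
  have h1 := D.mu_sq q hq
  have h2 := D.mu_pos q hq
  nlinarith [sq_nonneg ‖ν q‖]

lemma norm_nu_lt (D : MLData Φ a ν μ) {q : ℂ} (hq : q ∈ Hset) : ‖ν q‖ < μ q := by
  have h1 := D.mu_sq q hq
  have h2 := D.mu_pos q hq
  nlinarith [norm_nonneg (ν q)]

lemma dbar_mu_sq (D : MLData Φ a ν μ) {q : ℂ} (hq : q ∈ Hset) :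
    2 * μ q * dbarMu ν q = conj (ν q) * dzb ν q + ν q * conj (dz ν q) := by
  have h1 := (D.hasW_mu hq).mul (D.hasW_mu hq)
  have h2 := ((D.hasW_nu hq).mul (D.hasW_nu hq).star).add (HasW.const 1 q)
  have h3 : (fun z => (μ z : ℂ) * μ z) =ᶠ[𝓝 q] fun z => ν z * conj (ν z) + 1 := by
    filter_upwards [isOpen_Hset.mem_nhds hq] with z hz
    rw [← pow_two, D.mu_sq_complex hz]; ring
  have h4 := (h1.unique (h2.congr_of_eventuallyEq h3)).2
  linear_combination h4

end MLData

/-- A pair of functions satisfying the first order system of the matrix coefficients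
`P(q̄, Φ) ω` and `P(q̄, Φ̄) ω̄` of a minimal Lagrangian map, where `ω² = 1 / (y² a)`. -/
structure KPair (ν : ℂ → ℂ) (μ : ℂ → ℝ) (Ω Ξ : ℂ → ℂ) : Prop where
  hasW_fst : ∀ q ∈ Hset, HasW Ω (Complex.I / 2 * (q.im : ℂ)⁻¹ * (μ q * Ξ q))
    (Complex.I / 2 * (q.im : ℂ)⁻¹ * (ν q * Ξ q - conj (Ξ q))) q
  hasW_snd : ∀ q ∈ Hset, HasW Ξ (Complex.I / 2 * (q.im : ℂ)⁻¹ * (Ξ q - conj (ν q) * Ω q))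
    (Complex.I / 2 * (q.im : ℂ)⁻¹ * (Ξ q - conj (Ω q) - μ q * Ω q)) q

namespace KPair

variable {Φ a ν Ω Ξ : ℂ → ℂ} {μ : ℂ → ℝ}

/-- The derivative `∂ Re Ω`. -/
def dRe (ν : ℂ → ℂ) (μ : ℂ → ℝ) (Ξ : ℂ → ℂ) (q : ℂ) : ℂ :=
  Complex.I / 4 * ((q.im : ℂ)⁻¹ * ((1 + μ q) * Ξ q - conj (ν q) * conj (Ξ q)))

/-- The derivative `∂ Im Ω`. -/
def dIm (ν : ℂ → ℂ) (μ : ℂ → ℝ) (Ξ : ℂ → ℂ) (q : ℂ) : ℂ :=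
  -1 / 4 * ((q.im : ℂ)⁻¹ * ((1 - μ q) * Ξ q - conj (ν q) * conj (Ξ q)))

lemma hasW_re (P : KPair ν μ Ω Ξ) {q : ℂ} (hq : q ∈ Hset) :
    HasW (fun z => ((Ω z).re : ℂ)) (dRe ν μ Ξ q) (conj (dRe ν μ Ξ q)) q := by
  refine (P.hasW_fst q hq).ofReal_re.congr_coeff ?_ ?_
  · simp [dRe, map_ofNat]; ring
  · simp [dRe, map_ofNat]; ring

lemma hasW_im (P : KPair ν μ Ω Ξ) {q : ℂ} (hq : q ∈ Hset) :
    HasW (fun z => ((Ω z).im : ℂ)) (dIm ν μ Ξ q) (conj (dIm ν μ Ξ q)) q := by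
  refine (P.hasW_fst q hq).ofReal_im.congr_coeff ?_ ?_
  · simp [dIm, map_ofNat]; ring_nf; simp only [Complex.I_sq]; ring
  · simp [dIm, map_ofNat]; ring_nf; simp only [Complex.I_sq]; ring

lemma carre_dRe (D : MLData Φ a ν μ) (Ξ : ℂ → ℂ) {q : ℂ} (hq : q ∈ Hset) :
    carre ν μ q (dRe ν μ Ξ q) (dRe ν μ Ξ q) = (1 + μ q) / 8 * ‖Ξ q‖ ^ 2 := by
  have hy : (q.im : ℂ) ≠ 0 := by exact_mod_cast (ne_of_gt hq)
  have hμ := D.mu_sq_complex hq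
  apply Complex.ofReal_injective
  rw [carre]
  push_cast
  rw [ofReal_re_eq, ofReal_re_eq, ← Complex.mul_conj', dRe]
  simp only [map_mul, map_sub, map_add, map_div₀, map_inv₀, map_one, map_ofNat, map_neg,
    Complex.conj_I, Complex.conj_ofReal, Complex.conj_conj]
  linear_combination (norm := skip) (1 / 16 * ((2 + μ q) * (Ξ q * conj (Ξ q))
    - (ν q * Ξ q ^ 2 + conj (ν q) * conj (Ξ q) ^ 2) / 2)) * hμ
  field_simp
  ring_nf
  simp only [Complex.I_sq]
  ring

lemma carre_dIm (D : MLData Φ a ν μ) (Ξ : ℂ → ℂ) {q : ℂ} (hq : q ∈ Hset) :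
    carre ν μ q (dIm ν μ Ξ q) (dIm ν μ Ξ q) = (μ q - 1) / 8 * ‖Ξ q‖ ^ 2 := by
  have hy : (q.im : ℂ) ≠ 0 := by exact_mod_cast (ne_of_gt hq)
  have hμ := D.mu_sq_complex hq
  apply Complex.ofReal_injective
  rw [carre]
  push_cast
  rw [ofReal_re_eq, ofReal_re_eq, ← Complex.mul_conj', dIm]
  simp only [map_mul, map_sub, map_neg, map_div₀, map_inv₀, map_one, map_ofNat,
    Complex.conj_ofReal, Complex.conj_conj]
  linear_combination (norm := skip) (1 / 16 * (-(2 - μ q) * (Ξ q * conj (Ξ q))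
    + (ν q * Ξ q ^ 2 + conj (ν q) * conj (Ξ q) ^ 2) / 2)) * hμ
  field_simp
  ring_nf

lemma hasL_re (P : KPair ν μ Ω Ξ) (D : MLData Φ a ν μ) {q : ℂ} (hq : q ∈ Hset) :
    HasL ν μ (fun z => (Ω z).re) (dRe ν μ Ξ q) ((1 + μ q) / 4 * (Ω q).re) q := by
  have hy : (q.im : ℂ) ≠ 0 := by exact_mod_cast (ne_of_gt hq)
  have hμ := D.mu_sq_complex hq
  have hW := (((HasW.im q).inv hy).mul ((((HasW.const 1 q).add (D.hasW_mu hq)).mul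
    (P.hasW_snd q hq)).sub ((D.hasW_nu hq).star.mul (P.hasW_snd q hq).star))).const_mul
      (Complex.I / 4)
  have hC := D.dbar_mu_sq hq
  have hp : dz ν q = MLData.dbarMu ν q - Complex.I / (q.im : ℂ) * ν q := by
    rw [MLData.dbarMu]; ring
  have hCb := congrArg conj hC
  refine ⟨dRe ν μ Ξ, _, μ q * (1 + μ q) * (Ω q).re / (4 * q.im ^ 2)
    - (MLData.dbarMu ν q * Ξ q).im / (2 * q.im), ?_, hW.congr_coeff rfl ?_, rfl, ?_⟩
  · filter_upwards [isOpen_Hset.mem_nhds hq] with z hz using P.hasW_re hz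
  · push_cast
    rw [ofReal_re_eq (Ω q), ofReal_im_eq (MLData.dbarMu ν q * Ξ q), hp]
    simp only [map_mul, map_sub, map_div₀, map_inv₀, map_ofNat, Complex.conj_I,
      Complex.conj_ofReal, Complex.conj_conj]
    linear_combination (norm := skip) (-(conj (Ω q)) / (8 * (q.im : ℂ) ^ 2)) * hμ
    field_simp
    ring_nf
    simp only [Complex.I_sq]
    ring
  · apply Complex.ofReal_injective
    push_cast
    simp only [ofReal_re_eq, ofReal_im_eq (MLData.dbarMu ν q * Ξ q), dRe]
    rw [hp] at hC hCb
    simp only [map_mul, map_sub, map_add, map_div₀, map_inv₀, map_one, map_zero, map_ofNat, map_neg,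
      map_pow, Complex.conj_I, Complex.conj_ofReal, Complex.conj_conj] at hC hCb ⊢
    linear_combination (norm := skip) (-(1 + μ q : ℂ) / 4 * ((Ω q + conj (Ω q)) / 2)) * hμ
      - (Complex.I * q.im / 8 * Ξ q) * hC + (Complex.I * q.im / 8 * conj (Ξ q)) * hCb
    field_simp
    ring_nf
    simp only [Complex.I_sq]
    ring

lemma hasL_im (P : KPair ν μ Ω Ξ) (D : MLData Φ a ν μ) {q : ℂ} (hq : q ∈ Hset) :
    HasL ν μ (fun z => (Ω z).im) (dIm ν μ Ξ q) ((μ q - 1) / 4 * (Ω q).im) q := by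
  have hy : (q.im : ℂ) ≠ 0 := by exact_mod_cast (ne_of_gt hq)
  have hμ := D.mu_sq_complex hq
  have hW := (((HasW.im q).inv hy).mul ((((HasW.const 1 q).sub (D.hasW_mu hq)).mul
    (P.hasW_snd q hq)).sub ((D.hasW_nu hq).star.mul (P.hasW_snd q hq).star))).const_mul
      (-1 / 4)
  have hC := D.dbar_mu_sq hq
  have hp : dz ν q = MLData.dbarMu ν q - Complex.I / (q.im : ℂ) * ν q := by
    rw [MLData.dbarMu]; ring
  have hCb := congrArg conj hC
  refine ⟨dIm ν μ Ξ, _, μ q * (μ q - 1) * (Ω q).im / (4 * q.im ^ 2)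
    + (MLData.dbarMu ν q * Ξ q).re / (2 * q.im), ?_, hW.congr_coeff rfl ?_, rfl, ?_⟩
  · filter_upwards [isOpen_Hset.mem_nhds hq] with z hz using P.hasW_im hz
  · push_cast
    rw [ofReal_im_eq (Ω q), ofReal_re_eq (MLData.dbarMu ν q * Ξ q), hp]
    simp only [map_mul, map_sub, map_div₀, map_inv₀, map_ofNat, Complex.conj_I,
      Complex.conj_ofReal, Complex.conj_conj]
    linear_combination (norm := skip) (-(Complex.I * conj (Ω q)) / (8 * (q.im : ℂ) ^ 2)) * hμ
    field_simp
    ring_nf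
  · apply Complex.ofReal_injective
    push_cast
    simp only [ofReal_re_eq, ofReal_im_eq (Ω q), dIm]
    rw [hp] at hC hCb
    simp only [map_mul, map_sub, map_add, map_div₀, map_inv₀, map_one, map_zero, map_ofNat, map_neg,
      map_pow, Complex.conj_I, Complex.conj_ofReal, Complex.conj_conj] at hC hCb ⊢
    linear_combination (norm := skip) (-(μ q - 1 : ℂ) / 4
      * (-Complex.I * (Ω q - conj (Ω q)) / 2)) * hμ
      - (q.im / 8 * Ξ q) * hC - (q.im / 8 * conj (Ξ q)) * hCb
    field_simp
    ring_nf

end KPair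

lemma exists_hasW_dz {u : ℂ → ℂ} {q : ℂ} (h : ContDiffAt ℝ 2 u q) :
    ∃ A S B, HasW (dz u) A S q ∧ HasW (dzb u) S B q := by
  have hd : HasFDerivAt (fderiv ℝ u) (fderiv ℝ (fderiv ℝ u) q) q :=
    ((h.fderiv_right (m := 1) (by norm_num)).differentiableAt (by norm_num)).hasFDerivAt
  have hs : ∀ v w, fderiv ℝ (fderiv ℝ u) q v w = fderiv ℝ (fderiv ℝ u) q w v :=
    h.isSymmSndFDerivAt (by simp)
  set f := fderiv ℝ (fderiv ℝ u) q
  have e : ∀ w : ℂ, HasW (fun z => fderiv ℝ u z w)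
      ((f 1 w - Complex.I * f Complex.I w) / 2) ((f 1 w + Complex.I * f Complex.I w) / 2) q := by
    intro w
    have h1 : HasFDerivAt (fun z => fderiv ℝ u z w)
        ((ContinuousLinearMap.apply ℝ ℂ w).comp f) q :=
      (ContinuousLinearMap.apply ℝ ℂ w).hasFDerivAt.comp q hd
    rw [eq_wirtinger ((ContinuousLinearMap.apply ℝ ℂ w).comp f)] at h1
    exact h1
  have h1 := e 1
  have hI := e Complex.I
  refine ⟨_, _, _, ((h1.sub (hI.const_mul Complex.I)).const_mul (1 / 2)).congr_of_eventuallyEq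
    (Eventually.of_forall fun z => ?_), (((h1.add (hI.const_mul Complex.I)).const_mul
      (1 / 2)).congr_of_eventuallyEq (Eventually.of_forall fun z => ?_)).congr_coeff ?_ rfl⟩
  · simp only [dz]; ring
  · simp only [dzb]; ring
  · have := hs 1 Complex.I
    linear_combination (Complex.I / 2) * this

namespace MLData

variable {Φ a ν : ℂ → ℂ} {μ : ℂ → ℝ}

lemma laplace_mu_bound {y μ b : ℝ} {n S r M : ℂ} (hy : 0 < y) (hμ : μ ^ 2 = 1 + ‖n‖ ^ 2)
    (hμ1 : 1 ≤ μ)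
    (hrel : 2 * (μ : ℂ) * b + M * (2 * conj M) = conj n * S + r * conj r
      + (n * conj S + conj (M - Complex.I / y * n) * (M - Complex.I / y * n)))
    (hC : 2 * (μ : ℂ) * M = conj n * r + n * conj (M - Complex.I / y * n)) :
    2 * (y ^ 2 * (μ * (conj M * conj (conj M)).re - (n * conj M * conj M).re)) / (μ + 1)
      - ‖n‖ ^ 2 / 2 ≤ y ^ 2 * (μ * b - (n * conj (S + (Complex.I * (y : ℂ)⁻¹ * r
        + n * (Complex.I * (-((y : ℂ) ^ 2)⁻¹ * (Complex.I / 2)))))).re)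
        + y * (Complex.I * n * conj M).re := by
  have hyc : (y : ℂ) ≠ 0 := by exact_mod_cast hy.ne'
  obtain ⟨R, hR⟩ : ∃ R : ℂ, R = y * r + Complex.I * n := ⟨_, rfl⟩
  obtain ⟨m, hm⟩ : ∃ m : ℂ, m = y * M := ⟨_, rfl⟩
  have hr' : r = (R - Complex.I * n) / y := by rw [hR]; field_simp; ring
  have hM' : M = m / y := by rw [hm]; field_simp
  subst hr' hM'
  clear hR hm
  simp only [map_div₀, map_mul, map_sub, Complex.conj_I, Complex.conj_ofReal]
    at hrel hC
  have e1 : y ^ 2 * (μ * b - (n * conj (S + (Complex.I * (y : ℂ)⁻¹ * ((R - Complex.I * n) / y)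
        + n * (Complex.I * (-((y : ℂ) ^ 2)⁻¹ * (Complex.I / 2)))))).re)
        + y * (Complex.I * n * conj (m / y)).re = (‖R‖ ^ 2 - ‖m‖ ^ 2) / 2 - ‖n‖ ^ 2 / 2 := by
    apply Complex.ofReal_injective
    push_cast
    simp only [ofReal_re_eq, ← Complex.mul_conj']
    simp only [map_div₀, map_mul, map_sub, map_add, map_neg, map_pow, map_inv₀, map_ofNat,
      Complex.conj_I, Complex.conj_ofReal, Complex.conj_conj]
    linear_combination (norm := skip) ((y : ℂ) ^ 2 / 2) * hrel
    field_simp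
    ring_nf
    simp only [Complex.I_sq]
    ring
  have e2 : y ^ 2 * (μ * (conj (m / y) * conj (conj (m / y))).re
      - (n * conj (m / y) * conj (m / y)).re) = μ * ‖m‖ ^ 2 - (n * conj m * conj m).re := by
    apply Complex.ofReal_injective
    push_cast
    simp only [ofReal_re_eq, ← Complex.mul_conj']
    simp only [map_div₀, map_mul, Complex.conj_ofReal, Complex.conj_conj]
    field_simp
    ring
  have e3 : conj n * R = 2 * μ * m - n * conj m := by
    linear_combination (norm := skip) (-(y : ℂ)) * hC
    field_simp
    ring
  have e4 : ‖n‖ ^ 2 * ((‖R‖ ^ 2 - ‖m‖ ^ 2) / 2)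
      = 2 * μ * (μ * ‖m‖ ^ 2 - (n * conj m * conj m).re) := by
    have e3b := congrArg conj e3
    apply Complex.ofReal_injective
    push_cast
    simp only [ofReal_re_eq, ← Complex.mul_conj']
    simp only [map_mul, map_sub, map_ofNat, Complex.conj_ofReal, Complex.conj_conj] at e3b ⊢
    linear_combination (n * conj R / 2) * e3 + ((2 * μ * m - n * conj m) / 2) * e3b
  rw [e1, e2]
  have hn : ‖n‖ ^ 2 = (μ - 1) * (μ + 1) := by linarith
  have hΓ : 0 ≤ μ * ‖m‖ ^ 2 - (n * conj m * conj m).re := by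
    have h1 := Complex.re_le_norm (n * conj m * conj m)
    simp only [norm_mul, RCLike.norm_conj] at h1
    have h2 : ‖n‖ ≤ μ := by nlinarith [norm_nonneg n]
    nlinarith [mul_nonneg (sub_nonneg.2 h2) (sq_nonneg ‖m‖)]
  generalize μ * ‖m‖ ^ 2 - (n * conj m * conj m).re = G at *
  suffices 2 * G / (μ + 1) ≤ (‖R‖ ^ 2 - ‖m‖ ^ 2) / 2 by linarith
  rw [div_le_iff₀ (by linarith)]
  rcases hμ1.eq_or_lt with h | h
  · have hn0 : n = 0 := by
      rw [← h] at hn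
      have : ‖n‖ = 0 := by nlinarith
      exact norm_eq_zero.1 this
    subst hn0
    have hm0 : m = 0 := by
      have : (2 * (μ : ℂ)) * m = 0 := by linear_combination -e3 + (R) * (map_zero (starRingEnd ℂ))
      rcases mul_eq_zero.1 this with h' | h'
      · exfalso
        have h'' : 2 * μ = 0 := by exact_mod_cast h'
        linarith
      · exact h'
    subst hm0
    rw [norm_zero] at e4
    have : G = 0 := by nlinarith
    rw [this]
    simp only [norm_zero]
    nlinarith [mul_nonneg (sq_nonneg ‖R‖) (by linarith : (0 : ℝ) ≤ μ + 1)]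
  · rw [hn] at e4
    have h1 : (μ - 1) * (2 * G) ≤ (μ - 1) * ((‖R‖ ^ 2 - ‖m‖ ^ 2) / 2 * (μ + 1)) := by nlinarith
    exact le_of_mul_le_mul_left h1 (by linarith)

lemma exists_hasL_mu (D : MLData Φ a ν μ) {q : ℂ} (hq : q ∈ Hset) :
    ∃ ℓ, HasL ν μ μ (conj (dbarMu ν q)) ℓ q ∧
      2 * carre ν μ q (conj (dbarMu ν q)) (conj (dbarMu ν q)) / (μ q + 1) - ‖ν q‖ ^ 2 / 2 ≤ ℓ := by
  have hy : (q.im : ℂ) ≠ 0 := by exact_mod_cast (ne_of_gt hq)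
  have hy0 : 0 < q.im := hq
  have hnhds := isOpen_Hset.mem_nhds hq
  obtain ⟨P, S, T, hp, hr⟩ := exists_hasW_dz (D.contDiff_nu.contDiffAt hnhds)
  obtain ⟨X, B, Z, hm1, hm2⟩ := exists_hasW_dz
    ((Complex.ofRealCLM.contDiff.contDiffAt (x := μ q)).comp q (D.contDiff_mu.contDiffAt hnhds))
  have hM := hp.add ((((HasW.im q).inv hy).const_mul Complex.I).mul (D.hasW_nu hq))
  have hM' : HasW (dbarMu ν) _ _ q := hM.congr_of_eventuallyEq
    (Eventually.of_forall fun z => by simp only [dbarMu, div_eq_mul_inv])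
  have hB1 := (hM'.unique (hm2.congr_of_eventuallyEq (v := dbarMu ν) (by
    filter_upwards [hnhds] with z hz using (D.hasW_mu hz).dzb_eq.symm))).1
  have hB2 := (hM'.star.unique (hm1.congr_of_eventuallyEq (v := fun z => conj (dbarMu ν z)) (by
    filter_upwards [hnhds] with z hz using (D.hasW_mu hz).dz_eq.symm))).2
  have hBr : conj B = B := by rw [hB1] at hB2; exact hB2
  obtain ⟨b, rfl⟩ := Complex.conj_eq_iff_real.1 hBr
  have hrel := ((((HasW.const 2 q).mul (D.hasW_mu hq)).mul hM').unique
    ((((D.hasW_nu hq).star.mul hr).add ((D.hasW_nu hq).mul hp.star)).congr_of_eventuallyEq (by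
      filter_upwards [hnhds] with z hz using D.dbar_mu_sq hz))).1
  rw [hB1] at hrel
  have hC := D.dbar_mu_sq hq
  have hμ := D.mu_sq q hq
  have hμ1 := D.one_le_mu hq
  refine ⟨_, ⟨fun z => conj (dbarMu ν z), _, b, ?_, hM'.star.congr_coeff rfl hB2, rfl, rfl⟩, ?_⟩
  · filter_upwards [hnhds] with z hz
    simpa using D.hasW_mu hz
  have hpM : dz ν q = dbarMu ν q - Complex.I / (q.im : ℂ) * ν q := by
    rw [dbarMu]; ring
  rw [hpM] at hrel hC
  simp only [mul_zero, add_zero] at hrel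
  rw [carre]
  exact laplace_mu_bound hy0 hμ hμ1 hrel hC

/-- The square of the principal curvature. -/
def lamSq (μ : ℂ → ℝ) (q : ℂ) : ℝ := 1 + -2 * (1 + μ q)⁻¹

lemma exists_hasL_lamSq (D : MLData Φ a ν μ) {q : ℂ} (hq : q ∈ Hset) :
    ∃ U ℓ, HasL ν μ (lamSq μ) U ℓ q ∧ -lamSq μ q ≤ ℓ := by
  obtain ⟨ℓ, hL, hle⟩ := D.exists_hasL_mu hq
  have hμ1 := D.one_le_mu hq
  have hμ := D.mu_sq q hq
  have hpos : 0 < 1 + μ q := by linarith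
  have h1 := (HasL.const 1 q).add ((((HasL.const 1 q).add hL).inv hpos.ne').const_mul (-2))
  refine ⟨_, _, h1, ?_⟩
  simp only [zero_add, lamSq]
  generalize carre ν μ q (conj (dbarMu ν q)) (conj (dbarMu ν q)) = G at *
  have hw : 0 < (1 + μ q)⁻¹ := inv_pos.2 hpos
  have h2 : -(‖ν q‖ ^ 2 / 2) ≤ ℓ - 2 * G * (1 + μ q)⁻¹ := by
    rw [div_eq_mul_inv, add_comm (μ q) 1] at hle
    linarith
  have h3 := mul_le_mul_of_nonneg_left h2 (by positivity : 0 ≤ 2 * (1 + μ q)⁻¹ ^ 2)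
  have h4 : 2 * (1 + μ q)⁻¹ ^ 2 * -(‖ν q‖ ^ 2 / 2) = -(1 + -2 * (1 + μ q)⁻¹) := by
    have : ‖ν q‖ ^ 2 = μ q ^ 2 - 1 := by linarith
    rw [this]
    field_simp
    ring
  rw [h4] at h3
  simp only [← inv_pow]
  linarith

end MLData

lemma MLData.coneAdmissible_one {Φ a ν : ℂ → ℂ} {μ : ℂ → ℝ} (D : MLData Φ a ν μ) :
    MLData.ConeAdmissible ν μ 1 := by
  intro q hq v hv
  have h1 := D.norm_nu_lt hq
  have h2 : 0 < ‖v‖ := norm_pos_iff.2 hv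
  have h3 := Complex.abs_re_le_norm (conj (ν q) * v * v)
  simp only [norm_mul, RCLike.norm_conj] at h3
  have h4 : (1 * conj (μ q * v + ν q * conj v) * v).re
      = μ q * ‖v‖ ^ 2 + (conj (ν q) * v * v).re := by
    apply Complex.ofReal_injective
    push_cast
    simp only [ofReal_re_eq, ← Complex.mul_conj']
    simp only [map_mul, map_add, map_one, Complex.conj_conj, Complex.conj_ofReal]
    ring
  rw [h4]
  have h5 := neg_le_of_abs_le h3
  nlinarith [mul_pos (sub_pos.2 h1) (mul_pos h2 h2)]

/-- `ω` is a square root of `1 / (y² a)` with argument at most `π / 4`. -/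
structure IsOmega (Φ a ν : ℂ → ℂ) (μ : ℂ → ℝ) (ω : ℂ → ℂ) : Prop where
  hasW : ∀ q ∈ Hset, HasW ω (Complex.I / 2 * (q.im : ℂ)⁻¹ * (μ q * conj (ω q)))
    (Complex.I / 2 * (q.im : ℂ)⁻¹ * (ν q * conj (ω q) - ω q)) q
  sq_mul : ∀ q ∈ Hset, ω q ^ 2 * (a q * (q.im : ℂ) ^ 2) = 1
  mul_a : ∀ q ∈ Hset, ω q * a q * q.im = conj (ω q) * (Φ q).im
  norm_sq : ∀ q ∈ Hset, ‖ω q‖ ^ 2 * (q.im * (Φ q).im) = 1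
  abs_im_le : ∀ q ∈ Hset, |(ω q).im| ≤ (ω q).re

lemma abs_im_le_abs_re_of_sq {w : ℂ} (h : 0 ≤ (w ^ 2).re) : |w.im| ≤ |w.re| := by
  rw [← sq_le_sq]
  simp [pow_two] at h
  nlinarith

lemma MLData.exists_isOmega {Φ a ν : ℂ → ℂ} {μ : ℂ → ℝ} {φ : ℝ → ℝ} (D : MLData Φ a ν μ)
    (hB : BoundaryMap Φ φ) : ∃ ω, IsOmega Φ a ν μ ω := by
  have hre : ∀ q ∈ Hset, 0 ≤ (a q).re := by
    intro q hq
    simpa using D.cone_infty hB D.coneAdmissible_one hq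
  have hslit : ∀ q ∈ Hset, a q ∈ Complex.slitPlane := by
    intro q hq
    rw [Complex.mem_slitPlane_iff]
    by_contra! h
    exact D.a_ne_zero hq (Complex.ext (le_antisymm h.1 (hre q hq)) h.2)
  set ω : ℂ → ℂ := fun q => Complex.exp (-1 / 2 * Complex.log (a q)) * (q.im : ℂ)⁻¹ with hω
  have hsq : ∀ q ∈ Hset, ω q ^ 2 * (a q * (q.im : ℂ) ^ 2) = 1 := by
    intro q hq
    have hy : (q.im : ℂ) ≠ 0 := by exact_mod_cast (ne_of_gt hq)
    have h1 : Complex.exp (-1 / 2 * Complex.log (a q)) ^ 2 * a q = 1 := by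
      rw [← Complex.exp_nat_mul]
      nth_rewrite 2 [← Complex.exp_log (D.a_ne_zero hq)]
      rw [← Complex.exp_add]
      push_cast
      ring_nf
      simp
    simp only [hω]
    generalize Complex.exp (-1 / 2 * Complex.log (a q)) = e at *
    field_simp
    linear_combination h1
  have hn : ∀ q ∈ Hset, ‖ω q‖ ^ 2 * (q.im * (Φ q).im) = 1 := by
    intro q hq
    have h1 := congrArg norm (hsq q hq)
    have hy : 0 < q.im := hq
    simp only [norm_mul, norm_pow, Complex.norm_real, norm_one, Real.norm_eq_abs,
      abs_of_pos hy] at h1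
    rw [← D.norm_a q hq, ← h1]
    ring
  have hma : ∀ q ∈ Hset, ω q * a q * q.im = conj (ω q) * (Φ q).im := by
    intro q hq
    have hy : (q.im : ℂ) ≠ 0 := by exact_mod_cast (ne_of_gt hq)
    have h1 : (ω q * conj (ω q)) * (q.im * (Φ q).im) = 1 := by
      rw [Complex.mul_conj']; exact_mod_cast hn q hq
    have h2 := hsq q hq
    have h0 : ω q * q.im ≠ 0 := by
      intro h
      have : ω q ^ 2 * (a q * (q.im : ℂ) ^ 2) = 0 := by
        linear_combination (ω q * q.im * a q) * h
      rw [this] at h2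
      exact zero_ne_one h2
    apply mul_left_cancel₀ h0
    linear_combination h2 - h1
  refine ⟨ω, fun q hq => ?_, hsq, hma, hn, fun q hq => ?_⟩
  · have hy : (q.im : ℂ) ≠ 0 := by exact_mod_cast (ne_of_gt hq)
    have hY : ((Φ q).im : ℂ) ≠ 0 := by exact_mod_cast (D.im_pos q hq).ne'
    have ha := D.a_ne_zero hq
    have h1 := ((D.hasW_a q hq).comp_hasDerivAt (Complex.hasDerivAt_log (hslit q hq))).const_mul
      (-1 / 2)
    have h2 := (h1.comp_hasDerivAt (Complex.hasDerivAt_exp _)).mul ((HasW.im q).inv hy)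
    have h3 := hma q hq
    refine h2.congr_coeff ?_ ?_
    · have : conj (ω q) = ω q * a q * q.im / (Φ q).im := by rw [h3]; field_simp
      rw [this]
      simp only [hω]
      field_simp
      ring
    · have : conj (ω q) = ω q * a q * q.im / (Φ q).im := by rw [h3]; field_simp
      rw [this]
      simp only [hω]
      field_simp
      ring
  · have hy : 0 < q.im := hq
    have hpos : 0 < (ω q).re := by
      simp only [hω]
      rw [← Complex.ofReal_inv, Complex.re_mul_ofReal, Complex.exp_re]
      refine mul_pos (mul_pos (Real.exp_pos _) ?_) (inv_pos.2 hy)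
      have h1 := Complex.neg_pi_lt_arg (a q)
      have h2 := Complex.arg_le_pi (a q)
      have h3 := Complex.mem_slitPlane_iff_arg.1 (hslit q hq)
      have h4 : (Complex.arg (a q)) < π := lt_of_le_of_ne h2 h3.1
      have h5 : (-1 / 2 * Complex.log (a q)).im = -Complex.arg (a q) / 2 := by
        rw [show (-1 / 2 : ℂ) = ((-1 / 2 : ℝ) : ℂ) by push_cast; ring, Complex.im_ofReal_mul,
          Complex.log_im]
        ring
      rw [h5]
      exact Real.cos_pos_of_mem_Ioo ⟨by linarith, by linarith⟩
    rw [← abs_of_pos hpos]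
    apply abs_im_le_abs_re_of_sq
    have h1 := hsq q hq
    have h2 : ω q ^ 2 = ((q.im ^ 2 * Complex.normSq (a q))⁻¹ : ℝ) * conj (a q) := by
      have ha := D.a_ne_zero hq
      have hyc : (q.im : ℂ) ≠ 0 := by exact_mod_cast hy.ne'
      have hac : conj (a q) ≠ 0 := by simpa using ha
      push_cast
      rw [← Complex.mul_conj]
      field_simp
      linear_combination h1
    rw [h2, Complex.re_ofReal_mul]
    simp only [Complex.conj_re]
    have := hre q hq
    have := Complex.normSq_nonneg (a q)
    positivity

/-- The real bilinear polynomial with coefficients `α, β, γ, δ`. -/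
def bilin (α β γ δ : ℝ) (u v : ℂ) : ℂ := α + β * u + γ * v + δ * u * v

lemma IsOmega.kPair {Φ a ν ω : ℂ → ℂ} {μ : ℂ → ℝ} (h : IsOmega Φ a ν μ ω) (D : MLData Φ a ν μ)
    (α β γ δ : ℝ) : KPair ν μ (fun q => bilin α β γ δ (conj q) (Φ q) * ω q)
      (fun q => bilin α β γ δ (conj q) (conj (Φ q)) * conj (ω q)) := by
  have key : ∀ q ∈ Hset, ∀ {v : ℂ → ℂ} {A B : ℂ}, HasW v A B q →
      HasW (fun q => bilin α β γ δ (conj q) (v q)) (γ * A + δ * conj q * A)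
        (β + γ * B + δ * (conj q * B + v q)) q := by
    intro q hq v A B hv
    have hc := (HasW.id q).star
    simp only [bilin]
    exact ((((HasW.const α q).add (hc.const_mul β)).add (hv.const_mul γ)).add
      ((hc.const_mul δ).mul hv)).congr_coeff (by simp) (by simp; ring)
  have hconj : ∀ z : ℂ, conj z = z - 2 * Complex.I * z.im := by
    intro z; apply Complex.ext <;> simp <;> ring
  constructor
  · intro q hq
    have hy : (q.im : ℂ) ≠ 0 := by exact_mod_cast (ne_of_gt hq)
    have h1 := (key q hq (D.hasW_map q hq)).mul (h.hasW q hq)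
    have h2 : ω q * a q = conj (ω q) * (Φ q).im / q.im := by
      rw [← h.mul_a q hq]; field_simp
    refine h1.congr_coeff ?_ ?_
    · simp only [bilin, hconj (Φ q)]
      linear_combination (norm := skip) (μ q * (γ + δ * conj q)) * h2
      field_simp
      ring_nf
      simp only [Complex.I_sq]
      ring
    · simp only [bilin, map_add, map_mul, Complex.conj_ofReal, Complex.conj_conj]
      rw [hconj (Φ q), hconj q]
      linear_combination (norm := skip) (ν q * (γ + δ * conj q)) * h2
      rw [hconj q]
      field_simp
      ring_nf
      simp only [Complex.I_sq, Complex.I_pow_three]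
      ring
  · intro q hq
    have hy : (q.im : ℂ) ≠ 0 := by exact_mod_cast (ne_of_gt hq)
    have h1 := (key q hq (D.hasW_map q hq).star).mul (h.hasW q hq).star
    have h2 : conj (ω q) * conj (a q) = ω q * (Φ q).im / q.im := by
      have := congrArg conj (h.mul_a q hq)
      simp only [map_mul, Complex.conj_ofReal, Complex.conj_conj] at this
      rw [← this]; field_simp
    refine h1.congr_coeff ?_ ?_
    · simp only [bilin, map_mul, map_sub, map_div₀, map_inv₀, map_ofNat, Complex.conj_ofReal,
        Complex.conj_conj, Complex.conj_I, hconj (Φ q)]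
      linear_combination (norm := skip) (conj (ν q) * (γ + δ * conj q)) * h2
      field_simp
      ring_nf
      simp only [Complex.I_sq]
      ring
    · simp only [bilin, map_add, map_mul, map_div₀, map_inv₀, map_ofNat,
        Complex.conj_ofReal, Complex.conj_conj, Complex.conj_I]
      rw [hconj (Φ q), hconj q]
      linear_combination (norm := skip) (μ q * (γ + δ * conj q)) * h2
      rw [hconj q]
      field_simp
      ring_nf
      simp only [Complex.I_sq, Complex.I_pow_three]
      ring

lemma HasW.continuousAt {u : ℂ → ℂ} {A B q : ℂ} (h : HasW u A B q) : ContinuousAt u q :=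
  HasFDerivAt.continuousAt h

/-- A continuous function on the upper half-plane which is smaller than `m` near the boundary
and takes a value at least `m` attains its maximum. -/
lemma exists_isMaxOn_Hset {G : ℂ → ℝ} (hG : ContinuousOn G Hset) {m : ℝ} {q₀ : ℂ}
    (hq₀ : q₀ ∈ Hset) (h₀ : m ≤ G q₀) (hreal : ∀ x : ℝ, ∀ᶠ q in 𝓝[Hset] (x : ℂ), G q < m)
    (hinf : ∀ᶠ q in Bornology.cobounded ℂ ⊓ 𝓟 Hset, G q < m) :
    ∃ q ∈ Hset, m ≤ G q ∧ IsMaxOn G Hset q := by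
  set K : Set ℂ := Hset ∩ G ⁻¹' Ici m with hK
  have hKsub : K ⊆ Hset := inter_subset_left
  have hbdd : Bornology.IsBounded K := by
    rw [Bornology.isBounded_def]
    rw [Filter.eventually_inf_principal] at hinf
    filter_upwards [hinf] with q hq hqK
    exact absurd (hq hqK.1) (not_lt.2 hqK.2)
  have hclosed : IsClosed K := by
    refine isClosed_of_closure_subset fun q hq => ?_
    have him : 0 ≤ q.im := by
      have : closure K ⊆ {z : ℂ | 0 ≤ z.im} :=
        closure_minimal (fun z hz => show 0 ≤ z.im from le_of_lt (show 0 < z.im from hz.1))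
          (isClosed_le continuous_const Complex.continuous_im)
      exact this hq
    rcases him.eq_or_lt with h | h
    · exfalso
      have hx : ((q.re : ℝ) : ℂ) = q := Complex.ext (by simp) (by simp [← h])
      have h1 := hreal q.re
      rw [hx, eventually_nhdsWithin_iff] at h1
      obtain ⟨z, hz, hzK⟩ := (mem_closure_iff_frequently.1 hq).and_eventually h1 |>.exists
      exact absurd (hzK hz.1) (not_lt.2 hz.2)
    · have hqH : q ∈ Hset := h
      refine ⟨hqH, ?_⟩
      by_contra hlt
      have h1 : ∀ᶠ z in 𝓝 q, G z < m :=
        ((hG q hqH).continuousAt (isOpen_Hset.mem_nhds hqH)).eventually_lt_const (not_le.1 hlt)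
      obtain ⟨z, hz, hzK⟩ := (mem_closure_iff_frequently.1 hq).and_eventually h1 |>.exists
      exact absurd hzK (not_lt.2 hz.2)
  have hcomp : IsCompact K := Metric.isCompact_of_isClosed_isBounded hclosed hbdd
  obtain ⟨q, hq, hmax⟩ := hcomp.exists_isMaxOn ⟨q₀, hq₀, h₀⟩ (hG.mono hKsub)
  refine ⟨q, hq.1, hq.2, fun z hz => ?_⟩
  by_cases h : m ≤ G z
  · exact hmax ⟨hz, h⟩
  · exact (not_le.1 h).le.trans hq.2

section Cone

variable {Φ a ν ω : ℂ → ℂ} {μ : ℂ → ℝ} {φ : ℝ → ℝ}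

lemma IsOmega.ne_zero (h : IsOmega Φ a ν μ ω) {q : ℂ} (hq : q ∈ Hset) : ω q ≠ 0 := by
  intro h0
  have := h.sq_mul q hq
  rw [h0] at this
  simp at this

lemma KPair.continuousOn_re {Ω Ξ : ℂ → ℂ} (P : KPair ν μ Ω Ξ) :
    ContinuousOn (fun q => (Ω q).re) Hset := fun q hq =>
  (Complex.continuous_re.continuousAt.comp (P.hasW_fst q hq).continuousAt).continuousWithinAt

lemma IsOmega.re_pos (h : IsOmega Φ a ν μ ω) (q : ℂ) (hq : q ∈ Hset) : 0 < (ω q).re := by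
  have h1 := h.abs_im_le q hq
  rcases (abs_nonneg _ |>.trans h1).eq_or_lt with h2 | h2
  · exfalso
    apply h.ne_zero hq
    rw [← h2] at h1
    exact Complex.ext h2.symm (abs_nonpos_iff.1 h1)
  · exact h2

lemma IsOmega.cone (h : IsOmega Φ a ν μ ω) (D : MLData Φ a ν μ) (hB : BoundaryMap Φ φ) (z : ℝ)
    {q : ℂ} (hq : q ∈ Hset) : |((z - conj q) * (φ z - Φ q) * ω q).im|
      ≤ ((z - conj q) * (φ z - Φ q) * ω q).re := by
  set Ω : ℂ → ℂ := fun q => (z - conj q) * (φ z - Φ q) * ω q with hΩ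
  have habs : ∀ q ∈ Hset, |(Ω q).im| ≤ |(Ω q).re| := by
    intro q hq
    apply abs_im_le_abs_re_of_sq
    have h1 := D.cone_real hB D.coneAdmissible_one hq z
    have ha := D.a_ne_zero hq
    have hyc : (q.im : ℂ) ≠ 0 := by exact_mod_cast (ne_of_gt hq)
    have hac : conj (a q) ≠ 0 := by simpa using ha
    have h2 := h.sq_mul q hq
    have h3 : Ω q ^ 2 = ((q.im ^ 2 * Complex.normSq (a q))⁻¹ : ℝ)
        * (conj 1 * conj (a q) * (z - conj q) ^ 2 * (φ z - Φ q) ^ 2) := by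
      have h4 : ω q ^ 2 = ((q.im : ℂ) ^ 2 * a q)⁻¹ := by
        field_simp
        linear_combination h2
      simp only [hΩ, mul_pow, h4]
      push_cast
      rw [← Complex.mul_conj]
      simp only [map_one]
      field_simp
    rw [h3, Complex.re_ofReal_mul]
    have := Complex.normSq_nonneg (a q)
    positivity
  have hne : ∀ q ∈ Hset, (Ω q).re ≠ 0 := by
    intro q hq h0
    have h1 := habs q hq
    rw [h0, abs_zero] at h1
    have h2 : Ω q = 0 := Complex.ext h0 (abs_nonpos_iff.1 h1)
    have hy : 0 < q.im := hq
    have hY := D.im_pos q hq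
    rcases mul_eq_zero.1 h2 with h3 | h3
    · rcases mul_eq_zero.1 h3 with h4 | h4
      · have := congrArg Complex.im h4
        simp at this
        linarith
      · have := congrArg Complex.im h4
        simp at this
        linarith
    · exact h.ne_zero hq h3
  have hc : ContinuousOn (fun q => (Ω q).re) Hset := by
    have := (h.kPair D (z * φ z) (-φ z) (-z) 1).continuousOn_re
    refine this.congr fun q hq => ?_
    simp only [hΩ, bilin]
    congr 1
    push_cast
    ring
  set p : ℂ := z + Complex.I with hp
  have hpH : p ∈ Hset := by simp [hp, Hset]
  have hpos : 0 < (Ω p).re := by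
    rcases lt_or_gt_of_ne (hne p hpH) with hlt | hgt
    · exfalso
      have h1 := h.re_pos p hpH
      have h2 := h.abs_im_le p hpH
      have h3 := habs p hpH
      rw [abs_of_neg hlt] at h3
      have h4 : ((z - conj p) * (φ z - Φ p)).re * ‖ω p‖ ^ 2
          = (Ω p).re * (ω p).re + (Ω p).im * (ω p).im := by
        simp only [hΩ]
        rw [← Complex.normSq_eq_norm_sq, Complex.normSq_apply]
        simp only [Complex.mul_re, Complex.mul_im]
        ring
      have h5 : ((z - conj p) * (φ z - Φ p)).re = (Φ p).im := by
        simp [hp]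
      have h6 : 0 < (Φ p).im * ‖ω p‖ ^ 2 :=
        mul_pos (D.im_pos p hpH) (by have := norm_pos_iff.2 (h.ne_zero hpH); positivity)
      rw [← h5, h4] at h6
      have h7 : (Ω p).im * (ω p).im ≤ |(Ω p).im| * |(ω p).im| := by
        rw [← abs_mul]; exact le_abs_self _
      have h8 : |(Ω p).im| * |(ω p).im| ≤ -(Ω p).re * (ω p).re :=
        mul_le_mul h3 h2 (abs_nonneg _) (by linarith)
      linarith
    · exact hgt
  have hall : 0 < (Ω q).re := by
    by_contra hcon
    have := convex_Hset.isPreconnected.intermediate_value hq hpH hc ⟨not_lt.1 hcon, hpos.le⟩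
    obtain ⟨r, hr, hr0⟩ := this
    exact hne r hr hr0
  have := habs q hq
  rwa [abs_of_pos hall] at this

lemma IsOmega.re_mul_nonneg (h : IsOmega Φ a ν μ ω) (D : MLData Φ a ν μ) (hB : BoundaryMap Φ φ)
    (z : ℝ) {q : ℂ} (hq : q ∈ Hset) : 0 ≤ ((z - conj q) * (φ z - Φ q)).re := by
  have h1 := h.cone D hB z hq
  have h2 := h.abs_im_le q hq
  have h3 : 0 < ‖ω q‖ ^ 2 := by have := norm_pos_iff.2 (h.ne_zero hq); positivity
  have h4 : ((z - conj q) * (φ z - Φ q)).re * ‖ω q‖ ^ 2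
      = ((z - conj q) * (φ z - Φ q) * ω q).re * (ω q).re
        + ((z - conj q) * (φ z - Φ q) * ω q).im * (ω q).im := by
    rw [← Complex.normSq_eq_norm_sq, Complex.normSq_apply]
    simp only [Complex.mul_re, Complex.mul_im]
    ring
  generalize (z - conj q) * (φ z - Φ q) * ω q = W at *
  have h5 : -(W.im * (ω q).im) ≤ |W.im| * |(ω q).im| := by
    rw [← abs_mul]; exact neg_le_abs _
  have h6 : |W.im| * |(ω q).im| ≤ W.re * (ω q).re :=
    mul_le_mul h1 h2 (abs_nonneg _) (by have := abs_nonneg W.im; linarith)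
  have h7 : 0 ≤ ((z - conj q) * (φ z - Φ q)).re * ‖ω q‖ ^ 2 := by linarith
  exact nonneg_of_mul_nonneg_left h7 h3

lemma mem_closure_Hset (x : ℝ) : (x : ℂ) ∈ closure Hset := by
  rw [Hset, show {z : ℂ | 0 < z.im} = Complex.im ⁻¹' Ioi 0 from rfl,
    Complex.closure_preimage_im]
  simp

lemma BoundaryMap.monotone (hB : BoundaryMap Φ φ) (D : MLData Φ a ν μ) : Monotone φ := by
  obtain ⟨ω, h⟩ := D.exists_isOmega hB
  have key : ∀ z x : ℝ, 0 ≤ (z - x) * (φ z - φ x) := by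
    intro z x
    have : (𝓝[Hset] (x : ℂ)).NeBot := mem_closure_iff_nhdsWithin_neBot.1 (mem_closure_Hset x)
    have h1 : Tendsto (fun q : ℂ => ((z - conj q) * (φ z - Φ q)).re) (𝓝[Hset] (x : ℂ))
        (𝓝 (((z - conj (x : ℂ)) * (φ z - (φ x : ℂ)))).re) := by
      refine (Complex.continuous_re.tendsto _).comp ?_
      refine Tendsto.mul (tendsto_const_nhds.sub ?_) (tendsto_const_nhds.sub (hB.tendsto_real x))
      exact (Complex.continuous_conj.tendsto _).mono_left nhdsWithin_le_nhds
    have h2 := ge_of_tendsto h1 (by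
      filter_upwards [self_mem_nhdsWithin] with q hq using h.re_mul_nonneg D hB z hq)
    rw [Complex.conj_ofReal] at h2
    exact_mod_cast h2
  intro x z hxz
  rcases hxz.eq_or_lt with rfl | hlt
  · exact le_rfl
  · have := key z x
    exact sub_nonneg.1 (nonneg_of_mul_nonneg_right this (sub_pos.2 hlt))

end Cone

/-! ### The weight function and the curvature estimate -/

/-- The real part of the sum of the coefficients attached to the boundary points `∞`, `0`, `1`. -/
def weight (Φ ω : ℂ → ℂ) (q : ℂ) : ℝ := (bilin 2 (-1) (-1) 2 (conj q) (Φ q) * ω q).re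

/-- The sum of the moduli of the polynomials attached to the boundary points `∞`, `0`, `1`. -/
def modSum (Φ : ℂ → ℂ) (q : ℂ) : ℝ := 1 + ‖q‖ * ‖Φ q‖ + ‖1 - q‖ * ‖1 - Φ q‖

lemma one_le_modSum (Φ : ℂ → ℂ) (q : ℂ) : 1 ≤ modSum Φ q := by
  rw [modSum]
  have := mul_nonneg (norm_nonneg q) (norm_nonneg (Φ q))
  have := mul_nonneg (norm_nonneg (1 - q)) (norm_nonneg (1 - Φ q))
  linarith

lemma norm_le_of_abs_im_le {w : ℂ} (h : |w.im| ≤ w.re) : ‖w‖ ≤ √2 * w.re := by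
  have h0 : 0 ≤ w.re := (abs_nonneg _).trans h
  refine (pow_le_pow_iff_left₀ (norm_nonneg _) (by positivity) two_ne_zero).1 ?_
  rw [mul_pow, Real.sq_sqrt (by norm_num), ← Complex.normSq_eq_norm_sq, Complex.normSq_apply]
  have h1 : w.im ^ 2 ≤ w.re ^ 2 := by
    rw [← sq_abs w.im]
    exact pow_le_pow_left₀ (abs_nonneg _) h 2
  nlinarith

lemma norm_le_two_mul {q w : ℂ} : ‖q‖ ≤ 2 * (1 + ‖q‖ * ‖w‖ + ‖1 - q‖ * ‖1 - w‖) := by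
  have hq := norm_nonneg q
  have hw := norm_nonneg w
  have h1q := norm_nonneg (1 - q)
  have h1w := norm_nonneg (1 - w)
  have h1 : 1 ≤ ‖w‖ + ‖1 - w‖ := by
    have := norm_add_le w (1 - w)
    simpa using this
  have h2 : ‖q‖ ≤ 1 + ‖1 - q‖ := by
    have := norm_sub_le 1 (1 - q)
    simpa using this
  rcases le_total ‖q‖ 2 with h | h
  · nlinarith [mul_nonneg hq hw, mul_nonneg h1q h1w]
  · have h3 : ‖q‖ ≤ 2 * ‖1 - q‖ := by linarith
    nlinarith [mul_nonneg hq hw, mul_nonneg h1q h1w, mul_le_mul_of_nonneg_right h3 h1w,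
      mul_le_mul_of_nonneg_left h1 hq]

section Weight

variable {Φ a ν ω : ℂ → ℂ} {μ : ℂ → ℝ} {φ : ℝ → ℝ}

lemma norm_add_norm_le (Φ : ℂ → ℂ) (q : ℂ) : ‖q‖ + ‖Φ q‖ ≤ 4 * modSum Φ q := by
  have h1 := norm_le_two_mul (q := q) (w := Φ q)
  have h2 := norm_le_two_mul (q := Φ q) (w := q)
  rw [modSum]
  linarith [mul_comm ‖q‖ ‖Φ q‖, mul_comm ‖1 - q‖ ‖1 - Φ q‖]

lemma IsOmega.modSum_mul_le (h : IsOmega Φ a ν μ ω) (D : MLData Φ a ν μ) (hB : BoundaryMap Φ φ)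
    (h0 : φ 0 = 0) (h1 : φ 1 = 1) {q : ℂ} (hq : q ∈ Hset) :
    modSum Φ q * ‖ω q‖ ≤ √2 * weight Φ ω q := by
  have e1 := norm_le_of_abs_im_le (h.abs_im_le q hq)
  have e2 := norm_le_of_abs_im_le (h.cone D hB 0 hq)
  have e3 := norm_le_of_abs_im_le (h.cone D hB 1 hq)
  rw [h0] at e2
  rw [h1] at e3
  have hw : weight Φ ω q = (ω q).re + (((0 : ℝ) - conj q) * ((0 : ℝ) - Φ q) * ω q).re
      + (((1 : ℝ) - conj q) * ((1 : ℝ) - Φ q) * ω q).re := by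
    rw [weight, bilin, ← Complex.add_re, ← Complex.add_re]
    congr 1
    push_cast
    ring
  have n2 : ‖((0 : ℝ) - conj q) * ((0 : ℝ) - Φ q) * ω q‖ = ‖q‖ * ‖Φ q‖ * ‖ω q‖ := by
    simp
  have n3 : ‖((1 : ℝ) - conj q) * ((1 : ℝ) - Φ q) * ω q‖ = ‖1 - q‖ * ‖1 - Φ q‖ * ‖ω q‖ := by
    rw [norm_mul, norm_mul, ← RCLike.norm_conj (1 - q)]
    simp
  rw [n2] at e2
  rw [n3] at e3
  rw [hw, modSum]
  linarith

lemma IsOmega.weight_pos (h : IsOmega Φ a ν μ ω) (D : MLData Φ a ν μ) (hB : BoundaryMap Φ φ)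
    (h0 : φ 0 = 0) (h1 : φ 1 = 1) {q : ℂ} (hq : q ∈ Hset) : 0 < weight Φ ω q := by
  have h2 := h.modSum_mul_le D hB h0 h1 hq
  have h3 : 0 < modSum Φ q * ‖ω q‖ :=
    mul_pos (by linarith [one_le_modSum Φ q]) (norm_pos_iff.2 (h.ne_zero hq))
  exact pos_of_mul_pos_right (h3.trans_le h2) (Real.sqrt_nonneg 2)

lemma IsOmega.sq_modSum_mul_le (h : IsOmega Φ a ν μ ω) (D : MLData Φ a ν μ)
    (hB : BoundaryMap Φ φ) (h0 : φ 0 = 0) (h1 : φ 1 = 1) {q : ℂ} (hq : q ∈ Hset) :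
    (modSum Φ q * ‖ω q‖) ^ 2 ≤ 2 * weight Φ ω q ^ 2 := by
  have h2 := h.modSum_mul_le D hB h0 h1 hq
  have h3 : 0 ≤ modSum Φ q * ‖ω q‖ :=
    mul_nonneg (by linarith [one_le_modSum Φ q]) (norm_nonneg _)
  have h4 := pow_le_pow_left₀ h3 h2 2
  rwa [mul_pow √2, Real.sq_sqrt (by norm_num)] at h4

lemma IsOmega.sq_modSum_le (h : IsOmega Φ a ν μ ω) (D : MLData Φ a ν μ)
    (hB : BoundaryMap Φ φ) (h0 : φ 0 = 0) (h1 : φ 1 = 1) {q : ℂ} (hq : q ∈ Hset) :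
    modSum Φ q ^ 2 ≤ 2 * weight Φ ω q ^ 2 * (q.im * (Φ q).im) := by
  have h2 := h.sq_modSum_mul_le D hB h0 h1 hq
  have h3 := h.norm_sq q hq
  have h4 : 0 < q.im * (Φ q).im := mul_pos hq (D.im_pos q hq)
  calc modSum Φ q ^ 2 = (modSum Φ q * ‖ω q‖) ^ 2 * (q.im * (Φ q).im) := by
        rw [mul_pow, mul_assoc, h3, mul_one]
    _ ≤ _ := mul_le_mul_of_nonneg_right h2 h4.le

lemma IsOmega.two_le_weight_sq (h : IsOmega Φ a ν μ ω) (D : MLData Φ a ν μ)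
    (hB : BoundaryMap Φ φ) (h0 : φ 0 = 0) (h1 : φ 1 = 1) {q : ℂ} (hq : q ∈ Hset) :
    2 ≤ weight Φ ω q ^ 2 := by
  have h2 := h.sq_modSum_le D hB h0 h1 hq
  have h4 : 0 < q.im * (Φ q).im := mul_pos hq (D.im_pos q hq)
  have h5 : 1 + q.im * (Φ q).im ≤ modSum Φ q := by
    have e1 : q.im ≤ ‖q‖ := Complex.im_le_norm q
    have e2 : (Φ q).im ≤ ‖Φ q‖ := Complex.im_le_norm _
    have e3 := mul_le_mul e1 e2 (D.im_pos q hq).le (norm_nonneg q)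
    have := mul_nonneg (norm_nonneg (1 - q)) (norm_nonneg (1 - Φ q))
    rw [modSum]
    linarith
  generalize q.im * (Φ q).im = t at *
  have h6 : (1 + t) ^ 2 ≤ modSum Φ q ^ 2 := pow_le_pow_left₀ (by linarith) h5 2
  by_contra! hcon
  nlinarith [mul_lt_mul_of_pos_right hcon h4, sq_nonneg (1 - t)]

lemma IsOmega.weight_tendsto_real (h : IsOmega Φ a ν μ ω) (D : MLData Φ a ν μ)
    (hB : BoundaryMap Φ φ) (h0 : φ 0 = 0) (h1 : φ 1 = 1) (C : ℝ) (x : ℝ) :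
    ∀ᶠ q in 𝓝[Hset] (x : ℂ), C < weight Φ ω q := by
  have ht : Tendsto (fun q : ℂ => 2 * C ^ 2 * (q.im * (Φ q).im)) (𝓝[Hset] (x : ℂ))
      (𝓝 (2 * C ^ 2 * ((x : ℂ).im * (φ x : ℂ).im))) := by
    refine tendsto_const_nhds.mul (Tendsto.mul ?_ ?_)
    · exact (Complex.continuous_im.tendsto _).mono_left nhdsWithin_le_nhds
    · exact (Complex.continuous_im.tendsto _).comp (hB.tendsto_real x)
  have hev := ht.eventually_lt_const (u := 1) (by simp)
  filter_upwards [hev, self_mem_nhdsWithin] with q hq hqH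
  have h2 := h.sq_modSum_le D hB h0 h1 hqH
  have h3 := one_le_modSum Φ q
  have h4 : 0 < q.im * (Φ q).im := mul_pos hqH (D.im_pos q hqH)
  have h5 := h.weight_pos D hB h0 h1 hqH
  by_contra! hcon
  have h6 : weight Φ ω q ^ 2 ≤ C ^ 2 := pow_le_pow_left₀ h5.le hcon 2
  nlinarith [mul_le_mul_of_nonneg_right h6 h4.le]

lemma BoundaryMap.tendsto_norm (hB : BoundaryMap Φ φ) :
    Tendsto (fun q => ‖Φ q‖) (Bornology.cobounded ℂ ⊓ 𝓟 Hset) atTop :=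
  tendsto_norm_cobounded_atTop.comp hB.tendsto_infty

lemma IsOmega.weight_tendsto_infty (h : IsOmega Φ a ν μ ω) (D : MLData Φ a ν μ)
    (hB : BoundaryMap Φ φ) (h0 : φ 0 = 0) (h1 : φ 1 = 1) (C : ℝ) :
    ∀ᶠ q in Bornology.cobounded ℂ ⊓ 𝓟 Hset, C < weight Φ ω q := by
  have e1 : ∀ᶠ q in Bornology.cobounded ℂ ⊓ 𝓟 Hset, 1 < ‖q‖ :=
    (tendsto_norm_cobounded_atTop.mono_left inf_le_left).eventually_gt_atTop 1
  have e2 := hB.tendsto_norm.eventually_gt_atTop (2 * C ^ 2)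
  have e3 : ∀ᶠ q in Bornology.cobounded ℂ ⊓ 𝓟 Hset, q ∈ Hset :=
    eventually_inf_principal.2 (Eventually.of_forall fun q hq => hq)
  filter_upwards [e1, e2, e3] with q hq1 hq2 hqH
  have h2 := h.sq_modSum_le D hB h0 h1 hqH
  have h3 : ‖q‖ * ‖Φ q‖ ≤ modSum Φ q := by
    have := mul_nonneg (norm_nonneg (1 - q)) (norm_nonneg (1 - Φ q))
    rw [modSum]; linarith
  have h4 : 0 < q.im * (Φ q).im := mul_pos hqH (D.im_pos q hqH)
  have h5 := h.weight_pos D hB h0 h1 hqH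
  have h7 : q.im * (Φ q).im ≤ ‖q‖ * ‖Φ q‖ :=
    mul_le_mul (Complex.im_le_norm q) (Complex.im_le_norm _) (D.im_pos q hqH).le (norm_nonneg q)
  by_contra! hcon
  have h6 : weight Φ ω q ^ 2 ≤ C ^ 2 := pow_le_pow_left₀ h5.le hcon 2
  have h8 : (‖q‖ * ‖Φ q‖) ^ 2 ≤ 2 * C ^ 2 * (‖q‖ * ‖Φ q‖) := by
    calc (‖q‖ * ‖Φ q‖) ^ 2 ≤ modSum Φ q ^ 2 :=
          pow_le_pow_left₀ (h4.le.trans h7) h3 2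
      _ ≤ 2 * weight Φ ω q ^ 2 * (q.im * (Φ q).im) := h2
      _ ≤ _ := mul_le_mul (by linarith) h7 h4.le (by positivity)
  have h9 : ‖q‖ * ‖Φ q‖ ≤ 2 * C ^ 2 := by
    have : 0 < ‖q‖ * ‖Φ q‖ := h4.trans_le h7
    nlinarith
  nlinarith [norm_nonneg (Φ q)]

end Weight

section Bernstein

variable {Φ a ν ω : ℂ → ℂ} {μ : ℂ → ℝ} {φ : ℝ → ℝ}

/-- The coefficient measuring the displacement of `Φ`, up to the sign `s`. -/
def displacement (s : ℝ) (Φ ω : ℂ → ℂ) (q : ℂ) : ℂ :=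
  bilin 0 (s / 2) (-(s / 2)) 0 (conj q) (Φ q) * ω q

lemma norm_displacement (s : ℝ) (Φ ω : ℂ → ℂ) (q : ℂ) :
    ‖displacement s Φ ω q‖ = |s| / 2 * ‖conj q - Φ q‖ * ‖ω q‖ := by
  have : displacement s Φ ω q = ((s / 2 : ℝ) : ℂ) * (conj q - Φ q) * ω q := by
    rw [displacement, bilin]; push_cast; ring
  rw [this, norm_mul, norm_mul, Complex.norm_real, Real.norm_eq_abs, abs_div, abs_two]

lemma IsOmega.continuousOn_weight (h : IsOmega Φ a ν μ ω) (D : MLData Φ a ν μ) :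
    ContinuousOn (weight Φ ω) Hset := (h.kPair D 2 (-1) (-1) 2).continuousOn_re

lemma modSum_ge (Φ : ℂ → ℂ) (q : ℂ) : 1 + ‖q‖ * ‖Φ q‖ ≤ modSum Φ q := by
  have := mul_nonneg (norm_nonneg (1 - q)) (norm_nonneg (1 - Φ q))
  rw [modSum]; linarith

lemma IsOmega.re_displacement_lt (h : IsOmega Φ a ν μ ω) (D : MLData Φ a ν μ)
    (hB : BoundaryMap Φ φ) (h0 : φ 0 = 0) (h1 : φ 1 = 1) {s m : ℝ} (hs : |s| ≤ 1) {q : ℂ}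
    (hq : q ∈ Hset) (hm : ‖conj q - Φ q‖ < m * (1 + ‖q‖ * ‖Φ q‖)) :
    (displacement s Φ ω q).re < m * weight Φ ω q := by
  have hF := h.weight_pos D hB h0 h1 hq
  have hS := h.modSum_mul_le D hB h0 h1 hq
  have hw := norm_pos_iff.2 (h.ne_zero hq)
  have hm0 : 0 < m := by
    have : 0 < m * (1 + ‖q‖ * ‖Φ q‖) := (norm_nonneg _).trans_lt hm
    exact pos_of_mul_pos_left this (by positivity)
  have h2 : ‖displacement s Φ ω q‖ ≤ 1 / 2 * (m * (modSum Φ q * ‖ω q‖)) := by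
    rw [norm_displacement]
    have e1 : ‖conj q - Φ q‖ ≤ m * modSum Φ q :=
      hm.le.trans (mul_le_mul_of_nonneg_left (modSum_ge Φ q) hm0.le)
    calc |s| / 2 * ‖conj q - Φ q‖ * ‖ω q‖ ≤ 1 / 2 * (m * modSum Φ q) * ‖ω q‖ := by
          gcongr
      _ = _ := by ring
  have h3 : √2 < 2 := by
    rw [Real.sqrt_lt' (by norm_num)]; norm_num
  have h4 := (Complex.re_le_norm (displacement s Φ ω q)).trans h2
  have h5 : √2 * weight Φ ω q < 2 * weight Φ ω q := mul_lt_mul_of_pos_right h3 hF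
  have h6 := mul_lt_mul_of_pos_left (hS.trans_lt h5) hm0
  linarith

lemma IsOmega.re_displacement_le (h : IsOmega Φ a ν μ ω) (D : MLData Φ a ν μ)
    (hB : BoundaryMap Φ φ) (h0 : φ 0 = 0) (h1 : φ 1 = 1) {ε : ℝ} (hε0 : 0 ≤ ε)
    (hε : ∀ x : ℝ, |x - φ x| ≤ ε * (1 + |x| * |φ x|)) {s : ℝ} (hs : |s| ≤ 1) {q : ℂ}
    (hq : q ∈ Hset) : (displacement s Φ ω q).re ≤ ε * weight Φ ω q := by
  by_contra! hcon
  have hF := fun {q : ℂ} (hq : q ∈ Hset) => h.weight_pos D hB h0 h1 hq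
  have P := h.kPair D 0 (s / 2) (-(s / 2)) 0
  have PY := h.kPair D 2 (-1) (-1) 2
  obtain ⟨η, hη0, hη⟩ : ∃ η > 0, ε * weight Φ ω q < (displacement s Φ ω q).re - η :=
    ⟨((displacement s Φ ω q).re - ε * weight Φ ω q) / 2, by linarith, by linarith⟩
  set G : ℂ → ℝ := fun z => ((displacement s Φ ω z).re - η) / weight Φ ω z with hG
  have hmε : ε < G q := by
    rw [hG, lt_div_iff₀ (hF hq)]; exact hη
  have hlt : ∀ z ∈ Hset, ‖conj z - Φ z‖ < G q * (1 + ‖z‖ * ‖Φ z‖) → G z < G q := by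
    intro z hz hz'
    have := h.re_displacement_lt D hB h0 h1 hs hz hz'
    change ((displacement s Φ ω z).re - η) / weight Φ ω z < G q
    rw [div_lt_iff₀ (hF hz)]
    linarith
  have hcont : ContinuousOn G Hset := by
    refine ContinuousOn.div ?_ (h.continuousOn_weight D) fun z hz => (hF hz).ne'
    exact P.continuousOn_re.sub continuousOn_const
  obtain ⟨p, hp, hpm, hpmax⟩ := exists_isMaxOn_Hset hcont hq le_rfl (fun x => by
    have t1 : Tendsto (fun z => ‖conj z - Φ z‖) (𝓝[Hset] (x : ℂ)) (𝓝 ‖conj (x : ℂ) - φ x‖) :=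
      (((Complex.continuous_conj.tendsto _).mono_left nhdsWithin_le_nhds).sub
        (hB.tendsto_real x)).norm
    have t2 : Tendsto (fun z => G q * (1 + ‖z‖ * ‖Φ z‖)) (𝓝[Hset] (x : ℂ))
        (𝓝 (G q * (1 + ‖(x : ℂ)‖ * ‖(φ x : ℂ)‖))) :=
      ((((continuous_norm.tendsto _).mono_left nhdsWithin_le_nhds).mul
        (hB.tendsto_real x).norm).const_add 1).const_mul _
    have hlim : ‖conj (x : ℂ) - φ x‖ < G q * (1 + ‖(x : ℂ)‖ * ‖(φ x : ℂ)‖) := by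
      rw [Complex.conj_ofReal, ← Complex.ofReal_sub, Complex.norm_real, Complex.norm_real,
        Complex.norm_real]
      refine (hε x).trans_lt ?_
      simp only [Real.norm_eq_abs]
      exact mul_lt_mul_of_pos_right hmε (by positivity)
    filter_upwards [t1.eventually_lt t2 hlim, self_mem_nhdsWithin] with z hz hzH
    exact hlt z hzH hz) (by
    have hG0 : 0 < G q := hε0.trans_lt hmε
    have e1 : ∀ᶠ z in Bornology.cobounded ℂ ⊓ 𝓟 Hset, 2 / G q < ‖z‖ :=
      (tendsto_norm_cobounded_atTop.mono_left inf_le_left).eventually_gt_atTop _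
    have e2 := hB.tendsto_norm.eventually_gt_atTop (2 / G q)
    have e3 : ∀ᶠ q in Bornology.cobounded ℂ ⊓ 𝓟 Hset, q ∈ Hset :=
      eventually_inf_principal.2 (Eventually.of_forall fun q hq => hq)
    filter_upwards [e1, e2, e3] with z h2 h3 hz
    refine hlt z hz ?_
    rw [div_lt_iff₀ hG0] at h2 h3
    have h4 := norm_sub_le (conj z) (Φ z)
    rw [RCLike.norm_conj] at h4
    nlinarith [norm_nonneg z, norm_nonneg (Φ z)])
  have hc : G p * weight Φ ω p = (displacement s Φ ω p).re - η :=
    div_mul_cancel₀ _ (hF hp).ne'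
  have hloc : IsLocalMax (fun z => (displacement s Φ ω z).re + (-G p) * weight Φ ω z) p := by
    filter_upwards [isOpen_Hset.mem_nhds hp] with z hz
    have h2 : G z ≤ G p := hpmax hz
    have h3 : ((displacement s Φ ω z).re - η) / weight Φ ω z ≤ G p := h2
    rw [div_le_iff₀ (hF hz)] at h3
    linarith
  have hL := (P.hasL_re D hp).add ((PY.hasL_re D hp).const_mul (-G p))
  have h2 := hL.nonpos_of_isLocalMax hloc (D.norm_nu_lt hp).le
  have h3 : (1 + μ p) / 4 * (displacement s Φ ω p).re
      + -G p * ((1 + μ p) / 4 * weight Φ ω p) ≤ 0 := h2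
  have h4 := D.one_le_mu hp
  nlinarith

lemma IsOmega.abs_re_displacement_le (h : IsOmega Φ a ν μ ω) (D : MLData Φ a ν μ)
    (hB : BoundaryMap Φ φ) (h0 : φ 0 = 0) (h1 : φ 1 = 1) {ε : ℝ} (hε0 : 0 ≤ ε)
    (hε : ∀ x : ℝ, |x - φ x| ≤ ε * (1 + |x| * |φ x|)) {q : ℂ} (hq : q ∈ Hset) :
    |(displacement 1 Φ ω q).re| ≤ ε * weight Φ ω q := by
  have e1 := h.re_displacement_le D hB h0 h1 hε0 hε (s := 1) (by simp) hq
  have e2 := h.re_displacement_le D hB h0 h1 hε0 hε (s := -1) (by simp) hq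
  have e3 : displacement (-1) Φ ω q = -displacement 1 Φ ω q := by
    simp only [displacement, bilin]; push_cast; ring
  rw [e3, Complex.neg_re] at e2
  exact abs_le.2 ⟨by linarith, e1⟩

lemma IsOmega.norm_sq_displacement (h : IsOmega Φ a ν μ ω) {q : ℂ}
    (hq : q ∈ Hset) : ‖bilin 0 (1 / 2) (-(1 / 2)) 0 (conj q) (conj (Φ q)) * conj (ω q)‖ ^ 2
      = (displacement 1 Φ ω q).re ^ 2 + (displacement 1 Φ ω q).im ^ 2 - 1 := by
  have h2 := h.norm_sq q hq
  have h3 : (displacement 1 Φ ω q).re ^ 2 + (displacement 1 Φ ω q).im ^ 2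
      = ‖displacement 1 Φ ω q‖ ^ 2 := by
    rw [← Complex.normSq_eq_norm_sq, Complex.normSq_apply]; ring
  have h4 : bilin 0 (1 / 2) (-(1 / 2)) 0 (conj q) (conj (Φ q)) * conj (ω q)
      = ((1 / 2 : ℝ) : ℂ) * (conj q - conj (Φ q)) * conj (ω q) := by
    rw [bilin]; push_cast; ring
  rw [h3, h4, norm_displacement, norm_mul, norm_mul, RCLike.norm_conj, Complex.norm_real,
    ← map_sub, RCLike.norm_conj]
  simp only [mul_pow, ← Complex.normSq_eq_norm_sq, Complex.normSq_apply, Complex.sub_re,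
    Complex.sub_im, Complex.conj_re, Complex.conj_im, abs_one, Real.norm_eq_abs, sq_abs] at h2 ⊢
  linear_combination -h2

lemma IsOmega.sq_norm_grad_le (h : IsOmega Φ a ν μ ω) (D : MLData Φ a ν μ)
    (hB : BoundaryMap Φ φ) (h0 : φ 0 = 0) (h1 : φ 1 = 1) {q : ℂ} (hq : q ∈ Hset) :
    ‖bilin 2 (-1) (-1) 2 (conj q) (conj (Φ q)) * conj (ω q)‖ ^ 2 ≤ 2 * weight Φ ω q ^ 2 := by
  refine le_trans (pow_le_pow_left₀ (norm_nonneg _) ?_ 2) (h.sq_modSum_mul_le D hB h0 h1 hq)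
  have e : bilin 2 (-1) (-1) 2 (conj q) (conj (Φ q))
      = conj (1 + q * Φ q + (1 - q) * (1 - Φ q)) := by
    simp only [bilin, map_add, map_mul, map_sub, map_one]; push_cast; ring
  rw [norm_mul, e, RCLike.norm_conj, RCLike.norm_conj, modSum]
  refine mul_le_mul_of_nonneg_right ?_ (norm_nonneg _)
  refine (norm_add₃_le).trans ?_
  rw [norm_mul, norm_mul, norm_one]

lemma IsOmega.sq_norm_displacement_grad_le (h : IsOmega Φ a ν μ ω) (D : MLData Φ a ν μ)
    (hB : BoundaryMap Φ φ) (h0 : φ 0 = 0) (h1 : φ 1 = 1) {q : ℂ} (hq : q ∈ Hset) :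
    (displacement 1 Φ ω q).re ^ 2 + (displacement 1 Φ ω q).im ^ 2 - 1 ≤ 8 * weight Φ ω q ^ 2 := by
  rw [← h.norm_sq_displacement hq]
  have h4 : bilin 0 (1 / 2) (-(1 / 2)) 0 (conj q) (conj (Φ q)) * conj (ω q)
      = ((1 / 2 : ℝ) : ℂ) * (conj q - conj (Φ q)) * conj (ω q) := by
    rw [bilin]; push_cast; ring
  have h5 : ‖bilin 0 (1 / 2) (-(1 / 2)) 0 (conj q) (conj (Φ q)) * conj (ω q)‖
      ≤ 2 * (modSum Φ q * ‖ω q‖) := by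
    rw [h4, norm_mul, norm_mul, RCLike.norm_conj, Complex.norm_real, ← map_sub, RCLike.norm_conj]
    have := (norm_sub_le q (Φ q)).trans (norm_add_norm_le Φ q)
    rw [Real.norm_of_nonneg (by norm_num)]
    nlinarith [norm_nonneg (ω q)]
  have h6 := pow_le_pow_left₀ (norm_nonneg _) h5 2
  have h7 := h.sq_modSum_mul_le D hB h0 h1 hq
  nlinarith

lemma HasL.cube {u : ℂ → ℝ} {U q : ℂ} {ℓ : ℝ} (h : HasL ν μ u U ℓ q) :
    ∃ V, HasL ν μ (fun z => u z ^ 3) V (3 * u q ^ 2 * ℓ + 6 * u q * carre ν μ q U U) q := by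
  have h2 := (h.mul h).mul h
  have e : (fun z => u z ^ 3) = fun z => u z * u z * u z := by
    funext z; ring
  rw [e]
  refine ⟨u q * u q * U + u q * (u q * U + u q * U), ?_⟩
  convert h2 using 1
  · push_cast; ring
  have h3 : carre ν μ q (u q * U + u q * U) U = 2 * u q * carre ν μ q U U := by
    simp only [carre, add_mul, mul_add, Complex.add_re, mul_assoc, Complex.re_ofReal_mul]
    rw [mul_left_comm (ν q) (u q : ℂ), Complex.re_ofReal_mul]
    ring
  rw [h3]
  ring

open MLData in
/-- The curvature estimate: the squared Beltrami coefficient is controlled by the displacement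
of the boundary map. -/
lemma IsOmega.lamSq_le (h : IsOmega Φ a ν μ ω) (D : MLData Φ a ν μ)
    (hB : BoundaryMap Φ φ) (h0 : φ 0 = 0) (h1 : φ 1 = 1) {ε : ℝ} (hε0 : 0 < ε)
    (hε : ∀ x : ℝ, |x - φ x| ≤ ε * (1 + |x| * |φ x|)) {q : ℂ} (hq : q ∈ Hset) :
    lamSq μ q ≤ 2107 * ε ^ 2 * weight Φ ω q ^ 3 := by
  have hF := fun {q : ℂ} (hq : q ∈ Hset) => h.weight_pos D hB h0 h1 hq
  have hF2 := fun {q : ℂ} (hq : q ∈ Hset) => h.two_le_weight_sq D hB h0 h1 hq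
  have hlam : ∀ z ∈ Hset, lamSq μ z * (1 + μ z) = μ z - 1 := fun z hz => by
    have := D.one_le_mu hz
    rw [lamSq]; field_simp; ring
  have hlam0 : ∀ z ∈ Hset, 0 ≤ lamSq μ z ∧ lamSq μ z ≤ 1 := fun z hz => by
    have h2 := D.one_le_mu hz
    have h3 := hlam z hz
    constructor <;> nlinarith
  set f : ℂ → ℝ := fun z => (displacement 1 Φ ω z).re with hf
  set k : ℂ → ℝ := fun z => (displacement 1 Φ ω z).im with hk
  have P := h.kPair D 0 (1 / 2) (-(1 / 2)) 0
  have PY := h.kPair D 2 (-1) (-1) 2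
  have hg0 : ∀ z ∈ Hset, 0 ≤ f z ^ 2 + k z ^ 2 - 1 := fun z hz => by
    have := h.norm_sq_displacement hz
    change _ = f z ^ 2 + k z ^ 2 - 1 at this
    rw [← this]; positivity
  have hg8 : ∀ z ∈ Hset, f z ^ 2 + k z ^ 2 - 1 ≤ 8 * weight Φ ω z ^ 2 := fun z hz =>
    h.sq_norm_displacement_grad_le D hB h0 h1 hz
  have hfε : ∀ z ∈ Hset, f z ^ 2 ≤ ε ^ 2 * weight Φ ω z ^ 2 := fun z hz => by
    have h2 := h.abs_re_displacement_le D hB h0 h1 hε0.le hε hz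
    rw [← mul_pow, ← sq_abs (f z)]
    exact pow_le_pow_left₀ (abs_nonneg _) h2 2
  set V : ℂ → ℝ := fun z => lamSq μ z + (55 * (f z * f z) + (6 * (k z * k z) + -6)) with hV
  have hVlam : ∀ z ∈ Hset, lamSq μ z ≤ V z := fun z hz => by
    have := hg0 z hz
    simp only [hV]; nlinarith [sq_nonneg (f z)]
  have hV500 : ∀ z ∈ Hset, V z ≤ 500 * weight Φ ω z ^ 2 := fun z hz => by
    have h2 := hg8 z hz
    have h3 := (hlam0 z hz).2
    have h4 := hF2 hz
    simp only [hV]; nlinarith [sq_nonneg (k z)]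
  by_contra! hcon
  set G : ℂ → ℝ := fun z => V z / weight Φ ω z ^ 3 with hG
  have hm : 2107 * ε ^ 2 < G q := by
    rw [hG, lt_div_iff₀ (pow_pos (hF hq) 3)]
    exact hcon.trans_le (hVlam q hq)
  have hm0 : 0 < G q := lt_trans (by positivity) hm
  have hlt : ∀ z ∈ Hset, 500 / G q < weight Φ ω z → G z < G q := by
    intro z hz hz'
    change V z / weight Φ ω z ^ 3 < G q
    rw [div_lt_iff₀ hm0] at hz'
    rw [div_lt_iff₀ (pow_pos (hF hz) 3)]
    have h2 := mul_lt_mul_of_pos_right hz' (pow_pos (hF hz) 2)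
    have h3 := hV500 z hz
    linarith [h2, h3, show weight Φ ω z * G q * weight Φ ω z ^ 2
      = G q * weight Φ ω z ^ 3 by ring]
  have hcont : ContinuousOn G Hset := by
    refine ContinuousOn.div ?_ ((h.continuousOn_weight D).pow 3)
      fun z hz => (pow_pos (hF hz) 3).ne'
    have c1 : ContinuousOn f Hset := P.continuousOn_re
    have c2 : ContinuousOn k Hset := fun z hz =>
      (Complex.continuous_im.continuousAt.comp (P.hasW_fst z hz).continuousAt).continuousWithinAt
    have c3 : ContinuousOn (lamSq μ) Hset := by
      refine continuousOn_const.add (continuousOn_const.mul (ContinuousOn.inv₀ ?_ ?_))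
      · exact continuousOn_const.add D.contDiff_mu.continuousOn
      · intro z hz
        linarith [D.one_le_mu hz]
    exact c3.add ((continuousOn_const.mul (c1.mul c1)).add
      ((continuousOn_const.mul (c2.mul c2)).add continuousOn_const))
  obtain ⟨p, hp, hpm, hpmax⟩ := exists_isMaxOn_Hset hcont hq le_rfl (fun x => by
    filter_upwards [h.weight_tendsto_real D hB h0 h1 (500 / G q) x, self_mem_nhdsWithin]
      with z hz hzH using hlt z hzH hz) (by
    filter_upwards [h.weight_tendsto_infty D hB h0 h1 (500 / G q),
      eventually_inf_principal.2 (Eventually.of_forall fun q hq => hq)]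
      with z hz hzH using hlt z hzH hz)
  have hc : G p * weight Φ ω p ^ 3 = V p := div_mul_cancel₀ _ (pow_pos (hF hp) 3).ne'
  have hloc : IsLocalMax (fun z => V z + (-G p) * weight Φ ω z ^ 3) p := by
    filter_upwards [isOpen_Hset.mem_nhds hp] with z hz
    have h3 : V z / weight Φ ω z ^ 3 ≤ G p := hpmax hz
    rw [div_le_iff₀ (pow_pos (hF hz) 3)] at h3
    linarith
  obtain ⟨U, ℓ, hL1, hℓ⟩ := D.exists_hasL_lamSq hp
  obtain ⟨W, hW⟩ := (PY.hasL_re D hp).cube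
  have hf2 := (P.hasL_re D hp).mul (P.hasL_re D hp)
  have hk2 := (P.hasL_im D hp).mul (P.hasL_im D hp)
  rw [KPair.carre_dRe D _ hp] at hf2 hW
  rw [KPair.carre_dIm D _ hp] at hk2
  rw [h.norm_sq_displacement hp] at hf2 hk2
  have hL := (hL1.add ((hf2.const_mul 55).add ((hk2.const_mul 6).add
    (HasL.const (-6) p)))).add (hW.const_mul (-G p))
  have h2 := hL.nonpos_of_isLocalMax hloc (D.norm_nu_lt hp).le
  have hgrad := h.sq_norm_grad_le D hB h0 h1 hp
  generalize ‖bilin 2 (-1) (-1) 2 (conj p) (conj (Φ p)) * conj (ω p)‖ ^ 2 = S at *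
  change ℓ + (55 * (f p * ((1 + μ p) / 4 * f p) + f p * ((1 + μ p) / 4 * f p)
    + 2 * ((1 + μ p) / 8 * (f p ^ 2 + k p ^ 2 - 1)))
    + (6 * (k p * ((μ p - 1) / 4 * k p) + k p * ((μ p - 1) / 4 * k p)
    + 2 * ((μ p - 1) / 8 * (f p ^ 2 + k p ^ 2 - 1))) + 0))
    + -G p * (3 * weight Φ ω p ^ 2 * ((1 + μ p) / 4 * weight Φ ω p)
    + 6 * weight Φ ω p * ((1 + μ p) / 8 * S)) ≤ 0 at h2
  have hVp : V p = lamSq μ p + (55 * (f p * f p) + (6 * (k p * k p) + -6)) := rfl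
  have k1 := D.one_le_mu hp
  have k2 := hlam p hp
  have k3 := hlam0 p hp
  have k4 := hg0 p hp
  have k5 := hfε p hp
  have k6 := hF hp
  have k7 := hF2 hp
  have k8 : 0 < G p := hm0.trans_le hpm
  have k9 : G p * (weight Φ ω p * S) ≤ 2 * V p := by
    rw [← hc]
    have := mul_le_mul_of_nonneg_left hgrad (mul_pos k8 k6).le
    linarith
  have k10 : 2107 * ε ^ 2 * weight Φ ω p ^ 3 < V p := by
    rw [← hc]
    exact mul_lt_mul_of_pos_right (hm.trans_le hpm) (pow_pos k6 3)
  have k11 : weight Φ ω p ^ 2 ≤ weight Φ ω p ^ 3 := by nlinarith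
  have k12 : 2107 * f p ^ 2 < V p := by nlinarith [sq_nonneg ε]
  have k13 : -lamSq μ p + 55 * ((1 + μ p) / 2 * f p ^ 2 + (1 + μ p) / 4 * (f p ^ 2 + k p ^ 2 - 1))
      + 6 * ((μ p - 1) / 2 * k p ^ 2 + (μ p - 1) / 4 * (f p ^ 2 + k p ^ 2 - 1))
      ≤ 9 / 4 * (1 + μ p) * V p := by
    have e1 : G p * (3 * weight Φ ω p ^ 2 * ((1 + μ p) / 4 * weight Φ ω p)
        + 6 * weight Φ ω p * ((1 + μ p) / 8 * S))
        = (1 + μ p) * (3 / 4 * V p + 3 / 4 * (G p * (weight Φ ω p * S))) := by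
      rw [← hc]; ring
    have e2 := mul_le_mul_of_nonneg_left k9 (by linarith : 0 ≤ 1 + μ p)
    linarith
  obtain ⟨g, hg⟩ : ∃ g, g = f p ^ 2 + k p ^ 2 - 1 := ⟨_, rfl⟩
  have hk2 : k p ^ 2 = g + 1 - f p ^ 2 := by linarith
  have hV' : V p = lamSq μ p + 6 * g + 49 * f p ^ 2 := by rw [hVp, hg]; ring
  rw [← hg, hk2, hV'] at k13
  rw [← hg] at k4
  rw [hV'] at k12
  generalize lamSq μ p = L at *
  generalize f p = b at *
  generalize μ p = M at *
  have k14 : (1 + M) * (g + L) ≤ (1 + M) * (343 * b ^ 2) := by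
    nlinarith [mul_nonneg (sub_nonneg.2 k1) k4, sq_nonneg b]
  have k15 := le_of_mul_le_mul_left k14 (by linarith)
  linarith

end Bernstein

/-! ### Bounding the image of the base point -/

lemma le_of_re_mul_sq_ge {c : ℂ} {t : ℝ} (hc : ‖c‖ = 1) (ht1 : t ≤ 1)
    (h : ∀ ζ : ℂ, ‖ζ‖ = 1 → -(1 / 20) ≤ (c * (1 + t * ζ) ^ 2).re) : t ≤ 4 / 5 := by
  by_contra! ht
  have hc2 : c.re ^ 2 + c.im ^ 2 = 1 := by
    have : ‖c‖ ^ 2 = 1 := by rw [hc]; norm_num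
    rw [← Complex.normSq_eq_norm_sq, Complex.normSq_apply] at this
    linarith
  have hs : (√2) ^ 2 = 2 := Real.sq_sqrt (by norm_num)
  have hs1 : 1.4 ≤ √2 := Real.le_sqrt_of_sq_le (by norm_num)
  have hs0 : √2 ≤ 1.5 := by rw [Real.sqrt_le_left (by norm_num)]; norm_num
  set r := √2 / 2 with hr
  have hr2 : r ^ 2 = 1 / 2 := by rw [hr, div_pow, hs]; norm_num
  have n1 : ∀ x y : ℝ, x ^ 2 + y ^ 2 = 1 → ‖(⟨x, y⟩ : ℂ)‖ = 1 := by
    intro x y hxy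
    rw [Complex.norm_def, Complex.normSq_apply, Real.sqrt_eq_one]
    linarith
  have ev : ∀ x y : ℝ, (c * (1 + t * (⟨x, y⟩ : ℂ)) ^ 2).re
      = c.re * ((1 + t * x) ^ 2 - (t * y) ^ 2) - c.im * (2 * (1 + t * x) * (t * y)) := by
    intro x y
    simp only [sq, Complex.mul_re, Complex.mul_im, Complex.add_re, Complex.add_im, Complex.one_re,
      Complex.one_im, Complex.ofReal_re, Complex.ofReal_im]
    ring
  have h1 := h ⟨1, 0⟩ (n1 _ _ (by norm_num))
  have h2 := h ⟨0, 1⟩ (n1 _ _ (by norm_num))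
  have h3 := h ⟨0, -1⟩ (n1 _ _ (by norm_num))
  have h4 := h ⟨-r, r⟩ (n1 _ _ (by nlinarith))
  have h5 := h ⟨-r, -r⟩ (n1 _ _ (by nlinarith))
  rw [ev] at h1 h2 h3 h4 h5
  have h6 : -(1 / 20) ≤ c.re * (1 - √2 * t) := by
    have : √2 = 2 * r := by rw [hr]; ring
    rw [this]
    linarith
  have hst : 1.12 ≤ √2 * t := by
    have := mul_le_mul hs1 ht.le (by norm_num) (by positivity)
    linarith
  have hre1 : c.re ≤ 1 / 2 := by
    by_contra! hcon
    have := mul_le_mul hcon.le (sub_le_sub_right hst 1) (by norm_num) (by linarith)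
    linarith
  have hre0 : -(1 / 20) ≤ c.re := by
    by_contra! hcon
    have := mul_nonneg (by linarith : 0 ≤ -c.re) (by nlinarith : 0 ≤ (1 + t) ^ 2 - 1)
    linarith
  have ht2 : 0.64 ≤ t ^ 2 := by nlinarith
  have hre4 : c.re * (1 - t ^ 2) ≤ 1 / 2 * (1 - t ^ 2) :=
    mul_le_mul_of_nonneg_right hre1 (by nlinarith)
  have him1 : c.im ≤ 0.2 := by
    by_contra! hcon
    have := mul_le_mul hcon.le ht.le (by norm_num) (by linarith)
    linarith
  have him2 : -0.2 ≤ c.im := by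
    by_contra! hcon
    have := mul_le_mul (by linarith : 0.2 ≤ -c.im) ht.le (by norm_num) (by linarith)
    linarith
  have e1 : c.re ^ 2 ≤ (1 / 2) ^ 2 := sq_le_sq' (by linarith) hre1
  have e2 : c.im ^ 2 ≤ 0.2 ^ 2 := sq_le_sq' him2 him1
  norm_num at e1 e2
  linarith

section BasePoint

variable {Φ a ν ω : ℂ → ℂ} {μ : ℂ → ℝ} {φ : ℝ → ℝ}

lemma norm_sub_one_le_of_re_pos {P : ℂ} {ε : ℝ} (hP : ‖P‖ = 1) (hre : 0 ≤ P.re)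
    (him : |P.im| ≤ ε) : ‖P - 1‖ ≤ 2 * ε := by
  have hε : 0 ≤ ε := (abs_nonneg _).trans him
  have h1 : P.re ^ 2 + P.im ^ 2 = 1 := by
    have : ‖P‖ ^ 2 = 1 := by rw [hP]; norm_num
    rw [← Complex.normSq_eq_norm_sq, Complex.normSq_apply] at this
    linarith
  have h2 : P.im ^ 2 ≤ ε ^ 2 := by
    rw [← sq_abs]; exact pow_le_pow_left₀ (abs_nonneg _) him 2
  refine (pow_le_pow_iff_left₀ (norm_nonneg _) (by linarith) two_ne_zero).1 ?_
  rw [← Complex.normSq_eq_norm_sq, Complex.normSq_apply]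
  simp only [Complex.sub_re, Complex.sub_im, Complex.one_re, Complex.one_im]
  nlinarith [sq_nonneg P.im]

/-- The cone condition at the base point `i`, with `φ` replaced by the identity. -/
lemma MLData.cone_I_approx (D : MLData Φ a ν μ) (hB : BoundaryMap Φ φ) (h0 : φ 0 = 0) {ε : ℝ}
    (hε1 : ε ≤ 1 / 1000) (hε : ∀ x : ℝ, |x - φ x| ≤ ε * (1 + |x| * |φ x|)) {A B : ℂ}
    (hAB : A + B = 1) (hw : Φ Complex.I = Complex.I * (A - B)) (hle : ‖B‖ ≤ ‖A‖) {ζ : ℂ}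
    (hζ : ‖ζ‖ = 1) :
    -(1 / 20) * (‖a Complex.I‖ * ‖A‖ ^ 2) ≤ (conj (a Complex.I) * (A + B * ζ) ^ 2).re := by
  have hI : Complex.I ∈ Hset := show 0 < Complex.I.im by simp
  have hε0 : 0 ≤ ε := by
    have := hε 0
    rw [h0] at this
    simpa using this
  rcases eq_or_ne ζ 1 with rfl | hζ1
  · have h2 := D.cone_infty hB D.coneAdmissible_one hI
    rw [mul_one, hAB, one_pow, mul_one]
    simp only [map_one, one_mul] at h2
    refine le_trans ?_ h2
    nlinarith [mul_nonneg (norm_nonneg (a Complex.I)) (sq_nonneg ‖A‖)]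
  obtain ⟨z, hz⟩ : ∃ z : ℝ, (z : ℂ) = Complex.I * (ζ + 1) / (ζ - 1) := by
    have hc : conj (Complex.I * (ζ + 1) / (ζ - 1)) = Complex.I * (ζ + 1) / (ζ - 1) := by
      have hζc : conj ζ = ζ⁻¹ := (Complex.inv_eq_conj hζ).symm
      have hζ0 : ζ ≠ 0 := by rintro rfl; simp at hζ
      have e1 : ζ - 1 ≠ 0 := sub_ne_zero.2 hζ1
      have e2 : ζ⁻¹ - 1 ≠ 0 := fun h => e1 (by field_simp at h; linear_combination -h)
      simp only [map_div₀, map_mul, map_add, map_sub, map_one, Complex.conj_I, hζc]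
      rw [div_eq_div_iff e2 e1]
      field_simp
      ring
    exact ⟨_, Complex.conj_eq_iff_re.1 hc⟩
  have hζz : ζ * (z - Complex.I) = z + Complex.I := by
    have e1 : ζ - 1 ≠ 0 := sub_ne_zero.2 hζ1
    rw [hz]; field_simp; ring
  have hzφ : 0 ≤ z * φ z := by
    have hm := hB.monotone D
    rcases le_total 0 z with h | h
    · exact mul_nonneg h (h0 ▸ hm h)
    · exact mul_nonneg_of_nonpos_of_nonpos h (h0 ▸ hm h)
  have hcone := D.cone_real hB D.coneAdmissible_one hI z
  simp only [map_one, one_mul, Complex.conj_I, sub_neg_eq_add] at hcone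
  set s := φ z with hs
  set r := √((1 + z ^ 2) * (1 + s ^ 2)) with hr
  have hr0 : 0 < r := Real.sqrt_pos.2 (by positivity)
  have hr2 : r ^ 2 = (1 + z ^ 2) * (1 + s ^ 2) := Real.sq_sqrt (by positivity)
  set P : ℂ := ⟨(1 + z * s) / r, (s - z) / r⟩ with hP
  have hPr : (r : ℂ) * P = (z + Complex.I) * (s - Complex.I) := by
    apply Complex.ext <;> simp [hP] <;> field_simp <;> ring
  have hPn : ‖P‖ = 1 := by
    rw [Complex.norm_def, Complex.normSq_apply, Real.sqrt_eq_one]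
    simp only [hP]
    field_simp
    rw [hr2]; ring
  have hPre : 0 ≤ P.re := by simp only [hP]; positivity
  have hPim : |P.im| ≤ ε := by
    simp only [hP]
    rw [abs_div, abs_of_pos hr0, div_le_iff₀ hr0, abs_sub_comm]
    refine (hε z).trans (mul_le_mul_of_nonneg_left ?_ hε0)
    refine Real.le_sqrt_of_sq_le ?_
    nlinarith [sq_nonneg (|z| - |s|), sq_abs z, sq_abs s]
  have hP1 := norm_sub_one_le_of_re_pos hPn hPre hPim
  have hQr : (r : ℂ) * (ζ * conj P) = (z + Complex.I) * (s + Complex.I) := by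
    have e := congrArg conj hPr
    simp only [map_mul, map_add, map_sub, Complex.conj_ofReal, Complex.conj_I] at e
    linear_combination ζ * e + (s + Complex.I) * hζz
  set e : ℂ := (P - 1) * A + ζ * (conj P - 1) * B with he
  have hfac : (z + Complex.I) * (s - Φ Complex.I) = r * (A + B * ζ + e) := by
    rw [hw, he]
    linear_combination (-A) * hPr - B * hQr + (s * (z + Complex.I)) * (-hAB)
  have hen : ‖e‖ ≤ 4 * ε * ‖A‖ := by
    refine (norm_add_le _ _).trans ?_
    have : ‖conj P - 1‖ = ‖P - 1‖ := by
      rw [← RCLike.norm_conj (P - 1), map_sub, map_one]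
    rw [norm_mul, norm_mul, norm_mul, hζ, this, one_mul]
    have := mul_le_mul hP1 hle (norm_nonneg _) (by linarith)
    have := mul_le_mul_of_nonneg_right hP1 (norm_nonneg A)
    linarith
  have h2 : 0 ≤ (conj (a Complex.I) * (A + B * ζ + e) ^ 2).re := by
    have e1 : conj (a Complex.I) * (z + Complex.I) ^ 2 * (s - Φ Complex.I) ^ 2
        = ((r ^ 2 : ℝ) : ℂ) * (conj (a Complex.I) * (A + B * ζ + e) ^ 2) := by
      rw [mul_assoc, ← mul_pow, hfac]; push_cast; ring
    rw [e1, Complex.re_ofReal_mul] at hcone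
    exact nonneg_of_mul_nonneg_right hcone (by positivity)
  have h3 : conj (a Complex.I) * (A + B * ζ) ^ 2 = conj (a Complex.I) * (A + B * ζ + e) ^ 2
      - conj (a Complex.I) * (e * (2 * (A + B * ζ) + e)) := by ring
  have hABn : ‖A + B * ζ‖ ≤ 2 * ‖A‖ := by
    refine (norm_add_le _ _).trans ?_
    rw [norm_mul, hζ]; linarith
  have h4 : ‖conj (a Complex.I) * (e * (2 * (A + B * ζ) + e))‖
      ≤ ‖a Complex.I‖ * (1 / 20 * ‖A‖ ^ 2) := by
    rw [norm_mul, RCLike.norm_conj, norm_mul]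
    refine mul_le_mul_of_nonneg_left ?_ (norm_nonneg _)
    have hA := norm_nonneg A
    have e1 : ‖2 * (A + B * ζ) + e‖ ≤ 5 * ‖A‖ := by
      refine (norm_add_le _ _).trans ?_
      rw [norm_mul, Complex.norm_ofNat]
      nlinarith
    have e2 : ‖e‖ ≤ 1 / 100 * ‖A‖ := hen.trans (mul_le_mul_of_nonneg_right (by linarith) hA)
    calc _ ≤ 1 / 100 * ‖A‖ * (5 * ‖A‖) := mul_le_mul e2 e1 (norm_nonneg _) (by positivity)
      _ = _ := by ring
  have h5 := (Complex.re_le_norm _).trans h4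
  rw [h3, Complex.sub_re]
  linarith

/-- If the boundary map is close to the identity, the image of `i` stays in a compact set. -/
lemma MLData.normSq_I_le (D : MLData Φ a ν μ) (hB : BoundaryMap Φ φ) (h0 : φ 0 = 0) {ε : ℝ}
    (hε1 : ε ≤ 1 / 1000) (hε : ∀ x : ℝ, |x - φ x| ≤ ε * (1 + |x| * |φ x|)) :
    1 + ‖Φ Complex.I‖ ^ 2 ≤ 10 * (Φ Complex.I).im := by
  have hI : Complex.I ∈ Hset := show 0 < Complex.I.im by simp
  have hY := D.im_pos _ hI
  obtain ⟨A, B, hA, hB'⟩ : ∃ A B : ℂ, A = (1 - Complex.I * Φ Complex.I) / 2 ∧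
      B = (1 + Complex.I * Φ Complex.I) / 2 := ⟨_, _, rfl, rfl⟩
  have hAB : A + B = 1 := by rw [hA, hB']; ring
  have hw : Φ Complex.I = Complex.I * (A - B) := by
    rw [hA, hB']; linear_combination Φ Complex.I * Complex.I_sq
  have nA : ‖A‖ ^ 2 = (1 + ‖Φ Complex.I‖ ^ 2) / 4 + (Φ Complex.I).im / 2 := by
    rw [hA]
    simp only [← Complex.normSq_eq_norm_sq, Complex.normSq_apply, Complex.div_ofNat_re,
      Complex.div_ofNat_im, Complex.sub_re, Complex.sub_im, Complex.mul_re, Complex.mul_im,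
      Complex.I_re, Complex.I_im, Complex.one_re, Complex.one_im]
    ring
  have nB : ‖B‖ ^ 2 = (1 + ‖Φ Complex.I‖ ^ 2) / 4 - (Φ Complex.I).im / 2 := by
    rw [hB']
    simp only [← Complex.normSq_eq_norm_sq, Complex.normSq_apply, Complex.div_ofNat_re,
      Complex.div_ofNat_im, Complex.add_re, Complex.add_im, Complex.mul_re, Complex.mul_im,
      Complex.I_re, Complex.I_im, Complex.one_re, Complex.one_im]
    ring
  have hle : ‖B‖ ≤ ‖A‖ := by
    refine (pow_le_pow_iff_left₀ (norm_nonneg _) (norm_nonneg _) two_ne_zero).1 ?_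
    linarith
  have hA0 : 0 < ‖A‖ := by
    have : 0 < ‖A‖ ^ 2 := by rw [nA]; positivity
    exact (norm_nonneg A).lt_of_ne fun h => by simp [← h] at this
  have ha0 : 0 < ‖a Complex.I‖ := norm_pos_iff.2 (D.a_ne_zero hI)
  have hAc : A ≠ 0 := norm_pos_iff.1 hA0
  have hac : a Complex.I ≠ 0 := norm_pos_iff.1 ha0
  have ht : ‖B‖ / ‖A‖ ≤ 4 / 5 := by
    rcases eq_or_ne B 0 with h | hB0
    · rw [h]; simp; norm_num
    have hBn : ‖B‖ ≠ 0 := norm_ne_zero_iff.2 hB0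
    refine le_of_re_mul_sq_ge (c := conj (a Complex.I) * A ^ 2 / (‖a Complex.I‖ * ‖A‖ ^ 2 : ℝ))
      ?_ ((div_le_one hA0).2 hle) fun ζ hζ => ?_
    · rw [norm_div, norm_mul, RCLike.norm_conj, norm_pow, Complex.norm_real, Real.norm_eq_abs,
        abs_of_pos (by positivity), div_self (by positivity)]
    · have h2 := D.cone_I_approx hB h0 hε1 hε hAB hw hle
        (ζ := ((‖B‖ / ‖A‖ : ℝ) : ℂ) * A * ζ / B) (by
          rw [norm_div, norm_mul, norm_mul, hζ, Complex.norm_real, Real.norm_eq_abs,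
            abs_of_nonneg (by positivity)]
          field_simp)
      have e1 : conj (a Complex.I) * A ^ 2 / (‖a Complex.I‖ * ‖A‖ ^ 2 : ℝ)
          * (1 + (‖B‖ / ‖A‖ : ℝ) * ζ) ^ 2 = ((‖a Complex.I‖ * ‖A‖ ^ 2 : ℝ) : ℂ)⁻¹ *
          (conj (a Complex.I) * (A + B * (((‖B‖ / ‖A‖ : ℝ) : ℂ) * A * ζ / B)) ^ 2) := by
        field_simp
      rw [e1, ← Complex.ofReal_inv, Complex.re_ofReal_mul, ← div_eq_inv_mul,
        le_div_iff₀ (by positivity)]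
      exact h2
  rw [div_le_iff₀ hA0] at ht
  have h2 := pow_le_pow_left₀ (norm_nonneg _) ht 2
  rw [mul_pow, nA, nB] at h2
  linarith

end BasePoint

/-- At the base point, the diagonal Beltrami coefficient is at most `3`. -/
lemma MLData.mu_I_le {Φ a ν : ℂ → ℂ} {μ : ℂ → ℝ} {φ : ℝ → ℝ} (D : MLData Φ a ν μ)
    (hB : BoundaryMap Φ φ) (h0 : φ 0 = 0) (h1 : φ 1 = 1)
    (hε : ∀ x : ℝ, |x - φ x| ≤ 1 / 3000 * (1 + |x| * |φ x|)) : μ Complex.I ≤ 3 := by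
  have hI : Complex.I ∈ Hset := show 0 < Complex.I.im by simp
  obtain ⟨ω, h⟩ := D.exists_isOmega hB
  have h2 := h.lamSq_le D hB h0 h1 (by norm_num) hε hI
  have h3 := D.normSq_I_le hB h0 (by norm_num) hε
  have h4 := h.norm_sq _ hI
  have hY := D.im_pos _ hI
  have hF := h.weight_pos D hB h0 h1 hI
  rw [Complex.I_im, one_mul] at h4
  have h5 : weight Φ ω Complex.I ≤ modSum Φ Complex.I * ‖ω Complex.I‖ := by
    refine (Complex.re_le_norm _).trans ?_
    rw [norm_mul]
    refine mul_le_mul_of_nonneg_right ?_ (norm_nonneg _)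
    have e : bilin 2 (-1) (-1) 2 (conj Complex.I) (Φ Complex.I)
        = 1 + conj Complex.I * Φ Complex.I + conj (1 - Complex.I) * (1 - Φ Complex.I) := by
      simp only [bilin, map_sub, map_one]; push_cast; ring
    rw [e, modSum]
    refine (norm_add₃_le).trans ?_
    rw [norm_mul, norm_mul, norm_one, RCLike.norm_conj, RCLike.norm_conj]
  have h6 : modSum Φ Complex.I ≤ 5 / 2 * (1 + ‖Φ Complex.I‖) := by
    have e1 : ‖1 - Complex.I‖ ≤ 3 / 2 := by
      rw [Complex.norm_def, Complex.normSq_apply, Real.sqrt_le_left (by norm_num)]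
      simp; norm_num
    have e2 : ‖1 - Φ Complex.I‖ ≤ 1 + ‖Φ Complex.I‖ := by
      simpa using norm_sub_le 1 (Φ Complex.I)
    have e3 := mul_le_mul e1 e2 (norm_nonneg _) (by norm_num)
    rw [modSum, Complex.norm_I]
    linarith
  have h7 : weight Φ ω Complex.I ^ 2 ≤ 125 := by
    have hS : 0 ≤ modSum Φ Complex.I := by linarith [one_le_modSum Φ Complex.I]
    have e1 := pow_le_pow_left₀ hF.le h5 2
    have e2 := pow_le_pow_left₀ hS h6 2
    have e3 : modSum Φ Complex.I ^ 2 ≤ 125 * (Φ Complex.I).im := by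
      nlinarith [sq_nonneg (1 - ‖Φ Complex.I‖)]
    rw [mul_pow] at e1
    have e4 := mul_le_mul_of_nonneg_right e3 (sq_nonneg ‖ω Complex.I‖)
    linarith
  have h8 : weight Φ ω Complex.I ≤ 12 := by nlinarith
  have h9 := pow_le_pow_left₀ hF.le h8 3
  have h10 : MLData.lamSq μ Complex.I ≤ 1 / 2 := by
    norm_num at h2 h9 ⊢; linarith
  have h11 := D.one_le_mu hI
  rw [MLData.lamSq] at h10
  have h12 : (1 / 4 : ℝ) ≤ (1 + μ Complex.I)⁻¹ := by linarith
  rw [one_div, inv_le_inv₀ (by norm_num) (by linarith)] at h12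
  linarith

/-! ### Quasisymmetric maps of the line with small distortion -/

/-- Adjacent intervals of the same length have images of comparable length, up to the factor `M`. -/
def MidpointBound (M : ℝ) (φ : ℝ → ℝ) : Prop :=
  ∀ x t : ℝ, 0 < t → φ x - φ (x - t) ≤ M * (φ (x + t) - φ x) ∧
    φ (x + t) - φ x ≤ M * (φ x - φ (x - t))

lemma increment_bounds {f : ℕ → ℝ} {M : ℝ} (hM : 1 ≤ M) (h0 : f 0 = 0) (hf : Monotone f)
    (h1 : ∀ k, f (k + 2) - f (k + 1) ≤ M * (f (k + 1) - f k))
    (h2 : ∀ k, f (k + 1) - f k ≤ M * (f (k + 2) - f (k + 1))) {K k : ℕ} (hk : k ≤ K) :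
    f k ≤ k * (M ^ K * f 1) ∧ k * f 1 ≤ M ^ K * f k := by
  have hM0 : 0 ≤ M := by linarith
  have d : ∀ j, f (j + 1) - f j ≤ M ^ j * f 1 ∧ f 1 ≤ M ^ j * (f (j + 1) - f j) := by
    intro j
    induction j with
    | zero => simp [h0]
    | succ j ih =>
      refine ⟨(h1 j).trans ?_, ih.2.trans ?_⟩
      · calc M * (f (j + 1) - f j) ≤ M * (M ^ j * f 1) := mul_le_mul_of_nonneg_left ih.1 hM0
          _ = _ := by ring
      · calc M ^ j * (f (j + 1) - f j) ≤ M ^ j * (M * (f (j + 2) - f (j + 1))) :=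
            mul_le_mul_of_nonneg_left (h2 j) (by positivity)
          _ = _ := by ring
  have hf1 : 0 ≤ f 1 := h0 ▸ hf zero_le_one
  induction k with
  | zero => simp [h0]
  | succ k ih =>
    obtain ⟨i1, i2⟩ := ih (by omega)
    obtain ⟨d1, d2⟩ := d k
    have hp : M ^ k ≤ M ^ K := pow_le_pow_right₀ hM (by omega)
    have e1 := mul_le_mul_of_nonneg_right hp hf1
    have e2 := mul_le_mul_of_nonneg_right hp (sub_nonneg.2 (hf k.le_succ))
    push_cast
    constructor <;> linarith

lemma abs_sub_le_of_grid {ψ : ℝ → ℝ} (hψ : Monotone ψ) {ε T : ℝ} {n N : ℕ} (hε : 0 < ε)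
    (hT1 : 1 ≤ T) (hT2 : T ≤ 2) (hn : 4 / ε ≤ n) (hN : 4 / ε ≤ N) (hTN : (T - 1) * N ≤ ε / 2)
    (h : ∀ k : ℕ, k ≤ N * n + 1 → (k / n : ℝ) ≤ T * ψ (k / n) ∧ ψ (k / n) ≤ T * (k / n))
    {z : ℝ} (hz : 0 ≤ z) : |z - ψ z| ≤ ε * (1 + |z| * |ψ z|) := by
  have hn0 : (0 : ℝ) < n := (by positivity : 0 < 4 / ε).trans_le hn
  have hψ0 : 0 ≤ ψ z := by
    have h2 := (h 0 (by omega)).1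
    simp only [Nat.cast_zero, zero_div] at h2
    have h3 : 0 ≤ ψ 0 := by
      by_contra! hcon
      nlinarith
    exact h3.trans (hψ hz)
  rw [abs_of_nonneg hz, abs_of_nonneg hψ0]
  rcases le_total z N with hzN | hzN
  · have k1 := Nat.floor_le (mul_nonneg hz hn0.le)
    have k2 := Nat.lt_floor_add_one (z * n)
    have hK : ⌊z * n⌋₊ ≤ N * n := by
      have : (⌊z * n⌋₊ : ℝ) ≤ N * n := k1.trans (mul_le_mul_of_nonneg_right hzN hn0.le)
      exact_mod_cast this
    have b1 := (h ⌊z * n⌋₊ (by omega)).1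
    have b2 := (h (⌊z * n⌋₊ + 1) (by omega)).2
    push_cast at b2
    set k : ℝ := (⌊z * n⌋₊ : ℝ)
    have c1 : k / n ≤ z := (div_le_iff₀ hn0).2 k1
    have c2 : z ≤ (k + 1) / n := (le_div_iff₀ hn0).2 k2.le
    have c3 : (k + 1) / n = k / n + 1 / n := add_div _ _ _
    have c4 : (1 : ℝ) / n ≤ ε / 4 := by
      rw [div_le_iff₀ hε] at hn
      rw [div_le_iff₀ hn0]; linarith
    have m1 := hψ c1
    have m2 := hψ c2
    have c5 : (T - 1) * z ≤ ε / 2 := (mul_le_mul_of_nonneg_left hzN (by linarith)).trans hTN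
    have u1 : ψ z ≤ T * (z + ε / 4) := by
      refine m2.trans (b2.trans (mul_le_mul_of_nonneg_left ?_ (by linarith)))
      linarith
    have u2 : z - ε / 4 ≤ T * ψ z := by
      have := mul_le_mul_of_nonneg_left m1 (by linarith : 0 ≤ T)
      linarith
    have u3 : ψ z ≤ z + ε := by nlinarith
    have u4 : z - ε ≤ ψ z := by
      by_contra! hcon
      have := mul_lt_mul_of_pos_left hcon (by linarith : 0 < T)
      nlinarith
    have u5 : |z - ψ z| ≤ ε := abs_le.2 ⟨by linarith, by linarith⟩
    nlinarith [mul_nonneg hε.le (mul_nonneg hz hψ0)]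
  · have b1 := (h (N * n) (by omega)).1
    have e : ((N * n : ℕ) : ℝ) / n = N := by push_cast; field_simp
    rw [e] at b1
    have m1 := hψ hzN
    rw [div_le_iff₀ hε] at hN
    have hN0 : (0 : ℝ) ≤ N := Nat.cast_nonneg N
    have m2 : (N : ℝ) ≤ 2 * ψ z := by nlinarith
    have c1 : 2 ≤ ψ z * ε := by nlinarith
    have c2 : 2 ≤ z * ε := by nlinarith
    rw [abs_le]
    constructor <;> nlinarith

/-- A normalized monotone map of the line with distortion close to `1` is close to the identity. -/
lemma exists_midpointBound_close {ε : ℝ} (hε : 0 < ε) : ∃ M > 1, ∀ φ : ℝ → ℝ, Monotone φ →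
    φ 0 = 0 → φ 1 = 1 → MidpointBound M φ → ∀ x, |x - φ x| ≤ ε * (1 + |x| * |φ x|) := by
  obtain ⟨n, hn⟩ := exists_nat_ge (4 / ε)
  have hnR : (0 : ℝ) < n := (by positivity : 0 < 4 / ε).trans_le hn
  have hn0 : 0 < n := by exact_mod_cast hnR
  set K := n * n + 1 with hK
  obtain ⟨M, hM1, hM⟩ : ∃ M > (1 : ℝ), M ^ (2 * K + 1) < 1 + min 1 (ε / 2 / n) := by
    have hc : Tendsto (fun M : ℝ => M ^ (2 * K + 1)) (𝓝[>] 1) (𝓝 (1 ^ (2 * K + 1))) :=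
      ((continuous_pow _).tendsto _).mono_left nhdsWithin_le_nhds
    have hlt : (1 : ℝ) ^ (2 * K + 1) < 1 + min 1 (ε / 2 / n) := by
      rw [one_pow]; linarith [lt_min one_pos (by positivity : 0 < ε / 2 / n)]
    obtain ⟨M, h1, h2⟩ := ((hc.eventually_lt_const hlt).and self_mem_nhdsWithin).exists
    exact ⟨M, h2, h1⟩
  have hMK : 1 ≤ M ^ K := one_le_pow₀ hM1.le
  refine ⟨M, hM1, fun φ hφ h0 h1 hMB => ?_⟩
  set T := M ^ (2 * K + 1) with hT
  have hT1 : 1 ≤ T := one_le_pow₀ hM1.le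
  have hT2 : T ≤ 2 := by linarith [min_le_left 1 (ε / 2 / n)]
  have hTN : (T - 1) * n ≤ ε / 2 := by
    rw [← le_div_iff₀ hnR]; linarith [min_le_right 1 (ε / 2 / n)]
  have hTe : T = M ^ K * M ^ K * M := by rw [hT]; ring
  have step : (0 : ℝ) < 1 / n := by positivity
  have hp := fun {k : ℕ} (hk : k ≤ K) => increment_bounds (f := fun k => φ (k / n)) (K := K) hM1.le
    (by simpa using h0) (fun i j hij => hφ (by gcongr))
    (fun k => by
      have := (hMB ((k + 1 : ℕ) / n) (1 / n) step).2
      convert this using 3 <;> push_cast <;> ring_nf)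
    (fun k => by
      have := (hMB ((k + 1 : ℕ) / n) (1 / n) step).1
      convert this using 3 <;> push_cast <;> ring_nf) hk
  have e1 : ∀ k : ℕ, -(((k + 1 : ℕ) : ℝ) / n) - 1 / n = -(((k + 2 : ℕ) : ℝ) / n) := fun k => by
    push_cast; ring
  have e2 : ∀ k : ℕ, -(((k + 1 : ℕ) : ℝ) / n) + 1 / n = -((k : ℝ) / n) := fun k => by
    push_cast; ring
  have hm := fun {k : ℕ} (hk : k ≤ K) => increment_bounds (f := fun k => -φ (-(k / n))) (K := K)
    hM1.le (by simpa using h0)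
    (fun i j hij => neg_le_neg (hφ (neg_le_neg (by gcongr))))
    (fun k => by
      have := (hMB (-((k + 1 : ℕ) / n)) (1 / n) step).1
      rw [e1 k, e2 k] at this
      linarith)
    (fun k => by
      have := (hMB (-((k + 1 : ℕ) / n)) (1 / n) step).2
      rw [e1 k, e2 k] at this
      linarith) hk
  have hMB0 := hMB 0 (1 / n) step
  have hn1 := hp (k := n) (by rw [hK]; nlinarith)
  simp only [div_self hnR.ne', h1, h0, Nat.cast_one, zero_sub, zero_add, sub_zero] at hp hm hMB0 hn1
  have hd0 : 0 ≤ φ (1 / n) := h0 ▸ hφ step.le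
  have hg0 : φ (-(1 / n)) ≤ 0 := h0 ▸ hφ (neg_nonpos.2 step.le)
  have key : ∀ (k : ℕ) (g v : ℝ), g ≤ M * φ (1 / n) → φ (1 / n) ≤ M * g →
      v ≤ k * (M ^ K * g) → k * g ≤ M ^ K * v → (k / n : ℝ) ≤ T * v ∧ v ≤ T * (k / n) := by
    intro k g v g1 g2 v1 v2
    have hL : 0 ≤ M ^ K := by linarith
    have hM0 : 0 ≤ M := by linarith
    constructor
    · calc (k / n : ℝ) ≤ k / n * (n * (M ^ K * φ (1 / n))) := le_mul_of_one_le_right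
            (by positivity) hn1.1
        _ = k * M ^ K * φ (1 / n) := by field_simp
        _ ≤ k * M ^ K * (M * g) := by gcongr
        _ = M ^ K * M * (k * g) := by ring
        _ ≤ M ^ K * M * (M ^ K * v) := by gcongr
        _ = T * v := by rw [hTe]; ring
    · calc v ≤ k * (M ^ K * g) := v1
        _ ≤ k * (M ^ K * (M * φ (1 / n))) := by gcongr
        _ = k / n * M ^ K * M * (n * φ (1 / n)) := by field_simp
        _ ≤ k / n * M ^ K * M * (M ^ K * 1) := mul_le_mul_of_nonneg_left hn1.2 (by positivity)
        _ = T * (k / n) := by rw [hTe]; ring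
  have hd1 : φ (1 / n) ≤ M * φ (1 / n) := le_mul_of_one_le_left hd0 hM1.le
  have hx : ∀ k : ℕ, k ≤ K → (k / n : ℝ) ≤ T * φ (k / n) ∧ φ (k / n) ≤ T * (k / n) := fun k hk =>
    key k _ _ hd1 hd1 (hp hk).1 (hp hk).2
  have hy : ∀ k : ℕ, k ≤ K → (k / n : ℝ) ≤ T * -φ (-(k / n)) ∧ -φ (-(k / n)) ≤ T * (k / n) :=
    fun k hk => key k _ _ hMB0.1 hMB0.2 (hm hk).1 (hm hk).2
  intro x
  rcases le_total 0 x with h | h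
  · exact abs_sub_le_of_grid hφ hε hT1 hT2 hn hn hTN hx h
  · have := abs_sub_le_of_grid (ψ := fun x => -φ (-x)) (fun u v huv =>
      neg_le_neg (hφ (neg_le_neg huv)))
      hε hT1 hT2 hn hn hTN hy (neg_nonneg.2 h)
    simp only [neg_neg, abs_neg] at this
    rwa [neg_sub_neg, abs_sub_comm] at this

/-! ### Affine renormalization and the uniform bound -/

section Affine

variable {Φ a ν : ℂ → ℂ} {μ : ℂ → ℝ} {φ : ℝ → ℝ}

lemma im_affine (s x : ℝ) (z : ℂ) : (s * z + x : ℂ).im = s * z.im := by simp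

lemma affine_mem_Hset {s : ℝ} (hs : 0 < s) (x : ℝ) {z : ℂ} (hz : z ∈ Hset) :
    (s * z + x : ℂ) ∈ Hset := by
  show 0 < (s * z + x : ℂ).im
  rw [im_affine]
  exact mul_pos hs hz

lemma MLData.affine (D : MLData Φ a ν μ) {s k : ℝ} (hs : 0 < s) (hk : 0 < k) (x c : ℝ) :
    MLData (fun z => k * Φ (s * z + x) + c) (fun z => k * s * a (s * z + x))
      (fun z => ν (s * z + x)) (fun z => μ (s * z + x)) := by
  have hg : ∀ z : ℂ, HasDerivAt (fun z : ℂ => s * z + x) s z := fun z => by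
    simpa using ((hasDerivAt_id z).const_mul (s : ℂ)).add_const (x : ℂ)
  have hs' : (s : ℂ) ≠ 0 := by exact_mod_cast hs.ne'
  have hk' : (k : ℂ) ≠ 0 := by exact_mod_cast hk.ne'
  have him : ∀ z : ℂ, (k * Φ (s * z + x) + c : ℂ).im = k * (Φ (s * z + x)).im := fun z => by simp
  have hmem := fun {z : ℂ} (hz : z ∈ Hset) => affine_mem_Hset hs x hz
  have hgc : ContDiffOn ℝ 2 (fun z : ℂ => (s * z + x : ℂ)) Hset :=
    ((contDiff_const.mul contDiff_id).add contDiff_const).contDiffOn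
  refine ⟨?_, fun q hq => D.mu_pos _ (hmem hq), fun q hq => D.mu_sq _ (hmem hq), ?_, ?_, ?_,
    D.contDiff_mu.comp hgc fun z hz => hmem hz, D.contDiff_nu.comp hgc fun z hz => hmem hz, ?_⟩
  · intro q hq
    rw [him]
    exact mul_pos hk (D.im_pos _ (hmem hq))
  · intro q hq
    rw [him, ← D.norm_a _ (hmem hq), im_affine]
    simp only [norm_mul, Complex.norm_real, Real.norm_eq_abs, abs_of_pos hs, abs_of_pos hk]
    ring
  · intro q hq
    refine (((HasW.comp_right (g := fun z : ℂ => s * z + x) (D.hasW_map _ (hmem hq))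
      (hg q)).const_mul (k : ℂ)).add (HasW.const (c : ℂ) q)).congr_coeff ?_ ?_
    · ring
    · rw [Complex.conj_ofReal]; ring
  · intro q hq
    have hq0 : (q.im : ℂ) ≠ 0 := by exact_mod_cast (ne_of_gt hq : q.im ≠ 0)
    have hY0 : ((Φ (s * q + x)).im : ℂ) ≠ 0 := by exact_mod_cast (D.im_pos _ (hmem hq)).ne'
    refine ((HasW.comp_right (g := fun z : ℂ => s * z + x) (D.hasW_a _ (hmem hq))
      (hg q)).const_mul (k * s : ℂ)).congr_coeff ?_ ?_
    · rw [him, im_affine]; push_cast; field_simp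
    · rw [him, Complex.conj_ofReal]; push_cast; field_simp
  · intro q hq
    have hq0 : (q.im : ℂ) ≠ 0 := by exact_mod_cast (ne_of_gt hq : q.im ≠ 0)
    have e1 := (HasW.comp_right (g := fun z : ℂ => s * z + x) (D.hasW_mu (hmem hq)) (hg q)).dzb_eq
    have e2 := (HasW.comp_right (g := fun z : ℂ => s * z + x) (D.hasW_nu (hmem hq)) (hg q)).dz_eq
    rw [e1, e2, dbarMu, Complex.conj_ofReal, im_affine]
    push_cast
    field_simp

lemma tendsto_affine_cobounded (r d : ℂ) (hr : r ≠ 0) :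
    Tendsto (fun z => r * z + d) (Bornology.cobounded ℂ) (Bornology.cobounded ℂ) := by
  have h1 : Tendsto (fun z : ℂ => r * z) (Bornology.cobounded ℂ) (Bornology.cobounded ℂ) :=
    tendsto_mul_left_cobounded hr
  rw [← tendsto_norm_atTop_iff_cobounded] at h1 ⊢
  refine tendsto_atTop_mono (fun z => ?_) (tendsto_atTop_add_const_right _ (-‖d‖) h1)
  have := norm_sub_norm_le (r * z) (-d)
  rw [norm_neg, sub_neg_eq_add] at this
  linarith

lemma BoundaryMap.affine (hB : BoundaryMap Φ φ) {s k : ℝ} (hs : 0 < s) (hk : 0 < k) (x c : ℝ) :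
    BoundaryMap (fun z => k * Φ (s * z + x) + c) (fun t => k * φ (s * t + x) + c) := by
  have hs' : (s : ℂ) ≠ 0 := by exact_mod_cast hs.ne'
  have hk' : (k : ℂ) ≠ 0 := by exact_mod_cast hk.ne'
  constructor
  · intro t
    have hg : Tendsto (fun z : ℂ => s * z + x) (𝓝[Hset] (t : ℂ))
        (𝓝[Hset] ((s * t + x : ℝ) : ℂ)) := by
      refine tendsto_nhdsWithin_iff.2 ⟨?_, ?_⟩
      · have : Continuous fun z : ℂ => (s * z + x : ℂ) := by fun_prop
        have h2 := (this.tendsto (t : ℂ)).mono_left (nhdsWithin_le_nhds (s := Hset))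
        push_cast
        exact h2
      · filter_upwards [self_mem_nhdsWithin] with z hz using affine_mem_Hset hs x hz
    have := (((hB.tendsto_real _).comp hg).const_mul (k : ℂ)).add_const (c : ℂ)
    push_cast
    exact this
  · refine (tendsto_affine_cobounded k c hk').comp (hB.tendsto_infty.comp (tendsto_inf.2 ⟨?_, ?_⟩))
    · exact (tendsto_affine_cobounded s x hs').mono_left inf_le_left
    · refine tendsto_principal.2 (eventually_inf_principal.2 (Eventually.of_forall fun z hz => ?_))
      exact affine_mem_Hset hs x hz

end Affine

/-- If the boundary map has small distortion, the minimal Lagrangian map is uniformly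
quasiconformal. -/
theorem exists_uniform_mu_le : ∃ M > 1, ∀ (Φ a ν : ℂ → ℂ) (μ : ℂ → ℝ) (φ : ℝ → ℝ),
    MLData Φ a ν μ → BoundaryMap Φ φ → Function.Injective φ → MidpointBound M φ →
    ∀ q ∈ Hset, μ q ≤ 3 := by
  obtain ⟨M, hM, h⟩ := exists_midpointBound_close (ε := 1 / 3000) (by norm_num)
  refine ⟨M, hM, fun Φ a ν μ φ D hB hinj hMB q hq => ?_⟩
  have hy : 0 < q.im := hq
  have hmono : StrictMono φ := (hB.monotone D).strictMono_of_injective hinj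
  have hd : 0 < φ (q.im + q.re) - φ q.re := sub_pos.2 (hmono (by linarith))
  set k := (φ (q.im + q.re) - φ q.re)⁻¹ with hk
  have hk0 : 0 < k := inv_pos.2 hd
  have D' := D.affine hy hk0 q.re (-(k * φ q.re))
  have hB' := hB.affine hy hk0 q.re (-(k * φ q.re))
  have h0 : k * φ (q.im * 0 + q.re) + -(k * φ q.re) = 0 := by simp
  have h1 : k * φ (q.im * 1 + q.re) + -(k * φ q.re) = 1 := by
    rw [mul_one, ← sub_eq_add_neg, ← mul_sub, hk, inv_mul_cancel₀ hd.ne']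
  have hMB' : MidpointBound M fun t => k * φ (q.im * t + q.re) + -(k * φ q.re) := by
    intro x t ht
    obtain ⟨m1, m2⟩ := hMB (q.im * x + q.re) (q.im * t) (mul_pos hy ht)
    have e1 : q.im * (x - t) + q.re = q.im * x + q.re - q.im * t := by ring
    have e2 : q.im * (x + t) + q.re = q.im * x + q.re + q.im * t := by ring
    simp only [e1, e2]
    have m1' := mul_le_mul_of_nonneg_left m1 hk0.le
    have m2' := mul_le_mul_of_nonneg_left m2 hk0.le
    constructor <;> linarith
  have := D'.mu_I_le hB' h0 h1 (h _ (hB'.monotone D') h0 h1 hMB')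
  have e : (q.im * Complex.I + q.re : ℂ) = q := by
    rw [add_comm]; exact Complex.re_add_im q
  rwa [e] at this

/-! ### Minimal Lagrangian maps and their Wirtinger form -/

/-- The pull-back of the hyperbolic metric by `Φ` is the one determined by the self-adjoint
Codazzi field `v ↦ m v + n v̄` of determinant one. -/
structure PullbackMetric (Φ : ℂ → ℂ) (m : ℂ → ℝ) (n : ℂ → ℂ) : Prop where
  contDiffOn : ContDiffOn ℝ (⊤ : ℕ∞) Φ Hset
  im_pos : ∀ q ∈ Hset, 0 < (Φ q).im
  sq_eq : ∀ q ∈ Hset, m q ^ 2 = 1 + ‖n q‖ ^ 2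
  norm_sq : ∀ q ∈ Hset,
    ‖dz Φ q‖ ^ 2 + ‖dzb Φ q‖ ^ 2 = ((Φ q).im / q.im) ^ 2 * (m q ^ 2 + ‖n q‖ ^ 2)
  mul_conj : ∀ q ∈ Hset,
    dz Φ q * conj (dzb Φ q) = (((Φ q).im / q.im) ^ 2 * m q : ℝ) * conj (n q)
  codazzi : ∀ q ∈ Hset,
    fderiv ℝ (fun u => Complex.I * (m u - n u)) q 1 - (m q - n q) / q.im
      = fderiv ℝ (fun u => (m u + n u : ℂ)) q Complex.I - (m q + n q) / q.im

lemma det_eq_of_real_linear (L : ℂ →ₗ[ℝ] ℂ) :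
    LinearMap.det L = (L 1).re * (L Complex.I).im - (L Complex.I).re * (L 1).im := by
  rw [← LinearMap.det_toMatrix Complex.basisOneI, Matrix.det_fin_two]
  simp [LinearMap.toMatrix_apply]

lemma exists_pullbackMetric {Φ : ℂ → ℂ} (h : IsMinimalLagrangian Φ) :
    ∃ m n, PullbackMetric Φ m n := by
  obtain ⟨hc, hbij, -, b, hself, hdet, hmet, hcod⟩ := h
  have hselfI : ∀ z ∈ Hset, (b z 1).im = (b z Complex.I).re := fun z hz => by
    simpa [rinner] using hself z hz 1 Complex.I
  have hdet' := fun z hz => (det_eq_of_real_linear (b z)).symm.trans (hdet z hz)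
  simp only [ContinuousLinearMap.coe_coe] at hdet'
  set m : ℂ → ℝ := fun z => ((b z 1).re + (b z Complex.I).im) / 2 with hm
  set n : ℂ → ℂ := fun z => (b z 1 + Complex.I * b z Complex.I) / 2 with hn
  have hpos : ∀ q ∈ Hset, 0 < (Φ q).im := fun q hq => hbij.mapsTo hq
  have h1 : ∀ z ∈ Hset, b z 1 = m z + n z := fun z hz => by
    have := hselfI z hz
    apply Complex.ext <;> simp [hm, hn] <;> linarith
  have hI : ∀ z ∈ Hset, b z Complex.I = Complex.I * (m z - n z) := fun z hz => by
    have := hselfI z hz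
    apply Complex.ext <;> simp [hm, hn] <;> linarith
  have hmet' : ∀ q ∈ Hset, ∀ v w : ℂ, rinner (fderiv ℝ Φ q v) (fderiv ℝ Φ q w)
      = ((Φ q).im / q.im) ^ 2 * rinner (b q v) (b q w) := fun q hq v w => by
    have e := hmet q hq v w
    have hY := (hpos q hq).ne'
    have hy : q.im ≠ 0 := ne_of_gt hq
    field_simp at e ⊢
    linarith
  refine ⟨m, n, hc, hpos, fun q hq => ?_, fun q hq => ?_, fun q hq => ?_, fun q hq => ?_⟩
  · have := hselfI q hq
    have h2 := hdet' q hq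
    simp only [← Complex.normSq_eq_norm_sq, Complex.normSq_apply, hm, hn, Complex.add_re,
      Complex.add_im, Complex.I_mul_re, Complex.I_mul_im, Complex.div_ofNat_re,
      Complex.div_ofNat_im]
    rw [this] at h2 ⊢
    nlinarith
  · have e1 := hmet' q hq 1 1
    have e2 := hmet' q hq Complex.I Complex.I
    rw [h1 q hq] at e1
    rw [hI q hq] at e2
    simp only [rinner, Complex.add_re, Complex.add_im, Complex.I_mul_re, Complex.I_mul_im,
      Complex.sub_re, Complex.sub_im, Complex.ofReal_re, Complex.ofReal_im] at e1 e2
    simp only [← Complex.normSq_eq_norm_sq, Complex.normSq_apply, dz, dzb, Complex.add_re,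
      Complex.add_im, Complex.I_mul_re, Complex.I_mul_im, Complex.div_ofNat_re,
      Complex.div_ofNat_im, Complex.sub_re, Complex.sub_im]
    linear_combination (e1 + e2) / 2
  · have e1 := hmet' q hq 1 1
    have e2 := hmet' q hq Complex.I Complex.I
    have e3 := hmet' q hq 1 Complex.I
    rw [h1 q hq] at e1 e3
    rw [hI q hq] at e2 e3
    simp only [rinner, Complex.add_re, Complex.add_im, Complex.I_mul_re, Complex.I_mul_im,
      Complex.sub_re, Complex.sub_im, Complex.ofReal_re, Complex.ofReal_im] at e1 e2 e3
    apply Complex.ext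
    · simp only [dz, dzb, Complex.mul_re, Complex.mul_im, Complex.conj_re, Complex.conj_im,
        Complex.add_re, Complex.add_im, Complex.div_ofNat_re,
        Complex.div_ofNat_im, Complex.sub_re, Complex.sub_im, Complex.ofReal_re,
        Complex.ofReal_im, Complex.I_re, Complex.I_im]
      linear_combination (e1 - e2) / 4
    · simp only [dz, dzb, Complex.mul_re, Complex.mul_im, Complex.conj_re, Complex.conj_im,
        Complex.add_re, Complex.add_im, Complex.div_ofNat_re,
        Complex.div_ofNat_im, Complex.sub_re, Complex.sub_im, Complex.ofReal_re,
        Complex.ofReal_im, Complex.I_re, Complex.I_im]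
      linear_combination -e3 / 2
  · have e := hcod q hq 1 Complex.I
    have hy : (q.im : ℂ) ≠ 0 := by exact_mod_cast (ne_of_gt hq : q.im ≠ 0)
    have c1 : fderiv ℝ (fun u => b u Complex.I) q
        = fderiv ℝ (fun u => Complex.I * (m u - n u)) q := by
      refine Filter.EventuallyEq.fderiv_eq ?_
      filter_upwards [isOpen_Hset.mem_nhds hq] with z hz using hI z hz
    have c2 : fderiv ℝ (fun u => b u 1) q = fderiv ℝ (fun u => (m u + n u : ℂ)) q := by
      refine Filter.EventuallyEq.fderiv_eq ?_
      filter_upwards [isOpen_Hset.mem_nhds hq] with z hz using h1 z hz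
    rw [c1, c2, h1 q hq, hI q hq, show Gamma q Complex.I 1 = Gamma q 1 Complex.I by
      simp [Gamma]] at e
    have e' := sub_left_inj.1 e
    simp only [Gamma] at e'
    have hII := Complex.I_mul_I
    linear_combination e' + (n q - m q + m q + n q) / (q.im : ℂ) * hII

namespace PullbackMetric

variable {Φ : ℂ → ℂ} {m : ℂ → ℝ} {n : ℂ → ℂ}

lemma hasW (P : PullbackMetric Φ m n) {q : ℂ} (hq : q ∈ Hset) : HasW Φ (dz Φ q) (dzb Φ q) q :=
  hasW_of_differentiableAt
    ((P.contDiffOn.contDiffAt (isOpen_Hset.mem_nhds hq)).differentiableAt (by simp))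

/-- Post-composition with a holomorphic isometry of the upper half-plane. -/
lemma comp_isometry (P : PullbackMetric Φ m n) {h h' : ℂ → ℂ}
    (hh : ∀ w ∈ Hset, HasDerivAt h (h' w) w) (hc : ContDiffOn ℝ (⊤ : ℕ∞) h Hset)
    (him : ∀ w ∈ Hset, (h w).im = ‖h' w‖ * w.im) (h0 : ∀ w ∈ Hset, h' w ≠ 0) :
    PullbackMetric (fun z => h (Φ z)) m n := by
  have hW : ∀ q ∈ Hset, HasW (fun z => h (Φ z)) (h' (Φ q) * dz Φ q) (h' (Φ q) * dzb Φ q) q :=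
    fun q hq => HasW.comp_hasDerivAt (hh _ (P.im_pos q hq)) (P.hasW hq)
  refine ⟨hc.comp P.contDiffOn P.im_pos, fun q hq => ?_, P.sq_eq, fun q hq => ?_, fun q hq => ?_,
    P.codazzi⟩
  · rw [him _ (P.im_pos q hq)]
    exact mul_pos (norm_pos_iff.2 (h0 _ (P.im_pos q hq))) (P.im_pos q hq)
  · rw [(hW q hq).dz_eq, (hW q hq).dzb_eq, him _ (P.im_pos q hq), norm_mul, norm_mul]
    linear_combination ‖h' (Φ q)‖ ^ 2 * P.norm_sq q hq
  · rw [(hW q hq).dz_eq, (hW q hq).dzb_eq, him _ (P.im_pos q hq), map_mul]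
    have e := P.mul_conj q hq
    have e2 := Complex.mul_conj' (h' (Φ q))
    push_cast at e ⊢
    linear_combination (h' (Φ q) * conj (h' (Φ q))) * e
      + ((Φ q).im / q.im : ℂ) ^ 2 * m q * conj (n q) * e2

/-- Post-composition with the reflection `w ↦ -w̄`. -/
lemma neg_conj (P : PullbackMetric Φ m n) : PullbackMetric (fun z => -conj (Φ z)) m n := by
  have hW : ∀ q ∈ Hset, HasW (fun z => -conj (Φ z)) (-conj (dzb Φ q)) (-conj (dz Φ q)) q :=
    fun q hq => (P.hasW hq).star.neg
  refine ⟨(Complex.conjCLE.contDiff.comp_contDiffOn P.contDiffOn).neg, fun q hq => ?_, P.sq_eq,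
    fun q hq => ?_, fun q hq => ?_, P.codazzi⟩
  · simpa using P.im_pos q hq
  · rw [(hW q hq).dz_eq, (hW q hq).dzb_eq]
    have := P.norm_sq q hq
    simp only [norm_neg, RCLike.norm_conj, Complex.neg_im, Complex.conj_im, neg_neg]
    linarith
  · rw [(hW q hq).dz_eq, (hW q hq).dzb_eq]
    have := P.mul_conj q hq
    simp only [map_neg, Complex.conj_conj, Complex.neg_im, Complex.conj_im, neg_neg]
    linear_combination this

lemma norm_lt (P : PullbackMetric Φ m n) {q : ℂ} (hq : q ∈ Hset) : ‖n q‖ < |m q| := by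
  refine abs_lt_of_sq_lt_sq ?_ (abs_nonneg _) |> (abs_lt.1 · |>.2)
  rw [sq_abs, P.sq_eq q hq]
  linarith

lemma norm_mul_norm (P : PullbackMetric Φ m n) {q : ℂ} (hq : q ∈ Hset) :
    ‖dz Φ q‖ * ‖dzb Φ q‖ = ((Φ q).im / q.im) ^ 2 * (|m q| * ‖n q‖) := by
  have := congrArg norm (P.mul_conj q hq)
  rw [norm_mul, norm_mul, RCLike.norm_conj, RCLike.norm_conj, Complex.norm_real, norm_mul,
    Real.norm_eq_abs, Real.norm_eq_abs, abs_of_nonneg (sq_nonneg ((Φ q).im / q.im))] at this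
  linarith

lemma norm_add (P : PullbackMetric Φ m n) {q : ℂ} (hq : q ∈ Hset) :
    ‖dz Φ q‖ + ‖dzb Φ q‖ = (Φ q).im / q.im * (|m q| + ‖n q‖) := by
  have hr : 0 < (Φ q).im / q.im := div_pos (P.im_pos q hq) hq
  refine (pow_left_inj₀ (by positivity) (by positivity) two_ne_zero).1 ?_
  have := sq_abs (m q)
  linear_combination P.norm_sq q hq + 2 * P.norm_mul_norm hq - ((Φ q).im / q.im) ^ 2 * this

lemma abs_norm_sub (P : PullbackMetric Φ m n) {q : ℂ} (hq : q ∈ Hset) :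
    |‖dz Φ q‖ - ‖dzb Φ q‖| = (Φ q).im / q.im * (|m q| - ‖n q‖) := by
  have hr : 0 < (Φ q).im / q.im := div_pos (P.im_pos q hq) hq
  have hn := P.norm_lt hq
  refine (pow_left_inj₀ (abs_nonneg _) (mul_nonneg hr.le (by linarith)) two_ne_zero).1 ?_
  have := sq_abs (m q)
  rw [sq_abs]
  linear_combination P.norm_sq q hq - 2 * P.norm_mul_norm hq - ((Φ q).im / q.im) ^ 2 * this

lemma contDiffOn_fderiv_apply (P : PullbackMetric Φ m n) (v : ℂ) :
    ContDiffOn ℝ (⊤ : ℕ∞) (fun q => fderiv ℝ Φ q v) Hset :=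
  (P.contDiffOn.fderiv_of_isOpen isOpen_Hset (m := (⊤ : ℕ∞)) (by simp)).clm_apply
    contDiffOn_const

lemma contDiffOn_dz (P : PullbackMetric Φ m n) : ContDiffOn ℝ (⊤ : ℕ∞) (dz Φ) Hset :=
  ((P.contDiffOn_fderiv_apply 1).sub
    (contDiffOn_const.mul (P.contDiffOn_fderiv_apply Complex.I))).div_const 2

lemma contDiffOn_dzb (P : PullbackMetric Φ m n) : ContDiffOn ℝ (⊤ : ℕ∞) (dzb Φ) Hset :=
  ((P.contDiffOn_fderiv_apply 1).add
    (contDiffOn_const.mul (P.contDiffOn_fderiv_apply Complex.I))).div_const 2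

/-- Up to a reflection, the map preserves the orientation. -/
lemma orientation (P : PullbackMetric Φ m n) :
    (∀ q ∈ Hset, ‖dzb Φ q‖ < ‖dz Φ q‖) ∨ ∀ q ∈ Hset, ‖dz Φ q‖ < ‖dzb Φ q‖ := by
  have hc : ContinuousOn (fun q => ‖dz Φ q‖ - ‖dzb Φ q‖) Hset :=
    P.contDiffOn_dz.continuousOn.norm.sub P.contDiffOn_dzb.continuousOn.norm
  have h0 : ∀ q ∈ Hset, ‖dz Φ q‖ - ‖dzb Φ q‖ ≠ 0 := fun q hq => by
    rw [← abs_pos, P.abs_norm_sub hq]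
    exact mul_pos (div_pos (P.im_pos q hq) hq) (sub_pos.2 (P.norm_lt hq))
  by_contra! hcon
  obtain ⟨⟨q₁, h₁, k₁⟩, q₂, h₂, k₂⟩ := hcon
  obtain ⟨q, hq, hq0⟩ := convex_Hset.isPreconnected.intermediate_value h₁ h₂ hc
    (show (0 : ℝ) ∈ Icc _ _ from ⟨by linarith, by linarith⟩)
  exact h0 q hq hq0

end PullbackMetric

lemma ContinuousAt.eventually_eq_of_sq_eq_one {X : Type*} [TopologicalSpace X] {e : X → ℂ} {q : X}
    (hc : ContinuousAt e q) (he : ∀ᶠ z in 𝓝 q, e z ^ 2 = 1) : ∀ᶠ z in 𝓝 q, e z = e q := by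
  have h1 : ∀ᶠ z in 𝓝 q, dist (e z) (e q) < 2 := hc.eventually (Metric.ball_mem_nhds _ two_pos)
  filter_upwards [h1, he] with z hz hz2
  rcases sq_eq_sq_iff_eq_or_eq_neg.1 (hz2.trans he.self_of_nhds.symm) with h | h
  · exact h
  · have h2 : ‖e q‖ = 1 := by
      have := congrArg norm he.self_of_nhds
      rw [norm_pow, norm_one] at this
      exact (pow_eq_one_iff_of_nonneg (norm_nonneg _) two_ne_zero).1 this
    rw [h, dist_eq_norm, ← neg_add', norm_neg, ← two_mul, norm_mul, h2, Complex.norm_ofNat] at hz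
    norm_num at hz

/-- The Codazzi equation, in Wirtinger form. -/
lemma codazzi_of_eventuallyEq {m μ : ℂ → ℝ} {n ν : ℂ → ℂ} {e q M M' p r : ℂ} (he : e ≠ 0)
    (hm : ∀ᶠ z in 𝓝 q, (m z : ℂ) = e * μ z) (hn : ∀ᶠ z in 𝓝 q, n z = e * ν z)
    (hμ : HasW (fun z => (μ z : ℂ)) M M' q) (hν : HasW ν p r q)
    (h : fderiv ℝ (fun u => Complex.I * (m u - n u)) q 1 - (m q - n q) / q.im
      = fderiv ℝ (fun u => (m u + n u : ℂ)) q Complex.I - (m q + n q) / q.im) :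
    M' = p + Complex.I / q.im * ν q := by
  have h1 := (((hμ.sub hν).const_mul e).const_mul Complex.I).congr_of_eventuallyEq
    (v := fun u => Complex.I * (m u - n u)) (by
      filter_upwards [hm, hn] with z h1 h2
      rw [h1, h2]
      ring)
  have h2 := ((hμ.add hν).const_mul e).congr_of_eventuallyEq (v := fun u => (m u + n u : ℂ)) (by
      filter_upwards [hm, hn] with z h1 h2
      rw [h1, h2]
      ring)
  rw [HasFDerivAt.fderiv h1, HasFDerivAt.fderiv h2, hm.self_of_nhds, hn.self_of_nhds,
    wirtinger_apply, wirtinger_apply, map_one, Complex.conj_I] at h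
  have hI : Complex.I ≠ 0 := Complex.I_ne_zero
  have hII := Complex.I_mul_I
  refine mul_left_cancel₀ (mul_ne_zero (mul_ne_zero two_ne_zero hI) he) ?_
  linear_combination h - 2 * e * ν q / q.im * hII

namespace PullbackMetric

variable {Φ : ℂ → ℂ} {m : ℂ → ℝ} {n : ℂ → ℂ}

lemma codazzi_of_smooth (P : PullbackMetric Φ m n) {μ : ℂ → ℝ} {ν : ℂ → ℂ}
    (hμc : ContDiffOn ℝ 2 μ Hset) (hνc : ContDiffOn ℝ 2 ν Hset) (hμ : ∀ q ∈ Hset, μ q = |m q|)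
    (hν : ∀ q ∈ Hset, μ q * ν q = m q * n q) {q : ℂ} (hq : q ∈ Hset) :
    dzb (fun z => (μ z : ℂ)) q = dz ν q + Complex.I / q.im * ν q := by
  have hnhds := fun {z : ℂ} (hz : z ∈ Hset) => isOpen_Hset.mem_nhds hz
  have hμC : ContDiffOn ℝ 2 (fun z => (μ z : ℂ)) Hset :=
    Complex.ofRealCLM.contDiff.comp_contDiffOn hμc
  have hm0 : ∀ z ∈ Hset, 0 < |m z| := fun z hz => (norm_nonneg _).trans_lt (P.norm_lt hz)
  have hμ0 : ∀ z ∈ Hset, (μ z : ℂ) ≠ 0 := fun z hz => by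
    rw [hμ z hz]; exact_mod_cast (hm0 z hz).ne'
  set e : ℂ → ℂ := fun z => m z / μ z with he
  have he2 : ∀ z ∈ Hset, e z ^ 2 = 1 := fun z hz => by
    rw [he, div_pow, div_eq_one_iff_eq (pow_ne_zero 2 (hμ0 z hz)), hμ z hz]
    exact_mod_cast (sq_abs (m z)).symm
  have hem : ∀ z ∈ Hset, (m z : ℂ) = e z * μ z := fun z hz => (div_mul_cancel₀ _ (hμ0 z hz)).symm
  have hen : ∀ z ∈ Hset, n z = e z * ν z := fun z hz => by
    refine mul_left_cancel₀ (hμ0 z hz) ?_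
    have h1 := hν z hz
    rw [hem z hz] at h1
    linear_combination -(n z * μ z) * he2 z hz - e z * h1
  have hνμ : ∀ z ∈ Hset, ‖ν z‖ < μ z := fun z hz => by
    have h1 := congrArg norm (hν z hz)
    rw [norm_mul, norm_mul, Complex.norm_real, Complex.norm_real, Real.norm_eq_abs,
      Real.norm_eq_abs, hμ z hz, abs_abs] at h1
    rw [mul_left_cancel₀ (hm0 z hz).ne' h1, hμ z hz]
    exact P.norm_lt hz
  have hne : ∀ z ∈ Hset, ∀ s : ℂ, ‖s‖ = 1 → (μ z + s * ν z : ℂ) ≠ 0 := fun z hz s hs h => by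
    have := congrArg norm (eq_neg_of_add_eq_zero_left h)
    rw [norm_neg, norm_mul, hs, one_mul, Complex.norm_real, Real.norm_eq_abs] at this
    linarith [hνμ z hz, le_abs_self (μ z)]
  have hWμ := fun {z : ℂ} (hz : z ∈ Hset) => hasW_of_differentiableAt
    ((hμC.contDiffAt (hnhds hz)).differentiableAt (by norm_num))
  have hWν := fun {z : ℂ} (hz : z ∈ Hset) => hasW_of_differentiableAt
    ((hνc.contDiffAt (hnhds hz)).differentiableAt (by norm_num))
  have hloc : ∀ z ∈ Hset, ContinuousAt e z →
      dzb (fun z => (μ z : ℂ)) z = dz ν z + Complex.I / z.im * ν z := fun z hz hcont => by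
    have h1 := ContinuousAt.eventually_eq_of_sq_eq_one hcont
      (by filter_upwards [hnhds hz] with w hw using he2 w hw)
    refine codazzi_of_eventuallyEq (e := e z) (fun h0 => ?_) ?_ ?_ (hWμ hz) (hWν hz)
      (P.codazzi z hz)
    · have := he2 z hz
      rw [h0] at this
      norm_num at this
    · filter_upwards [h1, hnhds hz] with w hw hw2
      rw [← hw]
      exact hem w hw2
    · filter_upwards [h1, hnhds hz] with w hw hw2
      rw [← hw]
      exact hen w hw2
  have hcont : ∀ z ∈ Hset, ∀ s : ℂ, ‖s‖ = 1 → ContinuousAt (fun u => (m u + s * n u : ℂ)) z →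
      ContinuousAt e z := fun z hz s hs h => by
    have h1 : ContinuousAt (fun u => (m u + s * n u : ℂ) / (μ u + s * ν u)) z :=
      h.div ((hμC.contDiffAt (hnhds hz)).continuousAt.add
        (continuousAt_const.mul (hνc.contDiffAt (hnhds hz)).continuousAt)) (hne z hz s hs)
    refine h1.congr ?_
    filter_upwards [hnhds hz] with w hw
    rw [div_eq_iff (hne w hw s hs), hem w hw, hen w hw]
    ring
  have hzero : ∀ z ∈ Hset,
      dzb (fun z => (μ z : ℂ)) z ≠ dz ν z + Complex.I / z.im * ν z → ν z = 0 := by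
    intro z hz hC
    have hnc : ¬ ContinuousAt e z := fun h => hC (hloc z hz h)
    have d1 : fderiv ℝ (fun u => Complex.I * (m u - n u)) z = 0 := by
      refine fderiv_zero_of_not_differentiableAt fun hd => hnc (hcont z hz (-1) (by simp) ?_)
      refine (hd.continuousAt.const_mul (-Complex.I)).congr (Eventually.of_forall fun u => ?_)
      linear_combination (n u - m u) * Complex.I_mul_I
    have d2 : fderiv ℝ (fun u => (m u + n u : ℂ)) z = 0 := by
      refine fderiv_zero_of_not_differentiableAt fun hd => hnc (hcont z hz 1 (by simp) ?_)
      simpa using hd.continuousAt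
    have h := P.codazzi z hz
    have hy : (z.im : ℂ) ≠ 0 := by exact_mod_cast (ne_of_gt hz : z.im ≠ 0)
    rw [d1, d2] at h
    simp only [zero_apply, zero_sub, neg_inj] at h
    rw [div_left_inj' hy] at h
    have hn : n z = 0 := by linear_combination -h / 2
    have h1 := hν z hz
    rw [hn, mul_zero] at h1
    exact (mul_eq_zero.1 h1).resolve_left (hμ0 z hz)
  have hcC : ContinuousOn (fun z => dzb (fun z => (μ z : ℂ)) z
      - (dz ν z + Complex.I / z.im * ν z)) Hset := by
    have hf : ∀ {u : ℂ → ℂ}, ContDiffOn ℝ 2 u Hset → ∀ v : ℂ,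
        ContinuousOn (fun z => fderiv ℝ u z v) Hset := fun hu v =>
      (hu.continuousOn_fderiv_of_isOpen isOpen_Hset (by norm_num)).clm_apply continuousOn_const
    have hi : ContinuousOn (fun z : ℂ => Complex.I / (z.im : ℂ)) Hset :=
      continuousOn_const.div (by fun_prop) fun z hz => by
        exact_mod_cast (ne_of_gt hz : z.im ≠ 0)
    exact (((hf hμC 1).add (continuousOn_const.mul (hf hμC Complex.I))).div_const 2).sub
      ((((hf hνc 1).sub (continuousOn_const.mul (hf hνc Complex.I))).div_const 2).add
        (hi.mul hνc.continuousOn))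
  by_contra hC
  have hev : ∀ᶠ z in 𝓝 q, ν z = 0 := by
    filter_upwards [hnhds hq, (hcC.continuousAt (hnhds hq)).eventually_ne (sub_ne_zero.2 hC)]
      with z hz h using hzero z hz (sub_ne_zero.1 h)
  have hev1 : ∀ᶠ z in 𝓝 q, (μ z : ℂ) = 1 := by
    filter_upwards [hev, hnhds hq] with z h hz
    have hn : n z = 0 := by rw [hen z hz, h, mul_zero]
    have hm := P.sq_eq z hz
    rw [hn, norm_zero] at hm
    have h1 : |m z| = 1 := by
      rw [← pow_eq_one_iff_of_nonneg (abs_nonneg _) two_ne_zero, sq_abs, hm]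
      norm_num
    rw [hμ z hz, h1, Complex.ofReal_one]
  refine hC ?_
  rw [((HasW.const 1 q).congr_of_eventuallyEq hev1).dzb_eq,
    ((HasW.const 0 q).congr_of_eventuallyEq hev).dz_eq, hev.self_of_nhds]
  simp

end PullbackMetric

lemma two_le_smooth : (2 : WithTop ℕ∞) ≤ ((⊤ : ℕ∞) : WithTop ℕ∞) :=
  WithTop.coe_le_coe.2 le_top

/-- The derivatives of the parallel isometry `a` are determined by its length and by the equality
of mixed partial derivatives. -/
lemma parallel_derivs_unique {μ : ℝ} {ν a α β α₀ β₀ : ℂ} (ha : a ≠ 0) (hν : ‖ν‖ < μ)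
    (h1 : β * μ - α * ν = β₀ * μ - α₀ * ν)
    (h2 : α * conj a + a * conj β = α₀ * conj a + a * conj β₀) : α = α₀ ∧ β = β₀ := by
  have hμ : 0 < μ := (norm_nonneg _).trans_lt hν
  have e1 : (β - β₀) * μ = (α - α₀) * ν := by linear_combination h1
  have e2 : (α - α₀) * conj a = -(a * conj (β - β₀)) := by
    rw [map_sub]; linear_combination h2
  have n1 := congrArg norm e1
  have n2 := congrArg norm e2
  rw [norm_neg, norm_mul, norm_mul, RCLike.norm_conj, RCLike.norm_conj, mul_comm] at n2
  have n3 := mul_left_cancel₀ (norm_ne_zero_iff.2 ha) n2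
  rw [norm_mul, norm_mul, Complex.norm_real, Real.norm_eq_abs, abs_of_pos hμ, n3] at n1
  have n4 : ‖β - β₀‖ = 0 := by
    by_contra h
    exact hν.ne' (mul_left_cancel₀ h n1)
  exact ⟨sub_eq_zero.1 (norm_eq_zero.1 (n3.trans n4)), sub_eq_zero.1 (norm_eq_zero.1 n4)⟩

namespace PullbackMetric

variable {Φ : ℂ → ℂ} {m : ℂ → ℝ} {n : ℂ → ℂ}

lemma exists_mlData (P : PullbackMetric Φ m n) (ho : ∀ q ∈ Hset, ‖dzb Φ q‖ < ‖dz Φ q‖) :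
    ∃ a ν μ, MLData Φ a ν μ ∧ ∀ q ∈ Hset, μ q = |m q| ∧ ‖ν q‖ = ‖n q‖ := by
  have hnhds := fun {z : ℂ} (hz : z ∈ Hset) => isOpen_Hset.mem_nhds hz
  have hA0 : ∀ q ∈ Hset, dz Φ q ≠ 0 := fun q hq =>
    norm_pos_iff.1 ((norm_nonneg _).trans_lt (ho q hq))
  have hsub : ∀ q ∈ Hset, ‖dz Φ q‖ - ‖dzb Φ q‖ = (Φ q).im / q.im * (|m q| - ‖n q‖) :=
    fun q hq => by rw [← P.abs_norm_sub hq, abs_of_pos (sub_pos.2 (ho q hq))]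
  have hA : ∀ q ∈ Hset, ‖dz Φ q‖ = (Φ q).im / q.im * |m q| := fun q hq => by
    linear_combination (P.norm_add hq + hsub q hq) / 2
  have hB : ∀ q ∈ Hset, ‖dzb Φ q‖ = (Φ q).im / q.im * ‖n q‖ := fun q hq => by
    linear_combination (P.norm_add hq - hsub q hq) / 2
  have hy : ∀ q ∈ Hset, q.im ≠ 0 := fun q hq => ne_of_gt hq
  have hY : ∀ q ∈ Hset, (Φ q).im ≠ 0 := fun q hq => (P.im_pos q hq).ne'
  set μ : ℂ → ℝ := fun q => ‖dz Φ q‖ * q.im / (Φ q).im with hμdef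
  set a : ℂ → ℂ := fun q => ((Φ q).im / (q.im * ‖dz Φ q‖) : ℝ) * dz Φ q with hadef
  set ν : ℂ → ℂ := fun q => dzb Φ q / a q with hνdef
  have hμ : ∀ q ∈ Hset, μ q = |m q| := fun q hq => by
    have h1 := hy q hq
    have h2 := hY q hq
    rw [hμdef]
    simp only [hA q hq]
    field_simp
  have hnA : ∀ q ∈ Hset, ‖dz Φ q‖ ≠ 0 := fun q hq => norm_ne_zero_iff.2 (hA0 q hq)
  have hna : ∀ q ∈ Hset, ‖a q‖ = (Φ q).im / q.im := fun q hq => by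
    have h1 := hy q hq
    have h2 := hnA q hq
    have h3 : 0 ≤ (Φ q).im / (q.im * ‖dz Φ q‖) :=
      div_nonneg (P.im_pos q hq).le (mul_nonneg (le_of_lt hq) (norm_nonneg _))
    rw [hadef, norm_mul, Complex.norm_real, Real.norm_eq_abs, abs_of_nonneg h3]
    field_simp
  have ha0 : ∀ q ∈ Hset, a q ≠ 0 := fun q hq => by
    rw [← norm_ne_zero_iff, hna q hq]
    exact div_ne_zero (hY q hq) (hy q hq)
  have haμ : ∀ q ∈ Hset, a q * μ q = dz Φ q := fun q hq => by
    have h1 : (q.im : ℂ) ≠ 0 := by exact_mod_cast hy q hq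
    have h2 : (‖dz Φ q‖ : ℂ) ≠ 0 := by exact_mod_cast hnA q hq
    have h3 : ((Φ q).im : ℂ) ≠ 0 := by exact_mod_cast hY q hq
    rw [hadef, hμdef]
    push_cast
    field_simp
  have haν : ∀ q ∈ Hset, a q * ν q = dzb Φ q := fun q hq => mul_div_cancel₀ _ (ha0 q hq)
  have hν : ∀ q ∈ Hset, ‖ν q‖ = ‖n q‖ := fun q hq => by
    have := hna q hq
    rw [hνdef, norm_div, hB q hq, this, mul_div_cancel_left₀ _ (div_ne_zero (hY q hq) (hy q hq))]
  have hm0 : ∀ z ∈ Hset, 0 < |m z| := fun z hz => (norm_nonneg _).trans_lt (P.norm_lt hz)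
  have hμν : ∀ q ∈ Hset, (μ q * ν q : ℂ) = m q * n q := fun q hq => by
    have e := congrArg conj (P.mul_conj q hq)
    rw [← haμ q hq, ← haν q hq, ← hna q hq] at e
    simp only [map_mul, Complex.conj_conj, Complex.conj_ofReal] at e
    push_cast at e
    rw [← Complex.mul_conj'] at e
    have hc : conj (a q) ≠ 0 := (map_ne_zero _).2 (ha0 q hq)
    refine mul_left_cancel₀ (mul_ne_zero (ha0 q hq) hc) ?_
    linear_combination e
  have hYc : ContDiffOn ℝ 2 (fun q => (Φ q).im) Hset :=
    (Complex.imCLM.contDiff.comp_contDiffOn P.contDiffOn).of_le two_le_smooth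
  have hyc : ContDiffOn ℝ 2 (fun q : ℂ => q.im) Hset := Complex.imCLM.contDiff.contDiffOn
  have hAc : ContDiffOn ℝ 2 (dz Φ) Hset := P.contDiffOn_dz.of_le two_le_smooth
  have hBc : ContDiffOn ℝ 2 (dzb Φ) Hset := P.contDiffOn_dzb.of_le two_le_smooth
  have hAn : ContDiffOn ℝ 2 (fun q => ‖dz Φ q‖) Hset := hAc.norm ℝ hA0
  have hμc : ContDiffOn ℝ 2 μ Hset := (hAn.mul hyc).div hYc hY
  have hac : ContDiffOn ℝ 2 a Hset := (Complex.ofRealCLM.contDiff.comp_contDiffOn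
    (hYc.div (hyc.mul hAn) fun q hq => mul_ne_zero (hy q hq) (hnA q hq))).mul hAc
  have hνc : ContDiffOn ℝ 2 ν Hset :=
    (hBc.mul (hac.inv ha0)).congr fun q _ => div_eq_mul_inv _ _
  have hcod : ∀ q ∈ Hset, dzb (fun z => (μ z : ℂ)) q = dz ν q + Complex.I / q.im * ν q :=
    fun q hq => P.codazzi_of_smooth hμc hνc hμ hμν hq
  have hνμ : ∀ z ∈ Hset, ‖ν z‖ < μ z := fun z hz => by
    rw [hμ z hz, hν z hz]; exact P.norm_lt hz
  refine ⟨a, ν, μ, ⟨P.im_pos, fun q hq => ?_, fun q hq => ?_, fun q hq => ?_, fun q hq => ?_,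
    fun q hq => ?_, hμc, hνc, hcod⟩, fun q hq => ⟨hμ q hq, hν q hq⟩⟩
  · rw [hμ q hq]; exact hm0 q hq
  · rw [hμ q hq, hν q hq, sq_abs]; exact P.sq_eq q hq
  · rw [hna q hq, div_mul_cancel₀ _ (hy q hq)]
  · rw [haμ q hq, haν q hq]; exact P.hasW hq
  · have hWa := hasW_of_differentiableAt
      ((hac.contDiffAt (hnhds hq)).differentiableAt (by norm_num))
    have hWν := hasW_of_differentiableAt
      ((hνc.contDiffAt (hnhds hq)).differentiableAt (by norm_num))
    have hWμ : HasW (fun z => (μ z : ℂ)) (dz (fun z => (μ z : ℂ)) q)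
        (dzb (fun z => (μ z : ℂ)) q) q :=
      hasW_of_differentiableAt ((
        (Complex.ofRealCLM.contDiff.comp_contDiffOn hμc).contDiffAt (hnhds hq)).differentiableAt
          (by norm_num))
    have hWΦ := P.hasW hq
    obtain ⟨A, S, B, hz, hzb⟩ := exists_hasW_dz
      ((P.contDiffOn.contDiffAt (hnhds hq)).of_le two_le_smooth)
    have e1 := (hz.unique ((hWa.mul hWμ).congr_of_eventuallyEq (by
      filter_upwards [hnhds hq] with z hz using (haμ z hz).symm))).2
    have e2 := (hzb.unique ((hWa.mul hWν).congr_of_eventuallyEq (by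
      filter_upwards [hnhds hq] with z hz using (haν z hz).symm))).1
    have hlen := ((((hWa.mul hWa.star).mul ((HasW.im q).mul (HasW.im q))).congr_of_eventuallyEq
      (v := fun z => (((Φ z).im : ℝ) : ℂ) * ((Φ z).im : ℝ)) (by
        filter_upwards [hnhds hq] with z hz
        have hz' : (z.im : ℂ) ≠ 0 := by exact_mod_cast hy z hz
        rw [Complex.mul_conj', hna z hz]
        push_cast
        field_simp)).unique (hWΦ.ofReal_im.mul hWΦ.ofReal_im)).1
    have hy' : (q.im : ℂ) ≠ 0 := by exact_mod_cast hy q hq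
    have hY' : ((Φ q).im : ℂ) ≠ 0 := by exact_mod_cast hY q hq
    have haa : a q * conj (a q) * q.im ^ 2 = (Φ q).im ^ 2 := by
      rw [Complex.mul_conj', hna q hq]
      push_cast
      field_simp
    have hC := hcod q hq
    have h1 : dzb a q * μ q - dz a q * ν q = -(Complex.I / (Φ q).im * a q ^ 2 * ν q) * μ q
        - (a q * (Complex.I / q.im) - Complex.I / (Φ q).im * a q ^ 2 * μ q) * ν q := by
      linear_combination e2 - e1 - a q * hC
    have h2 : dz a q * conj (a q) + a q * conj (dzb a q)
        = (a q * (Complex.I / q.im) - Complex.I / (Φ q).im * a q ^ 2 * μ q) * conj (a q)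
          + a q * conj (-(Complex.I / (Φ q).im * a q ^ 2 * ν q)) := by
      rw [← haμ q hq, ← haν q hq] at hlen
      simp only [map_mul, map_neg, map_div₀, map_pow, Complex.conj_I, Complex.conj_ofReal] at hlen ⊢
      refine mul_left_cancel₀ (pow_ne_zero 2 hy') ?_
      have e3 : Complex.I / (Φ q).im * (Φ q).im ^ 2 = Complex.I * (Φ q).im := by field_simp
      have e4 : Complex.I / q.im * q.im ^ 2 = Complex.I * q.im := by field_simp
      linear_combination hlen - a q * conj (a q) * e4
        + Complex.I / (Φ q).im * (a q * μ q - conj (a q) * conj (ν q)) * haa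
        + (a q * μ q - conj (a q) * conj (ν q)) * e3
    obtain ⟨h3, h4⟩ := parallel_derivs_unique (ha0 q hq) (hνμ q hq) h1 h2
    exact hWa.congr_coeff h3 h4

end PullbackMetric

/-! ### The boundary at infinity -/

/-- The finite point of `ℝP¹` with affine coordinate `x`. -/
def finitePt (x : ℝ) : RP1 :=
  Projectivization.mk ℝ ![x, 1] fun h => one_ne_zero (congrFun h 1)

/-- The point at infinity of `ℝP¹`. -/
def inftyPt : RP1 :=
  Projectivization.mk ℝ ![1, 0] fun h => one_ne_zero (congrFun h 0)

lemma eq_mk_of_smul {ξ : RP1} {v : Fin 2 → ℝ} (hv : v ≠ 0) {t : ℝ} (ht : t • v = ξ.rep) :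
    ξ = Projectivization.mk ℝ v hv := by
  rw [← ξ.mk_rep]
  exact (Projectivization.mk_eq_mk_iff' ℝ _ _ ξ.rep_nonzero hv).2 ⟨t, ht⟩

lemma eq_inftyPt {ξ : RP1} (h : ξ.rep 1 = 0) : ξ = inftyPt := by
  refine eq_mk_of_smul _ (t := ξ.rep 0) ?_
  ext i
  fin_cases i <;> simp [h]

lemma eq_finitePt {ξ : RP1} (h : ξ.rep 1 ≠ 0) : ξ = finitePt (ξ.rep 0 / ξ.rep 1) := by
  refine eq_mk_of_smul _ (t := ξ.rep 1) ?_
  ext i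
  fin_cases i <;> simp [mul_div_cancel₀, h]

lemma exists_rep_finitePt (x : ℝ) : ∃ t : ℝ, t ≠ 0 ∧ (finitePt x).rep = t • ![x, 1] := by
  obtain ⟨t, ht⟩ := Projectivization.exists_smul_eq_mk_rep ℝ (![x, 1] : Fin 2 → ℝ)
    fun h => one_ne_zero (congrFun h 1)
  exact ⟨t, t.ne_zero, ht.symm⟩

lemma exists_rep_inftyPt : ∃ t : ℝ, t ≠ 0 ∧ inftyPt.rep = t • ![1, 0] := by
  obtain ⟨t, ht⟩ := Projectivization.exists_smul_eq_mk_rep ℝ (![1, 0] : Fin 2 → ℝ)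
    fun h => one_ne_zero (congrFun h 0)
  exact ⟨t, t.ne_zero, ht.symm⟩

lemma finitePt_ne_inftyPt (x : ℝ) : finitePt x ≠ inftyPt := by
  obtain ⟨t, ht, h⟩ := exists_rep_finitePt x
  obtain ⟨s, hs, h'⟩ := exists_rep_inftyPt
  intro e
  rw [e, h'] at h
  have := congrFun h 1
  simp at this
  exact ht this.symm

lemma finitePt_injective : Function.Injective finitePt := by
  intro x y e
  obtain ⟨t, ht, h⟩ := exists_rep_finitePt x
  obtain ⟨s, hs, h'⟩ := exists_rep_finitePt y
  rw [e, h'] at h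
  have h0 := congrFun h 0
  have h1 := congrFun h 1
  simp at h0 h1
  rw [h1] at h0
  exact (mul_left_cancel₀ ht h0).symm

lemma eq_of_det2_eq_zero {ξ η : RP1} (h : det2 ξ.rep η.rep = 0) : ξ = η := by
  rw [det2] at h
  by_cases h1 : ξ.rep 1 = 0
  · have h2 : ξ.rep 0 ≠ 0 := fun h2 => ξ.rep_nonzero (by ext i; fin_cases i <;> simp [h1, h2])
    rw [h1, zero_mul, sub_zero] at h
    rw [eq_inftyPt h1, eq_inftyPt ((mul_eq_zero.1 h).resolve_left h2)]
  · by_cases h3 : η.rep 1 = 0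
    · rw [h3, mul_zero, zero_sub, neg_eq_zero] at h
      exact absurd (by ext i; fin_cases i <;> simp [h3, (mul_eq_zero.1 h).resolve_left h1])
        η.rep_nonzero
    · rw [eq_finitePt h1, eq_finitePt h3]
      congr 1
      field_simp
      linarith

lemma rp1ToSphere_finitePt (x : ℝ) : rp1ToSphere (finitePt x) = ((x : ℂ) : OnePoint ℂ) := by
  obtain ⟨t, ht, h⟩ := exists_rep_finitePt x
  have h1 : (finitePt x).rep 1 = t := by simp [h]
  have h0 : (finitePt x).rep 0 = t * x := by simp [h]
  rw [rp1ToSphere, if_neg (by rwa [h1]), h1, h0, mul_div_cancel_left₀ _ ht]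

lemma rp1ToSphere_inftyPt : rp1ToSphere inftyPt = OnePoint.infty := by
  obtain ⟨t, ht, h⟩ := exists_rep_inftyPt
  rw [rp1ToSphere, if_pos (by simp [h])]

lemma tendsto_sphere_infty {l : Filter ℂ} {Φ : ℂ → ℂ} {ξ : RP1} (hξ : ξ.rep 1 = 0) :
    Tendsto (fun z => OnePoint.some (Φ z)) l (𝓝 (rp1ToSphere ξ)) ↔
      Tendsto Φ l (Bornology.cobounded ℂ) := by
  rw [rp1ToSphere, if_pos hξ, Metric.cobounded_eq_cocompact, ← coclosedCompact_eq_cocompact,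
    ← OnePoint.comap_coe_nhds_infty, tendsto_comap_iff]
  rfl

lemma tendsto_sphere_coe {l : Filter ℂ} {Φ : ℂ → ℂ} {ξ : RP1} (hξ : ξ.rep 1 ≠ 0) :
    Tendsto (fun z => OnePoint.some (Φ z)) l (𝓝 (rp1ToSphere ξ)) ↔
      Tendsto Φ l (𝓝 ((ξ.rep 0 / ξ.rep 1 : ℝ) : ℂ)) := by
  rw [rp1ToSphere, if_neg hξ]
  exact OnePoint.isOpenEmbedding_coe.isInducing.tendsto_nhds_iff.symm

lemma ExtendsToBoundary.finitePt {Φ : ℂ → ℂ} {φ : RP1 → RP1} (h : ExtendsToBoundary Φ φ) (x : ℝ) :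
    Tendsto (fun z => OnePoint.some (Φ z)) (𝓝[Hset] (x : ℂ))
      (𝓝 (rp1ToSphere (φ (finitePt x)))) := by
  have := h (AdSPaper.finitePt x)
  rwa [rp1ToSphere_finitePt, OnePoint.comap_coe_nhds] at this

lemma ExtendsToBoundary.inftyPt {Φ : ℂ → ℂ} {φ : RP1 → RP1} (h : ExtendsToBoundary Φ φ) :
    Tendsto (fun z => OnePoint.some (Φ z)) (Bornology.cobounded ℂ ⊓ 𝓟 Hset)
      (𝓝 (rp1ToSphere (φ inftyPt))) := by
  have := h AdSPaper.inftyPt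
  rwa [rp1ToSphere_inftyPt, OnePoint.comap_coe_nhds_infty, coclosedCompact_eq_cocompact,
    ← Metric.cobounded_eq_cocompact] at this

/-- The rotation of the upper half-plane taking the boundary point `[c]` to infinity. -/
def rotate (c : Fin 2 → ℝ) (w : ℂ) : ℂ := (c 0 * w + c 1) / (c 0 - c 1 * w)

section Rotate

variable {c : Fin 2 → ℝ}

lemma sq_add_sq_pos (hc : c ≠ 0) : 0 < c 0 ^ 2 + c 1 ^ 2 := by
  by_contra! h
  have h0 : c 0 = 0 := by nlinarith [sq_nonneg (c 0), sq_nonneg (c 1)]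
  have h1 : c 1 = 0 := by nlinarith [sq_nonneg (c 0), sq_nonneg (c 1)]
  exact hc (by ext i; fin_cases i <;> simp [h0, h1])

lemma rotate_denom_ne_zero (hc : c ≠ 0) {w : ℂ} (hw : w ∈ Hset) : (c 0 - c 1 * w : ℂ) ≠ 0 := by
  intro h
  have h1 := congrArg Complex.im h
  have h0 := congrArg Complex.re h
  simp only [Complex.sub_im, Complex.ofReal_im, Complex.mul_im, Complex.ofReal_re, zero_mul,
    add_zero, zero_sub, Complex.zero_im, neg_eq_zero, mul_eq_zero] at h1
  have h1 := h1.resolve_right (ne_of_gt hw)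
  simp [h1] at h0
  exact hc (by ext i; fin_cases i <;> simp [h0, h1])

lemma hasDerivAt_rotate (hc : c ≠ 0) {w : ℂ} (hw : w ∈ Hset) :
    HasDerivAt (rotate c) ((c 0 ^ 2 + c 1 ^ 2) / (c 0 - c 1 * w) ^ 2) w := by
  have h1 : HasDerivAt (fun w : ℂ => c 0 * w + c 1) (c 0 : ℂ) w := by
    simpa using ((hasDerivAt_id w).const_mul (c 0 : ℂ)).add_const (c 1 : ℂ)
  have h2 : HasDerivAt (fun w : ℂ => c 0 - c 1 * w) (-c 1 : ℂ) w := by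
    simpa using ((hasDerivAt_id w).const_mul (c 1 : ℂ)).const_sub (c 0 : ℂ)
  refine (h1.div h2 (rotate_denom_ne_zero hc hw)).congr_deriv ?_
  congr 1
  ring

lemma contDiffOn_rotate (hc : c ≠ 0) : ContDiffOn ℝ (⊤ : ℕ∞) (rotate c) Hset := by
  have h1 : ContDiff ℝ (⊤ : ℕ∞) (fun w : ℂ => (c 0 * w + c 1 : ℂ)) := by fun_prop
  have h2 : ContDiff ℝ (⊤ : ℕ∞) (fun w : ℂ => (c 0 - c 1 * w : ℂ)) := by fun_prop
  exact (h1.contDiffOn.mul (h2.contDiffOn.inv fun w hw => rotate_denom_ne_zero hc hw)).congr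
    fun q _ => div_eq_mul_inv _ _

lemma rotate_im (hc : c ≠ 0) {w : ℂ} (hw : w ∈ Hset) :
    (rotate c w).im = ‖((c 0 ^ 2 + c 1 ^ 2) / (c 0 - c 1 * w) ^ 2 : ℂ)‖ * w.im := by
  have h1 := Complex.normSq_pos.2 (rotate_denom_ne_zero hc hw)
  have h2 : ‖(c 0 ^ 2 + c 1 ^ 2 : ℂ)‖ = c 0 ^ 2 + c 1 ^ 2 := by
    have := Complex.norm_of_nonneg (sq_add_sq_pos hc).le
    push_cast at this
    exact this
  rw [norm_div, norm_pow, h2, ← Complex.normSq_eq_norm_sq, rotate, Complex.div_im]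
  field_simp
  simp
  ring

lemma rotate_eq (h1 : c 1 ≠ 0) {w : ℂ} (hw : w ∈ Hset) :
    rotate c w = (c 0 ^ 2 + c 1 ^ 2) / c 1 * (c 0 - c 1 * w)⁻¹ + -(c 0 / c 1) := by
  have h2 := rotate_denom_ne_zero (fun h => h1 (congrFun h 1)) hw
  have h3 : (c 1 : ℂ) ≠ 0 := by exact_mod_cast h1
  rw [rotate, ← div_eq_mul_inv, ← sub_eq_add_neg, div_div, div_sub_div _ _ (mul_ne_zero h3 h2) h3,
    div_eq_div_iff h2 (mul_ne_zero (mul_ne_zero h3 h2) h3)]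
  ring

lemma tendsto_rotate {l : Filter ℂ} {Φ : ℂ → ℂ} {c : Fin 2 → ℝ} {ξ : RP1}
    (hl : ∀ᶠ z in l, Φ z ∈ Hset) (hd : c 0 * ξ.rep 1 - c 1 * ξ.rep 0 ≠ 0)
    (h : Tendsto (fun z => OnePoint.some (Φ z)) l (𝓝 (rp1ToSphere ξ))) :
    Tendsto (fun z => rotate c (Φ z)) l
      (𝓝 (((c 0 * ξ.rep 0 + c 1 * ξ.rep 1) / (c 0 * ξ.rep 1 - c 1 * ξ.rep 0) : ℝ) : ℂ)) := by
  by_cases hξ : ξ.rep 1 = 0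
  · rw [tendsto_sphere_infty hξ] at h
    rw [hξ, mul_zero, zero_sub, neg_ne_zero] at hd
    have h1 : c 1 ≠ 0 := left_ne_zero_of_mul hd
    have h2 : ξ.rep 0 ≠ 0 := right_ne_zero_of_mul hd
    have h3 : (c 1 : ℂ) ≠ 0 := by exact_mod_cast h1
    have h4 := ((tendsto_inv₀_cobounded.comp ((tendsto_affine_cobounded (-c 1) (c 0)
      (neg_ne_zero.2 h3)).comp h)).const_mul ((c 0 ^ 2 + c 1 ^ 2) / c 1 : ℂ)).add_const
        (-(c 0 / c 1) : ℂ)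
    have h5 : (((c 0 * ξ.rep 0 + c 1 * ξ.rep 1) / (c 0 * ξ.rep 1 - c 1 * ξ.rep 0) : ℝ) : ℂ)
        = (c 0 ^ 2 + c 1 ^ 2) / c 1 * 0 + -(c 0 / c 1) := by
      have h6 : (ξ.rep 0 : ℂ) ≠ 0 := by exact_mod_cast h2
      rw [hξ]
      push_cast
      field_simp
      ring
    rw [h5]
    refine h4.congr' ?_
    filter_upwards [hl] with z hz
    rw [rotate_eq h1 hz]
    simp only [Function.comp]
    ring_nf
  · rw [tendsto_sphere_coe hξ] at h
    have h3 : (ξ.rep 1 : ℂ) ≠ 0 := by exact_mod_cast hξ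
    have hd' : (c 0 * ξ.rep 1 - c 1 * ξ.rep 0 : ℂ) ≠ 0 := by exact_mod_cast hd
    have h5 : (c 0 - c 1 * (ξ.rep 0 / ξ.rep 1 : ℝ) : ℂ) ≠ 0 := fun h0 => hd' (by
      push_cast at h0
      field_simp at h0
      linear_combination h0)
    have h4 := ((h.const_mul (c 0 : ℂ)).add_const (c 1 : ℂ)).div
      ((h.const_mul (c 1 : ℂ)).const_sub (c 0 : ℂ)) h5
    have h6 : (((c 0 * ξ.rep 0 + c 1 * ξ.rep 1) / (c 0 * ξ.rep 1 - c 1 * ξ.rep 0) : ℝ) : ℂ)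
        = (c 0 * (ξ.rep 0 / ξ.rep 1 : ℝ) + c 1) / (c 0 - c 1 * (ξ.rep 0 / ξ.rep 1 : ℝ)) := by
      push_cast at h5 ⊢
      rw [div_eq_div_iff hd' h5]
      field_simp
    rw [h6]
    exact h4

lemma tendsto_rotate_cobounded {l : Filter ℂ} {Φ : ℂ → ℂ} {ξ : RP1}
    (hl : ∀ᶠ z in l, Φ z ∈ Hset)
    (h : Tendsto (fun z => OnePoint.some (Φ z)) l (𝓝 (rp1ToSphere ξ))) :
    Tendsto (fun z => rotate ξ.rep (Φ z)) l (Bornology.cobounded ℂ) := by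
  by_cases hξ : ξ.rep 1 = 0
  · rw [tendsto_sphere_infty hξ] at h
    have h2 : (ξ.rep 0 : ℂ) ≠ 0 := fun h2 => ξ.rep_nonzero (by
      ext i; fin_cases i <;> simp [hξ, Complex.ofReal_eq_zero.1 h2])
    refine h.congr fun z => ?_
    rw [rotate, hξ]
    simp [h2]
  · rw [tendsto_sphere_coe hξ] at h
    have h3 : (ξ.rep 1 : ℂ) ≠ 0 := by exact_mod_cast hξ
    have hD : ((ξ.rep 0 ^ 2 + ξ.rep 1 ^ 2) / ξ.rep 1 : ℂ) ≠ 0 :=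
      div_ne_zero (by exact_mod_cast (sq_add_sq_pos ξ.rep_nonzero).ne') h3
    have h4 : Tendsto (fun z => (ξ.rep 0 - ξ.rep 1 * Φ z : ℂ)) l (𝓝[≠] 0) := by
      refine tendsto_nhdsWithin_iff.2 ⟨?_, ?_⟩
      · convert (h.const_mul (ξ.rep 1 : ℂ)).const_sub (ξ.rep 0 : ℂ) using 2
        push_cast
        field_simp
        ring
      · filter_upwards [hl] with z hz using rotate_denom_ne_zero ξ.rep_nonzero hz
    refine ((tendsto_affine_cobounded _ (-(ξ.rep 0 / ξ.rep 1)) hD).comp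
      (tendsto_inv₀_nhdsNE_zero.comp h4)).congr' ?_
    filter_upwards [hl] with z hz
    rw [rotate_eq hξ hz]
    rfl

end Rotate

/-! ### Normalization at infinity -/

lemma exists_unit_wirtinger (A B : ℂ) :
    ∃ v : ℂ, ‖v‖ = 1 ∧ ‖A * v + B * conj v‖ = ‖A‖ + ‖B‖ ∧
      ‖A * (Complex.I * v) + B * conj (Complex.I * v)‖ = |‖A‖ - ‖B‖| := by
  set θ : ℝ := (B.arg - A.arg) / 2 with hθ
  set u : ℂ := Complex.exp (((A.arg + B.arg) / 2 : ℝ) * Complex.I) with hu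
  have hu1 : ‖u‖ = 1 := Complex.norm_exp_ofReal_mul_I _
  have hA : A * Complex.exp (θ * Complex.I) = ‖A‖ * u := by
    rw [hu]
    conv_lhs => rw [← Complex.norm_mul_exp_arg_mul_I A, mul_assoc, ← Complex.exp_add]
    congr 2
    rw [hθ]
    push_cast
    ring
  have hB : B * conj (Complex.exp (θ * Complex.I)) = ‖B‖ * u := by
    rw [hu, ← Complex.exp_conj]
    conv_lhs => rw [← Complex.norm_mul_exp_arg_mul_I B, mul_assoc, ← Complex.exp_add]
    congr 2
    simp only [map_mul, Complex.conj_ofReal, Complex.conj_I]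
    rw [hθ]
    push_cast
    ring
  refine ⟨Complex.exp (θ * Complex.I), Complex.norm_exp_ofReal_mul_I _, ?_, ?_⟩
  · rw [hA, hB, ← add_mul, norm_mul, hu1, mul_one, ← Complex.ofReal_add,
      Complex.norm_of_nonneg (by positivity)]
  · have : A * (Complex.I * Complex.exp (θ * Complex.I))
        + B * conj (Complex.I * Complex.exp (θ * Complex.I))
        = Complex.I * (((‖A‖ - ‖B‖ : ℝ) : ℂ) * u) := by
      rw [map_mul, Complex.conj_I]
      push_cast
      linear_combination Complex.I * hA - Complex.I * hB
    rw [this, norm_mul, norm_mul, hu1, Complex.norm_I, one_mul, mul_one, Complex.norm_real,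
      Real.norm_eq_abs]

lemma PullbackMetric.dilatationAt_eq {Φ : ℂ → ℂ} {m : ℂ → ℝ} {n : ℂ → ℂ}
    (P : PullbackMetric Φ m n) {q : ℂ} (hq : q ∈ Hset) :
    dilatationAt Φ q = (|m q| + ‖n q‖) ^ 2 := by
  have hf : ∀ v, fderiv ℝ Φ q v = dz Φ q * v + dzb Φ q * conj v := fun v => by
    rw [fderiv_eq_wirtinger]; simp [wirtinger]
  obtain ⟨v, hv, h1, h2⟩ := exists_unit_wirtinger (dz Φ q) (dzb Φ q)
  have hIv : ‖Complex.I * v‖ = 1 := by simp [hv]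
  have hsup : (⨆ v : {v : ℂ // ‖v‖ = 1}, ‖fderiv ℝ Φ q (v : ℂ)‖) = ‖dz Φ q‖ + ‖dzb Φ q‖ := by
    have : Nonempty {v : ℂ // ‖v‖ = 1} := ⟨⟨v, hv⟩⟩
    have hle : ∀ w : {v : ℂ // ‖v‖ = 1}, ‖fderiv ℝ Φ q (w : ℂ)‖ ≤ ‖dz Φ q‖ + ‖dzb Φ q‖ := by
      intro w
      rw [hf]
      refine (norm_add_le _ _).trans_eq ?_
      rw [norm_mul, norm_mul, RCLike.norm_conj, w.2, mul_one, mul_one]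
    refine le_antisymm (ciSup_le hle) ?_
    rw [← h1, ← hf]
    exact le_ciSup (f := fun w : {v : ℂ // ‖v‖ = 1} => ‖fderiv ℝ Φ q (w : ℂ)‖)
      ⟨_, by rintro _ ⟨w, rfl⟩; exact hle w⟩ ⟨v, hv⟩
  have hinf : (⨅ v : {v : ℂ // ‖v‖ = 1}, ‖fderiv ℝ Φ q (v : ℂ)‖)
      = |‖dz Φ q‖ - ‖dzb Φ q‖| := by
    have : Nonempty {v : ℂ // ‖v‖ = 1} := ⟨⟨v, hv⟩⟩
    have hle : ∀ w : {v : ℂ // ‖v‖ = 1}, |‖dz Φ q‖ - ‖dzb Φ q‖| ≤ ‖fderiv ℝ Φ q (w : ℂ)‖ := by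
      intro w
      rw [hf]
      have := abs_norm_sub_norm_le (dz Φ q * w) (-(dzb Φ q * conj (w : ℂ)))
      rwa [norm_neg, norm_mul, norm_mul, RCLike.norm_conj, w.2, mul_one, mul_one,
        sub_neg_eq_add] at this
    refine le_antisymm ?_ (le_ciInf hle)
    rw [← h2, ← hf]
    exact ciInf_le (f := fun w : {v : ℂ // ‖v‖ = 1} => ‖fderiv ℝ Φ q (w : ℂ)‖)
      ⟨_, by rintro _ ⟨w, rfl⟩; exact hle w⟩ ⟨Complex.I * v, hIv⟩
  have hr : 0 < (Φ q).im / q.im := div_pos (P.im_pos q hq) hq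
  have hlt := P.norm_lt hq
  have hsq := P.sq_eq q hq
  rw [← sq_abs] at hsq
  rw [dilatationAt, hsup, hinf, P.norm_add hq, P.abs_norm_sub hq, mul_div_mul_left _ _ hr.ne',
    div_eq_iff (by linarith)]
  linear_combination -(|m q| + ‖n q‖) * hsq

/-- A lift to `ℝ²` of the image of a point of `ℝP¹` under the extension of `f` fixing the point
at infinity. -/
def boundaryLift (f : ℝ → ℝ) (ξ : RP1) : Fin 2 → ℝ :=
  if ξ.rep 1 = 0 then ![1, 0] else ![f (ξ.rep 0 / ξ.rep 1), 1]

lemma boundaryLift_finitePt (f : ℝ → ℝ) (x : ℝ) : boundaryLift f (finitePt x) = ![f x, 1] := by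
  obtain ⟨t, ht, h⟩ := exists_rep_finitePt x
  have h1 : (finitePt x).rep 1 = t := by simp [h]
  have h0 : (finitePt x).rep 0 = t * x := by simp [h]
  rw [boundaryLift, if_neg (by rwa [h1]), h1, h0, mul_div_cancel_left₀ _ ht]

lemma boundaryLift_inftyPt (f : ℝ → ℝ) : boundaryLift f inftyPt = ![1, 0] := by
  obtain ⟨t, -, h⟩ := exists_rep_inftyPt
  rw [boundaryLift, if_pos (by simp [h])]

/-- The map `f` of the real line is, up to a projective transformation of the target, the
circle map `φ`. -/
def LiftsTo (f : ℝ → ℝ) (φ : RP1 → RP1) : Prop :=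
  ∃ k ≠ (0 : ℝ), ∃ s : RP1 → ℝ, (∀ ξ, s ξ ≠ 0) ∧ ∀ ξ η,
    det2 (boundaryLift f ξ) (boundaryLift f η) = k * s ξ * s η * det2 (φ ξ).rep (φ η).rep

lemma LiftsTo.injective {f : ℝ → ℝ} {φ : RP1 → RP1} (h : LiftsTo f φ)
    (hφ : Function.Injective φ) : Function.Injective f := by
  obtain ⟨k, hk, s, hs, h⟩ := h
  intro x y hxy
  have h1 := h (finitePt x) (finitePt y)
  rw [boundaryLift_finitePt, boundaryLift_finitePt, hxy] at h1
  have h2 : det2 ![f y, 1] ![f y, 1] = 0 := by simp [det2]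
  rw [h2] at h1
  exact finitePt_injective (hφ (eq_of_det2_eq_zero
    ((mul_eq_zero.1 h1.symm).resolve_left (mul_ne_zero (mul_ne_zero hk (hs _)) (hs _)))))

lemma LiftsTo.neg {f : ℝ → ℝ} {φ : RP1 → RP1} (h : LiftsTo f φ) : LiftsTo (fun x => -f x) φ := by
  obtain ⟨k, hk, s, hs, h⟩ := h
  refine ⟨-k, neg_ne_zero.2 hk, fun ξ => if ξ.rep 1 = 0 then -s ξ else s ξ, fun ξ => ?_,
    fun ξ η => ?_⟩
  · beta_reduce
    split_ifs
    · exact neg_ne_zero.2 (hs ξ)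
    · exact hs ξ
  · have := h ξ η
    simp only [boundaryLift, det2] at this ⊢
    split_ifs at this ⊢ <;>
      simp only [Matrix.cons_val_zero, Matrix.cons_val_one] at this ⊢ <;> linarith

/-- The cross-ratio of the lines spanned by four vectors of the plane. -/
def vecCrossRatio (v₁ v₂ v₃ v₄ : Fin 2 → ℝ) : ℝ :=
  (det2 v₄ v₁ * det2 v₃ v₂) / (det2 v₂ v₁ * det2 v₃ v₄)

lemma LiftsTo.crossRatio_eq {f : ℝ → ℝ} {φ : RP1 → RP1} (h : LiftsTo f φ) (z₁ z₂ z₃ z₄ : RP1) :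
    crossRatio (φ z₁) (φ z₂) (φ z₃) (φ z₄)
      = vecCrossRatio (boundaryLift f z₁) (boundaryLift f z₂) (boundaryLift f z₃)
        (boundaryLift f z₄) := by
  obtain ⟨k, hk, s, hs, h⟩ := h
  rw [crossRatio, vecCrossRatio, h, h, h, h,
    ← mul_div_mul_left _ _ (mul_ne_zero (mul_ne_zero (mul_ne_zero hk hk)
    (mul_ne_zero (hs z₁) (hs z₂))) (mul_ne_zero (hs z₃) (hs z₄)))]
  congr 1 <;> ring

lemma BoundaryMap.neg_conj {Φ : ℂ → ℂ} {f : ℝ → ℝ} (h : BoundaryMap Φ f) :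
    BoundaryMap (fun z => -conj (Φ z)) (fun x => -f x) := by
  refine ⟨fun x => ?_, ?_⟩
  · have := ((Complex.continuous_conj.tendsto _).comp (h.tendsto_real x)).neg
    simpa using this
  · have := h.tendsto_infty
    rw [← tendsto_norm_atTop_iff_cobounded] at this ⊢
    simpa using this

/-- The affine coordinate, in the chart sending `[c]` to infinity, of the image of a real
number. -/
def rotateBoundary (c : Fin 2 → ℝ) (φ : RP1 → RP1) (x : ℝ) : ℝ :=
  (c 0 * (φ (finitePt x)).rep 0 + c 1 * (φ (finitePt x)).rep 1)
    / (c 0 * (φ (finitePt x)).rep 1 - c 1 * (φ (finitePt x)).rep 0)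

section Normalize

variable {φ : RP1 → RP1}

lemma rotateBoundary_denom_ne_zero (hφ : Function.Injective φ) (x : ℝ) :
    (φ inftyPt).rep 0 * (φ (finitePt x)).rep 1 - (φ inftyPt).rep 1 * (φ (finitePt x)).rep 0 ≠ 0 :=
  fun h => finitePt_ne_inftyPt x (hφ (eq_of_det2_eq_zero h)).symm

lemma liftsTo_rotateBoundary (hφ : Function.Injective φ) :
    LiftsTo (rotateBoundary (φ inftyPt).rep φ) φ := by
  set c := (φ inftyPt).rep with hc
  have hpos := sq_add_sq_pos (φ inftyPt).rep_nonzero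
  refine ⟨c 0 ^ 2 + c 1 ^ 2, hpos.ne', fun ξ => if ξ.rep 1 = 0 then (c 0 ^ 2 + c 1 ^ 2)⁻¹ else
    (c 0 * (φ ξ).rep 1 - c 1 * (φ ξ).rep 0)⁻¹, fun ξ => ?_, fun ξ η => ?_⟩
  · beta_reduce
    split_ifs with h
    · exact inv_ne_zero hpos.ne'
    · refine inv_ne_zero ?_
      rw [eq_finitePt h]
      exact rotateBoundary_denom_ne_zero hφ _
  · have key : ∀ ξ : RP1, boundaryLift (rotateBoundary c φ) ξ
        = (if ξ.rep 1 = 0 then (c 0 ^ 2 + c 1 ^ 2)⁻¹ else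
          (c 0 * (φ ξ).rep 1 - c 1 * (φ ξ).rep 0)⁻¹) •
          ![c 0 * (φ ξ).rep 0 + c 1 * (φ ξ).rep 1, c 0 * (φ ξ).rep 1 - c 1 * (φ ξ).rep 0] := by
      intro ξ
      by_cases h : ξ.rep 1 = 0
      · rw [boundaryLift, if_pos h, if_pos h, eq_inftyPt h, ← hc]
        ext i
        fin_cases i
        · simp [← sq]
          exact (inv_mul_cancel₀ hpos.ne').symm
        · simp [mul_comm]
      · rw [boundaryLift, if_neg h, if_neg h, rotateBoundary, ← eq_finitePt h]
        have hd := rotateBoundary_denom_ne_zero hφ (ξ.rep 0 / ξ.rep 1)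
        rw [← eq_finitePt h, ← hc] at hd
        ext i
        fin_cases i
        · simp [div_eq_inv_mul]
        · simp [inv_mul_cancel₀ hd]
    rw [key, key]
    simp only [det2, Pi.smul_apply, smul_eq_mul, Matrix.cons_val_zero, Matrix.cons_val_one]
    ring

lemma boundaryMap_rotate {Φ : ℂ → ℂ} (hΦ : ∀ z ∈ Hset, Φ z ∈ Hset) (hφ : Function.Injective φ)
    (h : ExtendsToBoundary Φ φ) :
    BoundaryMap (fun z => rotate (φ inftyPt).rep (Φ z))
      (rotateBoundary (φ inftyPt).rep φ) := by
  refine ⟨fun x => ?_, ?_⟩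
  · exact tendsto_rotate (eventually_mem_nhdsWithin.mono hΦ)
      (rotateBoundary_denom_ne_zero hφ x) (h.finitePt x)
  · refine tendsto_rotate_cobounded ?_ h.inftyPt
    exact mem_of_superset (mem_inf_of_right (mem_principal_self Hset)) hΦ

/-- Up to an isometry of the target, a minimal Lagrangian extension fixes the point at infinity
and preserves the orientation. -/
lemma exists_normalized {Φ : ℂ → ℂ} (hφ : Function.Injective φ)
    (h : IsMinimalLagrangianExtension Φ φ) :
    ∃ F a ν μ f, MLData F a ν μ ∧ BoundaryMap F f ∧ LiftsTo f φ ∧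
      ∀ z ∈ Hset, dilatationAt Φ z = (μ z + ‖ν z‖) ^ 2 := by
  obtain ⟨m, n, P⟩ := exists_pullbackMetric h.1
  have hc := (φ inftyPt).rep_nonzero
  have P' := P.comp_isometry (fun w hw => hasDerivAt_rotate hc hw) (contDiffOn_rotate hc)
    (fun w hw => rotate_im hc hw)
    (fun w hw => div_ne_zero (by exact_mod_cast (sq_add_sq_pos hc).ne')
      (pow_ne_zero 2 (rotate_denom_ne_zero hc hw)))
  have hB := boundaryMap_rotate P.im_pos hφ h.2
  have hL := liftsTo_rotateBoundary hφ
  have fin : ∀ F f, PullbackMetric F m n → (∀ q ∈ Hset, ‖dzb F q‖ < ‖dz F q‖) →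
      BoundaryMap F f → LiftsTo f φ → ∃ F a ν μ f, MLData F a ν μ ∧ BoundaryMap F f ∧
        LiftsTo f φ ∧ ∀ z ∈ Hset, dilatationAt Φ z = (μ z + ‖ν z‖) ^ 2 := by
    intro F f PF ho hB hL
    obtain ⟨a, ν, μ, D, hD⟩ := PF.exists_mlData ho
    refine ⟨F, a, ν, μ, f, D, hB, hL, fun z hz => ?_⟩
    rw [P.dilatationAt_eq hz, (hD z hz).1, (hD z hz).2]
  rcases P'.orientation with ho | ho
  · exact fin _ _ P' ho hB hL
  · refine fin _ _ P'.neg_conj (fun q hq => ?_) hB.neg_conj hL.neg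
    have hW := (P'.hasW hq).star.neg
    rw [hW.dz_eq, hW.dzb_eq, norm_neg, norm_neg, RCLike.norm_conj, RCLike.norm_conj]
    exact ho q hq

end Normalize

/-! ### Distortion of cross-ratios -/

section Distortion

variable {F a ν : ℂ → ℂ} {μ : ℂ → ℝ} {f : ℝ → ℝ} {t : ℝ}

lemma MLData.coneAdmissible_of_norm_lt (D : MLData F a ν μ) (ht : ∀ q ∈ Hset, ‖ν q‖ < t)
    {e : ℝ} (he : e ^ 2 = 1) : MLData.ConeAdmissible ν μ (t + e * Complex.I) := by
  intro q hq v hv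
  have ht0 : 0 < t := (norm_nonneg _).trans_lt (ht q hq)
  have hv0 : 0 < ‖v‖ ^ 2 := by positivity
  have hsq := D.mu_sq q hq
  have hμ := D.mu_pos q hq
  have h1 : ((t + e * Complex.I : ℂ) * conj (μ q * v + ν q * conj v) * v).re
      = t * μ q * ‖v‖ ^ 2 + ((t + e * Complex.I : ℂ) * (conj (ν q) * v ^ 2)).re := by
    simp only [← Complex.normSq_eq_norm_sq, Complex.normSq_apply]
    simp only [map_add, map_mul, Complex.conj_ofReal, Complex.conj_conj, sq, Complex.mul_re,
      Complex.mul_im, Complex.add_re,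
      Complex.add_im, Complex.ofReal_re, Complex.ofReal_im, Complex.I_re, Complex.I_im,
      Complex.conj_re, Complex.conj_im]
    ring
  have h2 : ‖(t + e * Complex.I : ℂ) * (conj (ν q) * v ^ 2)‖ ^ 2
      = (t ^ 2 + 1) * ‖ν q‖ ^ 2 * (‖v‖ ^ 2) ^ 2 := by
    rw [norm_mul, norm_mul, RCLike.norm_conj, norm_pow, mul_pow, mul_pow,
      ← Complex.normSq_eq_norm_sq, Complex.normSq_add_mul_I, he]
    ring
  have h3 : ‖(t + e * Complex.I : ℂ) * (conj (ν q) * v ^ 2)‖ < t * μ q * ‖v‖ ^ 2 := by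
    refine (pow_lt_pow_iff_left₀ (norm_nonneg _) (by positivity) two_ne_zero).1 ?_
    rw [h2, mul_pow, mul_pow, hsq]
    refine mul_lt_mul_of_pos_right ?_ (by positivity)
    have := pow_lt_pow_left₀ (ht q hq) (norm_nonneg _) two_ne_zero
    nlinarith
  rw [h1]
  have := (abs_le.1 (Complex.abs_re_le_norm ((t + e * Complex.I : ℂ) * (conj (ν q) * v ^ 2)))).1
  linarith

lemma MLData.cone_boundaryLift (D : MLData F a ν μ) (hB : BoundaryMap F f) {κ : ℂ}
    (hκ : MLData.ConeAdmissible ν μ κ) {p : ℂ} (hp : p ∈ Hset) (ξ : RP1) :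
    0 ≤ (conj κ * (conj (a p) * (ξ.rep 0 - ξ.rep 1 * conj p) ^ 2
      * (boundaryLift f ξ 0 - boundaryLift f ξ 1 * F p) ^ 2)).re := by
  by_cases h : ξ.rep 1 = 0
  · have := mul_nonneg (sq_nonneg (ξ.rep 0)) (D.cone_infty hB hκ hp)
    rw [← Complex.re_ofReal_mul] at this
    refine this.trans_eq (congrArg Complex.re ?_)
    simp [boundaryLift, h]
    ring
  · have := mul_nonneg (sq_nonneg (ξ.rep 1)) (D.cone_real hB hκ hp (ξ.rep 0 / ξ.rep 1))
    rw [← Complex.re_ofReal_mul] at this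
    refine this.trans_eq (congrArg Complex.re ?_)
    have h1 : (ξ.rep 1 : ℂ) ≠ 0 := by exact_mod_cast h
    simp [boundaryLift, h]
    field_simp

lemma MLData.abs_im_le (D : MLData F a ν μ) (hB : BoundaryMap F f)
    (ht : ∀ q ∈ Hset, ‖ν q‖ < t) {p : ℂ} (hp : p ∈ Hset) {ξ : RP1} {s : ℝ} {V : Fin 2 → ℝ}
    (hV : s • ξ.rep = V) {B : ℂ} {r : ℝ} (hr : 0 < r)
    (hB' : r * B = conj (a p) * (V 0 - V 1 * conj p) ^ 2) :
    |(B * (boundaryLift f ξ 0 - boundaryLift f ξ 1 * F p) ^ 2).im|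
      ≤ t * (B * (boundaryLift f ξ 0 - boundaryLift f ξ 1 * F p) ^ 2).re := by
  have key : ∀ e : ℝ, e ^ 2 = 1 →
      0 ≤ t * (B * (boundaryLift f ξ 0 - boundaryLift f ξ 1 * F p) ^ 2).re
        + e * (B * (boundaryLift f ξ 0 - boundaryLift f ξ 1 * F p) ^ 2).im := by
    intro e he
    have h1 := mul_nonneg (sq_nonneg s)
      (D.cone_boundaryLift hB (D.coneAdmissible_of_norm_lt ht he) hp ξ)
    rw [← Complex.re_ofReal_mul] at h1
    have h2 : ((s ^ 2 : ℝ) : ℂ) * (conj (t + e * Complex.I : ℂ) * (conj (a p) *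
        (ξ.rep 0 - ξ.rep 1 * conj p) ^ 2
        * (boundaryLift f ξ 0 - boundaryLift f ξ 1 * F p) ^ 2))
        = (r : ℂ) * ((t - e * Complex.I) *
          (B * (boundaryLift f ξ 0 - boundaryLift f ξ 1 * F p) ^ 2)) := by
      rw [mul_left_comm (r : ℂ), ← mul_assoc (r : ℂ), hB', ← hV]
      simp
      ring
    rw [h2, Complex.re_ofReal_mul] at h1
    have h1 := nonneg_of_mul_nonneg_right h1 hr
    rw [Complex.mul_re] at h1
    simpa using h1
  have h1 := key 1 (by norm_num)
  have h2 := key (-1) (by norm_num)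
  exact abs_le.2 ⟨by linarith, by linarith⟩

lemma abs_normSq_sub_le {B c c' : ℂ} (hB : B ≠ 0) (ht : 0 ≤ t)
    (h : |(B * c ^ 2).im| ≤ t * (B * c ^ 2).re)
    (h' : |(Complex.I * B * c' ^ 2).im| ≤ t * (Complex.I * B * c' ^ 2).re) :
    |‖c‖ ^ 2 * ‖c'‖ ^ 2 - 2 * (conj c * c').im ^ 2| ≤ 2 * t * (‖c‖ ^ 2 * ‖c'‖ ^ 2) := by
  set Z := B * c ^ 2 with hZ
  set Z' := Complex.I * B * c' ^ 2 with hZ'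
  have hB0 : 0 < ‖B‖ ^ 2 := by positivity
  have h1 : ‖Z‖ * ‖Z'‖ = ‖B‖ ^ 2 * (‖c‖ ^ 2 * ‖c'‖ ^ 2) := by
    rw [hZ, hZ']
    simp only [norm_mul, norm_pow, Complex.norm_I]
    ring
  have h2 : (conj Z * Z').im
      = ‖B‖ ^ 2 * (‖c‖ ^ 2 * ‖c'‖ ^ 2 - 2 * (conj c * c').im ^ 2) := by
    rw [hZ, hZ']
    simp only [← Complex.normSq_eq_norm_sq, Complex.normSq_apply]
    simp only [map_mul, sq,
      Complex.mul_re, Complex.mul_im, Complex.I_re, Complex.I_im, Complex.conj_re,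
      Complex.conj_im]
    ring
  have h0 : 0 ≤ t * Z.re := (abs_nonneg _).trans h
  have h0' : 0 ≤ t * Z'.re := (abs_nonneg _).trans h'
  have h3 : |(conj Z * Z').im| ≤ 2 * t * (‖Z‖ * ‖Z'‖) := by
    have e1 : (conj Z * Z').im = Z.re * Z'.im - Z.im * Z'.re := by
      simp only [Complex.mul_im, Complex.conj_re, Complex.conj_im]
      ring
    rw [e1]
    refine (abs_sub _ _).trans ?_
    rw [abs_mul, abs_mul]
    have a1 := mul_le_mul (Complex.abs_re_le_norm Z) (h'.trans
      (mul_le_mul_of_nonneg_left (Complex.re_le_norm Z') ht)) (abs_nonneg _) (norm_nonneg _)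
    have a2 := mul_le_mul (h.trans (mul_le_mul_of_nonneg_left (Complex.re_le_norm Z) ht))
      (Complex.abs_re_le_norm Z') (abs_nonneg _) (by positivity)
    linarith
  rw [h1, h2, abs_mul, abs_of_pos hB0] at h3
  exact le_of_mul_le_mul_left (by linarith) hB0

lemma abs_log_le_of_sq_le {x r : ℝ} (hr : 0 < r) (h1 : x ^ 2 ≤ r ^ 2)
    (h2 : 1 ≤ r ^ 2 * x ^ 2) : |Real.log (abs x)| ≤ Real.log r := by
  have hx : x ≠ 0 := by
    rintro rfl
    norm_num at h2
  have hx' := abs_pos.2 hx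
  have h3 : |x| ≤ r := abs_le_of_sq_le_sq h1 hr.le
  have h4 : 1 ≤ r * |x| := by
    rw [← sq_abs x, ← mul_pow] at h2
    exact (one_le_sq_iff₀ (by positivity)).1 h2
  have h5 := Real.log_nonneg h4
  rw [Real.log_mul hr.ne' hx'.ne'] at h5
  exact abs_le.2 ⟨by linarith, Real.log_le_log hx' h3⟩

/-- Four numbers comparable to products of consecutive weights have a quotient close to `1`. -/
lemma sq_quotient_le {s x₁₂ x₂₃ x₃₄ x₄₁ N₁ N₂ N₃ N₄ Y : ℝ} (hs : 0 ≤ s) (hs1 : s < 1)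
    (hY : 0 < Y) (hN₁ : 0 < N₁) (hN₂ : 0 < N₂) (hN₃ : 0 < N₃) (hN₄ : 0 < N₄)
    (h₁₂ : |N₁ * N₂ - Y * x₁₂ ^ 2| ≤ s * (N₁ * N₂))
    (h₂₃ : |N₂ * N₃ - Y * x₂₃ ^ 2| ≤ s * (N₂ * N₃))
    (h₃₄ : |N₃ * N₄ - Y * x₃₄ ^ 2| ≤ s * (N₃ * N₄))
    (h₄₁ : |N₄ * N₁ - Y * x₄₁ ^ 2| ≤ s * (N₄ * N₁)) :
    ((x₄₁ * x₂₃) / (x₁₂ * x₃₄)) ^ 2 ≤ ((1 + s) / (1 - s)) ^ 2 := by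
  rw [abs_le] at *
  have p₁ : 0 < N₁ * N₂ := by positivity
  have p₂ : 0 < N₃ * N₄ := by positivity
  have l₁ : (1 - s) * (N₁ * N₂) ≤ Y * x₁₂ ^ 2 := by linarith
  have l₂ : (1 - s) * (N₃ * N₄) ≤ Y * x₃₄ ^ 2 := by linarith
  have hs1' : 0 < 1 - s := by linarith
  have k₁ : 0 < Y * x₁₂ ^ 2 := (by positivity : 0 < (1 - s) * (N₁ * N₂)).trans_le l₁
  have k₂ : 0 < Y * x₃₄ ^ 2 := (by positivity : 0 < (1 - s) * (N₃ * N₄)).trans_le l₂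
  have lower := mul_le_mul l₁ l₂ (by positivity) k₁.le
  have upper := mul_le_mul (by linarith : Y * x₄₁ ^ 2 ≤ (1 + s) * (N₄ * N₁))
    (by linarith : Y * x₂₃ ^ 2 ≤ (1 + s) * (N₂ * N₃)) (by positivity) (by positivity)
  rw [div_pow, div_pow, div_le_div_iff₀ ?_ (by positivity)]
  · have h := mul_le_mul_of_nonneg_right upper (sq_nonneg (1 - s))
    have h' := mul_le_mul_of_nonneg_left lower (sq_nonneg (1 + s))
    have hY2 : 0 < Y ^ 2 := by positivity
    refine le_of_mul_le_mul_left ?_ hY2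
    nlinarith
  · have : 0 < Y ^ 2 * (x₁₂ * x₃₄) ^ 2 := by
      have := mul_pos k₁ k₂
      nlinarith
    exact pos_of_mul_pos_right this (by positivity)

end Distortion

section Harmonic

variable {F a ν : ℂ → ℂ} {μ : ℂ → ℝ} {f : ℝ → ℝ} {t : ℝ}

lemma norm_boundaryLift_sub_pos (f : ℝ → ℝ) (ξ : RP1) {w : ℂ} (hw : 0 < w.im) :
    0 < ‖(boundaryLift f ξ 0 - boundaryLift f ξ 1 * w : ℂ)‖ ^ 2 := by
  refine pow_pos (norm_pos_iff.2 fun h => ?_) 2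
  rw [boundaryLift] at h
  split_ifs at h with h1
  · simp at h
  · have := congrArg Complex.im h
    simp at this
    exact hw.ne' this

lemma MLData.abs_log_vecCrossRatio_le_of_neg (D : MLData F a ν μ) (hB : BoundaryMap F f)
    (ht : ∀ q ∈ Hset, ‖ν q‖ < t) (ht2 : t < 1 / 2) {z₁ z₂ z₃ z₄ : RP1} {s₁ s₂ s₃ s₄ : ℝ}
    {V₁ V₃ : Fin 2 → ℝ} (h₁ : s₁ • z₁.rep = V₁) (h₂ : s₂ • z₂.rep = V₁ + V₃)
    (h₃ : s₃ • z₃.rep = V₃) (h₄ : s₄ • z₄.rep = V₃ - V₁) (hd : det2 V₁ V₃ < 0) :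
    |Real.log (abs (vecCrossRatio (boundaryLift f z₁) (boundaryLift f z₂) (boundaryLift f z₃)
      (boundaryLift f z₄)))| ≤ Real.log ((1 + 2 * t) / (1 - 2 * t)) := by
  have ht0 : 0 < t := (norm_nonneg _).trans_lt (ht Complex.I (by simp [Hset]))
  set u : ℂ := Complex.I * V₃ 1 + V₁ 1 with hu
  set p : ℂ := (Complex.I * V₃ 0 + V₁ 0) / u with hp
  have hu0 : u ≠ 0 := by
    intro h
    have e1 : V₃ 1 = 0 := by simpa [hu] using congrArg Complex.im h
    have e2 : V₁ 1 = 0 := by simpa [hu] using congrArg Complex.re h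
    simp [det2, e1, e2] at hd
  have hu' : conj u ≠ 0 := by simpa using hu0
  have hpu : conj p * conj u = -Complex.I * V₃ 0 + V₁ 0 := by
    rw [← map_mul, hp, div_mul_cancel₀ _ hu0]
    simp
  have hcu : conj u = -Complex.I * V₃ 1 + V₁ 1 := by simp [hu]
  have hpH : p ∈ Hset := by
    have : p.im = -det2 V₁ V₃ / Complex.normSq u := by
      rw [hp, Complex.div_im, hu, det2]
      simp
      ring
    show 0 < p.im
    rw [this]
    exact div_pos (neg_pos.2 hd) (Complex.normSq_pos.2 hu0)
  have hY := D.im_pos p hpH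
  set C : ℂ := conj (a p) * ((det2 V₁ V₃ : ℝ) / conj u) ^ 2 with hC
  have hC0 : C ≠ 0 := mul_ne_zero ((map_ne_zero _).2 (D.a_ne_zero hpH))
    (pow_ne_zero 2 (div_ne_zero (by exact_mod_cast hd.ne) hu'))
  have hI := Complex.I_sq
  have b₁ : (V₁ 0 - V₁ 1 * conj p : ℂ) = -Complex.I * ((det2 V₁ V₃ : ℝ) / conj u) := by
    rw [← mul_div_assoc, eq_div_iff hu', sub_mul, mul_assoc, hpu, hcu, det2]
    push_cast
    ring
  have b₃ : (V₃ 0 - V₃ 1 * conj p : ℂ) = -((det2 V₁ V₃ : ℝ) / conj u) := by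
    rw [← neg_div, eq_div_iff hu', sub_mul, mul_assoc, hpu, hcu, det2]
    push_cast
    ring
  have k₁ := D.abs_im_le hB ht hpH h₁ (B := -C) (r := 1) one_pos (by
    rw [b₁, hC]
    push_cast
    linear_combination -conj (a p) * ((det2 V₁ V₃ : ℝ) / conj u) ^ 2 * hI)
  have k₂ := D.abs_im_le hB ht hpH h₂ (B := Complex.I * C) (r := 2) two_pos (by
    have : (((V₁ + V₃) 0 : ℝ) - ((V₁ + V₃) 1 : ℝ) * conj p : ℂ)
        = -(1 + Complex.I) * ((det2 V₁ V₃ : ℝ) / conj u) := by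
      simp only [Pi.add_apply]
      push_cast
      linear_combination b₁ + b₃
    rw [this, hC]
    push_cast
    linear_combination -conj (a p) * ((det2 V₁ V₃ : ℝ) / conj u) ^ 2 * hI)
  have k₃ := D.abs_im_le hB ht hpH h₃ (B := C) (r := 1) one_pos (by
    rw [b₃, hC]
    push_cast
    ring)
  have k₄ := D.abs_im_le hB ht hpH h₄ (B := Complex.I * -C) (r := 2) two_pos (by
    have : (((V₃ - V₁) 0 : ℝ) - ((V₃ - V₁) 1 : ℝ) * conj p : ℂ)
        = -(1 - Complex.I) * ((det2 V₁ V₃ : ℝ) / conj u) := by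
      simp only [Pi.sub_apply]
      push_cast
      linear_combination b₃ - b₁
    rw [this, hC]
    push_cast
    linear_combination -conj (a p) * ((det2 V₁ V₃ : ℝ) / conj u) ^ 2 * hI)
  set W : RP1 → Fin 2 → ℝ := boundaryLift f
  set c : RP1 → ℂ := fun z => W z 0 - W z 1 * F p with hc
  have hN : ∀ z, 0 < ‖c z‖ ^ 2 := fun z => norm_boundaryLift_sub_pos f z hY
  have him : ∀ z w, (conj (c z) * c w).im ^ 2 = (F p).im ^ 2 * det2 (W w) (W z) ^ 2 := by
    intro z w
    simp only [hc, det2, map_sub, map_mul, Complex.conj_ofReal, Complex.mul_im, Complex.sub_re,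
      Complex.sub_im, Complex.mul_re, Complex.ofReal_re, Complex.ofReal_im, Complex.conj_re,
      Complex.conj_im]
    ring
  have hsymm : ∀ v w, det2 v w ^ 2 = det2 w v ^ 2 := fun v w => by
    simp only [det2]
    ring
  have c₃₂ := abs_normSq_sub_le hC0 ht0.le k₃ k₂
  have c₂₁ := abs_normSq_sub_le (mul_ne_zero Complex.I_ne_zero hC0) ht0.le k₂
    (c' := c z₁) (by rwa [← mul_assoc, Complex.I_mul_I, neg_one_mul])
  have c₁₄ := abs_normSq_sub_le (neg_ne_zero.2 hC0) ht0.le k₁ k₄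
  have c₄₃ := abs_normSq_sub_le (mul_ne_zero Complex.I_ne_zero (neg_ne_zero.2 hC0)) ht0.le k₄
    (c' := c z₃) (by rwa [← mul_assoc, Complex.I_mul_I, neg_one_mul, neg_neg])
  have hY2 : 0 < 2 * (F p).im ^ 2 := by positivity
  rw [him, ← mul_assoc] at c₃₂ c₂₁ c₁₄ c₄₃
  rw [hsymm] at c₃₂ c₂₁
  have hs : 0 ≤ 2 * t := by linarith
  have hs1 : 2 * t < 1 := by linarith
  have hne : ∀ {N N' x : ℝ}, 0 < N → 0 < N' →
      |N * N' - 2 * (F p).im ^ 2 * x ^ 2| ≤ 2 * t * (N * N') → x ≠ 0 := by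
    rintro N N' x hN hN' h rfl
    have := mul_pos hN hN'
    rw [zero_pow two_ne_zero, mul_zero, sub_zero, abs_of_pos this] at h
    nlinarith
  have n₁ := hne (hN _) (hN _) c₃₂
  have n₂ := hne (hN _) (hN _) c₂₁
  have n₃ := hne (hN _) (hN _) c₁₄
  have n₄ := hne (hN _) (hN _) c₄₃
  have q₁ := sq_quotient_le hs hs1 hY2 (hN _) (hN _) (hN _) (hN _) c₂₁ c₁₄ c₄₃ c₃₂
  have q₂ := sq_quotient_le hs hs1 hY2 (hN _) (hN _) (hN _) (hN _) c₁₄ c₄₃ c₃₂ c₂₁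
  refine abs_log_le_of_sq_le (div_pos (by linarith) (by linarith)) ?_ ?_
  · refine le_trans (le_of_eq ?_) q₁
    rw [vecCrossRatio, mul_comm (det2 (W z₄) (W z₁))]
  · refine le_trans (le_of_eq ?_) (mul_le_mul_of_nonneg_right q₂ (sq_nonneg _))
    rw [vecCrossRatio, ← mul_pow, mul_comm (det2 (W z₄) (W z₁))]
    field_simp

/-- Four harmonic points have lifts `V₁`, `V₁ + V₃`, `V₃` and `V₃ - V₁`. -/
lemma exists_harmonic_lifts {z₁ z₂ z₃ z₄ : RP1} (h : crossRatio z₁ z₂ z₃ z₄ = -1) :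
    ∃ s₁ s₂ s₃ s₄ : ℝ, s₂ • z₂.rep = s₁ • z₁.rep + s₃ • z₃.rep ∧
      s₄ • z₄.rep = s₃ • z₃.rep - s₁ • z₁.rep ∧ det2 (s₁ • z₁.rep) (s₃ • z₃.rep) ≠ 0 := by
  rw [crossRatio] at h
  set v₁ := z₁.rep
  set v₂ := z₂.rep
  set v₃ := z₃.rep
  set v₄ := z₄.rep
  have h0 : det2 v₂ v₁ * det2 v₃ v₄ ≠ 0 := by
    intro h0
    rw [h0, div_zero] at h
    norm_num at h
  rw [div_eq_iff h0] at h
  have h21 : det2 v₂ v₁ ≠ 0 := left_ne_zero_of_mul h0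
  have h1 : det2 v₄ v₁ * det2 v₃ v₂ ≠ 0 := by
    rw [h]
    simpa using h0
  have h41 : det2 v₄ v₁ ≠ 0 := left_ne_zero_of_mul h1
  have h32 : det2 v₃ v₂ ≠ 0 := right_ne_zero_of_mul h1
  have h31 : det2 v₃ v₁ ≠ 0 := by
    intro h31
    have : det2 v₃ v₁ * det2 v₂ v₄ = 2 * (det2 v₂ v₁ * det2 v₃ v₄) := by
      simp only [det2] at h ⊢
      linarith
    rw [h31, zero_mul] at this
    exact h0 (by linarith)
  have hsymm : ∀ v w, det2 v w = -det2 w v := fun v w => by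
    simp only [det2]
    ring
  refine ⟨det2 v₂ v₃, det2 v₁ v₃, det2 v₁ v₂, det2 v₁ v₂ * det2 v₁ v₃ / det2 v₁ v₄, ?_, ?_, ?_⟩
  · ext i
    fin_cases i <;> simp [det2] <;> ring
  · have h14 : det2 v₁ v₄ ≠ 0 := by
      rw [hsymm]
      exact neg_ne_zero.2 h41
    ext i
    simp only [Pi.smul_apply, Pi.sub_apply, smul_eq_mul]
    rw [div_mul_eq_mul_div, div_eq_iff h14]
    simp only [det2] at h ⊢
    fin_cases i
    · simp only [Fin.zero_eta]
      linear_combination v₁ 0 * h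
    · simp only [Fin.mk_one]
      linear_combination v₁ 1 * h
  · have : det2 (det2 v₂ v₃ • v₁) (det2 v₁ v₂ • v₃) = det2 v₃ v₂ * det2 v₂ v₁ * -det2 v₃ v₁ := by
      simp only [det2, Pi.smul_apply, smul_eq_mul]
      ring
    rw [this]
    exact mul_ne_zero (mul_ne_zero h32 h21) (neg_ne_zero.2 h31)

lemma MLData.abs_log_vecCrossRatio_le (D : MLData F a ν μ) (hB : BoundaryMap F f)
    (ht : ∀ q ∈ Hset, ‖ν q‖ < t) (ht2 : t < 1 / 2) {z₁ z₂ z₃ z₄ : RP1}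
    (h : crossRatio z₁ z₂ z₃ z₄ = -1) :
    |Real.log (abs (vecCrossRatio (boundaryLift f z₁) (boundaryLift f z₂) (boundaryLift f z₃)
      (boundaryLift f z₄)))| ≤ Real.log ((1 + 2 * t) / (1 - 2 * t)) := by
  obtain ⟨s₁, s₂, s₃, s₄, h₂, h₄, hd⟩ := exists_harmonic_lifts h
  rcases hd.lt_or_gt with hd | hd
  · exact D.abs_log_vecCrossRatio_le_of_neg hB ht ht2 rfl h₂ rfl h₄ hd
  · have key := D.abs_log_vecCrossRatio_le_of_neg hB ht ht2 (z₁ := z₁) (z₂ := z₄) (z₃ := z₃)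
      (z₄ := z₂) (s₁ := -s₁) (s₂ := s₄) (s₃ := s₃) (s₄ := s₂) rfl (by rw [h₄, neg_smul]; abel) rfl
      (by rw [h₂, neg_smul]; abel) (by
        simp only [det2, Pi.smul_apply, smul_eq_mul] at hd ⊢
        linarith)
    have hinv : vecCrossRatio (boundaryLift f z₁) (boundaryLift f z₄) (boundaryLift f z₃)
        (boundaryLift f z₂) = (vecCrossRatio (boundaryLift f z₁) (boundaryLift f z₂)
          (boundaryLift f z₃) (boundaryLift f z₄))⁻¹ := by
      rw [vecCrossRatio, vecCrossRatio, inv_div]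
    rwa [hinv, abs_inv, Real.log_inv, abs_neg] at key

lemma crossRatio_symm_infty (x : ℝ) {t : ℝ} (ht : t ≠ 0) :
    crossRatio (finitePt (x - t)) (finitePt x) (finitePt (x + t)) inftyPt = -1 := by
  obtain ⟨r₁, h₁, e₁⟩ := exists_rep_finitePt (x - t)
  obtain ⟨r₂, h₂, e₂⟩ := exists_rep_finitePt x
  obtain ⟨r₃, h₃, e₃⟩ := exists_rep_finitePt (x + t)
  obtain ⟨r₄, h₄, e₄⟩ := exists_rep_inftyPt
  rw [crossRatio, e₁, e₂, e₃, e₄]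
  simp [det2]
  field_simp
  ring_nf
  rw [mul_inv_cancel₀ ht]

lemma LiftsTo.midpointBound {φ : RP1 → RP1} (hL : LiftsTo f φ) (hf : StrictMono f) {M : ℝ}
    (hM : 1 ≤ M) (h : ∀ r ∈ crSet φ, r ≤ Real.log M) : MidpointBound M f := by
  intro x t ht
  have hr := h _ ⟨_, _, _, _, crossRatio_symm_infty x ht.ne', rfl⟩
  have h1 : 0 < f x - f (x - t) := sub_pos.2 (hf (by linarith))
  have h2 : 0 < f (x + t) - f x := sub_pos.2 (hf (by linarith))
  have hv : vecCrossRatio ![f (x - t), 1] ![f x, 1] ![f (x + t), 1] ![1, 0]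
      = -((f (x + t) - f x) / (f x - f (x - t))) := by
    simp [vecCrossRatio, det2]
    rw [← neg_sub (f x) (f (x - t)), div_neg]
  have hM0 : 0 < M := by linarith
  rw [hL.crossRatio_eq, boundaryLift_finitePt, boundaryLift_finitePt, boundaryLift_finitePt,
    boundaryLift_inftyPt, hv, abs_neg, abs_of_pos (div_pos h2 h1), abs_le, ← Real.log_inv,
    Real.log_le_log_iff (inv_pos.2 hM0) (div_pos h2 h1),
    Real.log_le_log_iff (div_pos h2 h1) hM0, div_le_iff₀ h1, le_div_iff₀ h1,
    inv_mul_le_iff₀ hM0] at hr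
  exact hr

end Harmonic

lemma exists_log_sinh_lt {C : ℝ} (hC : C < 1 / 2) : ∃ δ > 0, ∀ N : ℝ, 0 < N → N < δ →
    Real.sinh (C * N / 2) < 1 / 2 ∧
      Real.log ((1 + 2 * Real.sinh (C * N / 2)) / (1 - 2 * Real.sinh (C * N / 2))) < N := by
  have hs : HasDerivAt (fun N => Real.sinh (C * N / 2)) (C / 2) 0 := by
    have h1 : HasDerivAt (fun N : ℝ => C * N / 2) (C / 2) 0 := by
      simpa using ((hasDerivAt_id (0 : ℝ)).const_mul C).div_const 2
    simpa using h1.sinh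
  have hg : HasDerivAt (fun N => N - (Real.log (1 + 2 * Real.sinh (C * N / 2))
      - Real.log (1 - 2 * Real.sinh (C * N / 2)))) (1 - 2 * C) 0 := by
    have h1 := ((hs.const_mul 2).const_add 1).log (by simp)
    have h2 := ((hs.const_mul 2).const_sub 1).log (by simp)
    refine ((hasDerivAt_id (0 : ℝ)).sub (h1.sub h2)).congr_deriv ?_
    simp
    ring
  have hpos : ∀ᶠ N in 𝓝[>] (0 : ℝ), 0 < N - (Real.log (1 + 2 * Real.sinh (C * N / 2))
      - Real.log (1 - 2 * Real.sinh (C * N / 2))) := by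
    have h1 := (hasDerivAt_iff_tendsto_slope.1 hg).mono_left
      (nhdsWithin_mono (0 : ℝ) fun x (hx : 0 < x) => hx.ne')
    filter_upwards [h1.eventually_const_lt (by linarith : (0 : ℝ) < 1 - 2 * C),
      self_mem_nhdsWithin] with N hN (hN0 : 0 < N)
    rw [slope_def_field] at hN
    simp only [mul_zero, zero_div, Real.sinh_zero, add_zero, sub_zero, Real.log_one] at hN
    exact (div_pos_iff_of_pos_right hN0).1 hN
  have hsmall : ∀ᶠ N in 𝓝[>] (0 : ℝ), Real.sinh (C * N / 2) ∈ Ioo (-(1 / 2) : ℝ) (1 / 2) := by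
    refine nhdsWithin_le_nhds (hs.continuousAt.eventually_mem (Ioo_mem_nhds ?_ ?_)) <;> norm_num
  obtain ⟨δ, hδ, hmem⟩ := mem_nhdsGT_iff_exists_Ioo_subset.1 (hpos.and hsmall)
  refine ⟨δ, hδ, fun N hN hNδ => ?_⟩
  obtain ⟨h1, h2, h3⟩ := hmem ⟨hN, hNδ⟩
  refine ⟨h3, ?_⟩
  rw [Real.log_div (by linarith) (by linarith)]
  linarith

lemma crNorm_nonneg (φ : RP1 → RP1) : 0 ≤ crNorm φ :=
  Real.sSup_nonneg fun _ ⟨_, _, _, _, _, h⟩ => h ▸ abs_nonneg _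

lemma norm_le_sinh_of_sq_le {m n K : ℝ} (hm : 0 < m) (hn : 0 ≤ n) (h : m ^ 2 = 1 + n ^ 2)
    (hK : (m + n) ^ 2 ≤ K) : n ≤ Real.sinh (Real.log K / 2) := by
  have h1 : (m + n) * (m - n) = 1 := by linarith
  have h2 : 0 < m + n := by linarith
  have h3 : Real.sinh (Real.log (m + n)) = n := by
    rw [Real.sinh_eq, Real.exp_neg, Real.exp_log h2, inv_eq_of_mul_eq_one_right h1]
    ring
  rw [← h3]
  refine Real.sinh_le_sinh.2 ?_
  have h4 := Real.log_le_log (by positivity) hK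
  rw [Real.log_pow] at h4
  push_cast at h4
  linarith

end AdSPaper

namespace AdSPaper

/-- **Theorem F.** For every constant `C₀ < 1/2` there exists `δ > 0` such that, for any
quasisymmetric homeomorphism `φ` of `ℝP¹` with cross-ratio norm `‖φ‖_cr < δ`, the minimal
Lagrangian extension `Φ_ML : ℍ² → ℍ²` of `φ` has maximal dilatation bounded below by
`C₀·‖φ‖_cr ≤ ln K(Φ_ML)`. -/
theorem crNorm_le_log_maxDilatation :
    ∀ C₀ : ℝ, C₀ < 1 / 2 →
      ∃ δ : ℝ, 0 < δ ∧
        ∀ φ : RP1 ≃ₜ RP1, Quasisymmetric φ → crNorm ⇑φ < δ →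
          ∀ Φ : ℂ → ℂ, IsMinimalLagrangianExtension Φ ⇑φ →
            C₀ * crNorm ⇑φ ≤ Real.log (maxDilatation Φ) := by
  intro C₀ hC₀
  obtain ⟨M, hM, hμ⟩ := exists_uniform_mu_le
  obtain ⟨δ, hδ, hδ'⟩ := exists_log_sinh_lt hC₀
  refine ⟨min δ (Real.log M), lt_min hδ (Real.log_pos hM), fun φ hφ hN Φ hΦ => ?_⟩
  obtain ⟨F, a, ν, μ, f, D, hB, hL, hdil⟩ := exists_normalized φ.injective hΦ
  have hinj := hL.injective φ.injective
  have hle : ∀ r ∈ crSet φ, r ≤ crNorm φ := fun r hr => le_csSup hφ.2 hr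
  have hmid : MidpointBound M f :=
    hL.midpointBound ((hB.monotone D).strictMono_of_injective hinj) hM.le
      fun r hr => (hle r hr).trans (hN.trans_le (min_le_right _ _)).le
  have hμ3 := hμ F a ν μ f D hB hinj hmid
  have hbdd : BddAbove (range fun z : Hset => dilatationAt Φ (z : ℂ)) := by
    refine ⟨36, ?_⟩
    rintro _ ⟨z, rfl⟩
    beta_reduce
    rw [hdil z z.2]
    have h1 := hμ3 z z.2
    have h2 := D.norm_nu_lt z.2
    have h3 := norm_nonneg (ν z)
    have h4 := D.mu_pos z z.2
    nlinarith
  have hK : ∀ q ∈ Hset, (μ q + ‖ν q‖) ^ 2 ≤ maxDilatation Φ := fun q hq => by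
    rw [← hdil q hq]
    exact le_ciSup hbdd (⟨q, hq⟩ : Hset)
  have hν : ∀ q ∈ Hset, ‖ν q‖ ≤ Real.sinh (Real.log (maxDilatation Φ) / 2) := fun q hq =>
    norm_le_sinh_of_sq_le (D.mu_pos q hq) (norm_nonneg _) (D.mu_sq q hq) (hK q hq)
  have hlog : 0 ≤ Real.log (maxDilatation Φ) := by
    have hI : Complex.I ∈ Hset := by simp [Hset]
    have := (norm_nonneg _).trans (hν _ hI)
    rw [Real.sinh_nonneg_iff] at this
    linarith
  rcases (crNorm_nonneg φ).eq_or_lt with h0 | h0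
  · rwa [← h0, mul_zero]
  by_contra! hlt
  obtain ⟨h1, h2⟩ := hδ' _ h0 (hN.trans_le (min_le_left _ _))
  have hν' : ∀ q ∈ Hset, ‖ν q‖ < Real.sinh (C₀ * crNorm φ / 2) := fun q hq =>
    (hν q hq).trans_lt (Real.sinh_lt_sinh.2 (by linarith))
  refine h2.not_ge (csSup_le ⟨_, _, _, _, _, crossRatio_symm_infty 0 one_ne_zero, rfl⟩ ?_)
  rintro r ⟨z₁, z₂, z₃, z₄, hz, rfl⟩
  rw [hL.crossRatio_eq]
  exact D.abs_log_vecCrossRatio_le hB hν' h1 hz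

end AdSPaper
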